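/- Let Ω ⊂ ℝⁿ (n ≥ 2) be a domain and u ∈ C^{1,β}_{loc}(Ω) a weak solution of -Δ_p u = f in Ω. Let α̃ ≥ 3 and set q = 2(α̃ - 1). Assume max{2 - 1/(2α̃-1), 2 - 1/C(n,q)} < p ≤ 2 and f ∈ W^{2,2(α̃-1)/3}_{loc}(Ω) ∩ C^{1,β'}_{loc}(Ω). Then the stress field |∇u|^{p-2} ∇u belongs to W^{1,α̃}_{loc}(Ω). -/

import Mathlib

open MeasureTheory Real Set
open scoped InnerProductSpace ENNReal NNReal Topology

noncomputable section

abbrev Euc (n : ℕ) : Type := EuclideanSpace ℝ (Fin n)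

variable {n : ℕ}

/-- A smooth test function compactly supported in `Ω`. -/
def IsTestFun (Ω : Set (Euc n)) (ψ : Euc n → ℝ) : Prop :=
  ContDiff ℝ (⊤ : ℕ∞) ψ ∧ HasCompactSupport ψ ∧ tsupport ψ ⊆ Ω

/-- `u` is a weak solution of `-Δ_p u = f` in `Ω`. -/
def IsPWeakSol (p : ℝ) (Ω : Set (Euc n)) (u f : Euc n → ℝ) : Prop :=
  ∀ ψ : Euc n → ℝ, IsTestFun Ω ψ →
    (∫ x in Ω, ‖gradient u x‖ ^ (p - 2) * ⟪gradient u x, gradient ψ x⟫_ℝ) =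
      ∫ x in Ω, f x * ψ x

/-- `f ∈ C^{0,β}_loc(Ω)`. -/
def C0Loc (Ω : Set (Euc n)) (β : ℝ≥0) (f : Euc n → ℝ) : Prop :=
  ContinuousOn f Ω ∧
  ∀ K : Set (Euc n), K ⊆ Ω → IsCompact K → ∃ C : ℝ≥0, HolderOnWith C β f K

/-- `u ∈ C^{1,β}_loc(Ω)`. -/
def C1Loc (Ω : Set (Euc n)) (β : ℝ≥0) (u : Euc n → ℝ) : Prop :=
  (∀ x ∈ Ω, DifferentiableAt ℝ u x) ∧
  ∀ K : Set (Euc n), K ⊆ Ω → IsCompact K →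
    ∃ C : ℝ≥0, HolderOnWith C β (fun x => gradient u x) K

/-- The `i`-th partial derivative of `g`. -/
def pd (g : Euc n → ℝ) (i : Fin n) (x : Euc n) : ℝ :=
  fderiv ℝ g x (EuclideanSpace.single i 1)

/-- `h` is the weak `i`-th partial derivative of `g` on `Ω`. -/
def HasWeakPD (Ω : Set (Euc n)) (g h : Euc n → ℝ) (i : Fin n) : Prop :=
  ∀ ψ : Euc n → ℝ, IsTestFun Ω ψ →
    (∫ x in Ω, g x * pd ψ i x) = - ∫ x in Ω, h x * ψ x

/-- `g ∈ W^{1,q}_loc(Ω)`. -/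
def MemW1Loc (Ω : Set (Euc n)) (q : ℝ) (g : Euc n → ℝ) : Prop :=
  ∃ d : Fin n → Euc n → ℝ,
    (∀ i, HasWeakPD Ω g (d i) i) ∧
    ∀ K : Set (Euc n), K ⊆ Ω → IsCompact K →
      IntegrableOn (fun x => |g x| ^ q) K volume ∧
      ∀ i, IntegrableOn (fun x => |d i x| ^ q) K volume

/-- `g ∈ W^{2,q}_loc(Ω)`. -/
def MemW2Loc (Ω : Set (Euc n)) (q : ℝ) (g : Euc n → ℝ) : Prop :=
  ∃ d : Fin n → Euc n → ℝ, ∃ d2 : Fin n → Fin n → Euc n → ℝ,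
    (∀ i, HasWeakPD Ω g (d i) i) ∧
    (∀ i j, HasWeakPD Ω (d i) (d2 i j) j) ∧
    ∀ K : Set (Euc n), K ⊆ Ω → IsCompact K →
      IntegrableOn (fun x => |g x| ^ q) K volume ∧
      (∀ i, IntegrableOn (fun x => |d i x| ^ q) K volume) ∧
      (∀ i j, IntegrableOn (fun x => |d2 i j x| ^ q) K volume)

/-- The Laplacian of `w`. -/
def lapl (w : Euc n → ℝ) (x : Euc n) : ℝ :=
  ∑ i : Fin n, iteratedFDeriv ℝ 2 w x ![EuclideanSpace.single i 1, EuclideanSpace.single i 1]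

/-- The Calderón–Zygmund constant `C(n,q)`: the best constant in
`‖D²w‖_{L^q} ≤ C ‖Δw‖_{L^q}`. -/
def CZ (n : ℕ) (q : ℝ) : ℝ :=
  sInf {C : ℝ | 0 ≤ C ∧ ∀ w : Euc n → ℝ, ContDiff ℝ (⊤ : ℕ∞) w → HasCompactSupport w →
    (∫ x, ‖iteratedFDeriv ℝ 2 w x‖ ^ q) ^ (1 / q) ≤ C * (∫ x, |lapl w x| ^ q) ^ (1 / q)}

/-- The critical set `Z_u` of `u`. -/
def Zset (u : Euc n → ℝ) : Set (Euc n) := {x | gradient u x = 0}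

/-- The recursion `q_N = 2 (q_{N-1} - 1)` starting from `q0`. -/
def qseq (q0 : ℝ) : ℕ → ℝ
  | 0 => q0
  | N + 1 => 2 * (qseq q0 N - 1)

/-- `A` is compactly contained in `Ω`. -/
def CptIn (A Ω : Set (Euc n)) : Prop :=
  IsOpen A ∧ IsCompact (closure A) ∧ closure A ⊆ Ω

/-- `v` is a weak solution of the regularized problem
`-div((ε + |∇v|²)^{(p-2)/2} ∇v) = f` in `B`. -/
def IsRegWeakSol (p ε : ℝ) (B : Set (Euc n)) (v f : Euc n → ℝ) : Prop :=
  ∀ ψ : Euc n → ℝ, IsTestFun B ψ →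
    (∫ x in B, (ε + ‖gradient v x‖ ^ (2 : ℝ)) ^ ((p - 2) / 2) *
        ⟪gradient v x, gradient ψ x⟫_ℝ) =
      ∫ x in B, f x * ψ x


section HilbertAverages

variable {X : Type*} [NormedAddCommGroup X] [InnerProductSpace ℝ X]

theorem sum_sum_norm_sub_sq (N : ℕ) (a : ℕ → X) :
    ∑ j ∈ Finset.range N, ∑ k ∈ Finset.range N, ‖a j - a k‖ ^ 2 =
      2 * N * ∑ j ∈ Finset.range N, ‖a j‖ ^ 2 - 2 * ‖∑ j ∈ Finset.range N, a j‖ ^ 2 := by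
  have h1 : ‖∑ j ∈ Finset.range N, a j‖ ^ 2 =
      ∑ j ∈ Finset.range N, ∑ k ∈ Finset.range N, ⟪a j, a k⟫_ℝ := by
    rw [← real_inner_self_eq_norm_sq, sum_inner]
    simp_rw [inner_sum]
  simp_rw [norm_sub_sq_real, Finset.sum_add_distrib, Finset.sum_sub_distrib, ← Finset.mul_sum,
    Finset.sum_const, Finset.card_range, h1, nsmul_eq_mul, ← Finset.mul_sum]
  ring

/-- The averages of the orbit of an isometry are controlled by the loss of norm of averages of
twice the length. -/
theorem norm_sum_orbit_sub_sq_le (U : X →ₗᵢ[ℝ] X) (x : X) (M : ℕ) :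
    ‖∑ j ∈ Finset.range M, (U ^ j) x - (M : ℝ) • x‖ ^ 2 ≤
      2 * (4 * (M : ℝ) ^ 2 * ‖x‖ ^ 2 - ‖∑ j ∈ Finset.range (2 * M), (U ^ j) x‖ ^ 2) := by
  have hvar := sum_sum_norm_sub_sq (2 * M) (fun j => (U ^ j) x)
  have hiso : ∀ j, ‖(U ^ j) x‖ = ‖x‖ := fun j => (U ^ j).norm_map x
  simp_rw [hiso] at hvar
  simp only [Finset.sum_const, Finset.card_range, nsmul_eq_mul, Nat.cast_mul, Nat.cast_ofNat]
    at hvar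
  have hlow : (M : ℝ) * ∑ m ∈ Finset.range M, ‖(U ^ m) x - x‖ ^ 2 ≤
      ∑ j ∈ Finset.range (2 * M), ∑ k ∈ Finset.range (2 * M), ‖(U ^ j) x - (U ^ k) x‖ ^ 2 := by
    rw [Finset.sum_comm]
    calc (M : ℝ) * ∑ m ∈ Finset.range M, ‖(U ^ m) x - x‖ ^ 2
        = ∑ k ∈ Finset.range M, ∑ m ∈ Finset.range M, ‖(U ^ (m + k)) x - (U ^ k) x‖ ^ 2 := by
          have : ∀ k m : ℕ, ‖(U ^ (m + k)) x - (U ^ k) x‖ = ‖(U ^ m) x - x‖ := by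
            intro k m
            rw [add_comm, pow_add, LinearIsometry.coe_mul, Function.comp_apply,
              ← map_sub, LinearIsometry.norm_map]
          simp [this]
      _ ≤ ∑ k ∈ Finset.range M, ∑ j ∈ Finset.range (2 * M), ‖(U ^ j) x - (U ^ k) x‖ ^ 2 := by
          refine Finset.sum_le_sum fun k hk => ?_
          rw [Finset.mem_range] at hk
          have := Finset.sum_image (s := Finset.range M) (g := fun m => m + k)
            (f := fun j => ‖(U ^ j) x - (U ^ k) x‖ ^ 2) (fun a _ b _ h => by simpa using h)
          rw [← this]
          refine Finset.sum_le_sum_of_subset_of_nonneg ?_ (fun _ _ _ => by positivity)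
          intro j hj
          simp only [Finset.mem_image, Finset.mem_range] at hj ⊢
          omega
      _ ≤ _ := by
          refine Finset.sum_le_sum_of_subset_of_nonneg ?_
            (fun _ _ _ => Finset.sum_nonneg fun _ _ => by positivity)
          exact Finset.range_mono (by omega)
  have hcs : ‖∑ j ∈ Finset.range M, (U ^ j) x - (M : ℝ) • x‖ ^ 2 ≤
      (M : ℝ) * ∑ m ∈ Finset.range M, ‖(U ^ m) x - x‖ ^ 2 := by
    have e : ∑ j ∈ Finset.range M, (U ^ j) x - (M : ℝ) • x =
        ∑ m ∈ Finset.range M, ((U ^ m) x - x) := by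
      rw [Finset.sum_sub_distrib]; simp [Nat.cast_smul_eq_nsmul]
    rw [e]
    calc _ ≤ (∑ m ∈ Finset.range M, ‖(U ^ m) x - x‖) ^ 2 := by
          gcongr; exact norm_sum_le _ _
      _ ≤ _ := by
          simpa using sq_sum_le_card_mul_sum_sq (s := Finset.range M)
            (f := fun m => ‖(U ^ m) x - x‖)
  nlinarith

/-- Bounded dyadic difference quotients of a one-parameter semigroup of isometries converge. -/
theorem cauchySeq_dyadic_quotient (τ : ℝ → X →ₗᵢ[ℝ] X) (hadd : ∀ s t, τ (s + t) = τ s * τ t)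
    (h0 : τ 0 = 1) (v : X) (C : ℝ)
    (hC : ∀ᶠ k : ℕ in Filter.atTop, ‖(2 : ℝ) ^ k • (τ ((1 / 2) ^ k) v - v)‖ ≤ C) :
    CauchySeq (fun k : ℕ => (2 : ℝ) ^ k • (τ ((1 / 2) ^ k) v - v)) := by
  set x : ℕ → X := fun k => (2 : ℝ) ^ k • (τ ((1 / 2) ^ k) v - v) with hx
  have hpow : ∀ (t : ℝ) (j : ℕ), (τ t) ^ j = τ (j * t) := by
    intro t j
    induction j with
    | zero => simp [h0]
    | succ j ih => rw [pow_succ, ih, ← hadd]; congr 1; push_cast; ring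
  have hsum : ∀ k m : ℕ, ∑ j ∈ Finset.range (2 ^ m), ((τ ((1 / 2) ^ (k + m))) ^ j) (x (k + m)) =
      (2 : ℝ) ^ m • x k := by
    intro k m
    simp only [hx, map_smul, ← Finset.smul_sum, map_sub]
    have : ∀ j, ((τ ((1 / 2) ^ (k + m))) ^ j) (τ ((1 / 2) ^ (k + m)) v) =
        ((τ ((1 / 2) ^ (k + m))) ^ (j + 1)) v := by
      intro j; rw [pow_succ, LinearIsometry.coe_mul, Function.comp_apply]
    simp_rw [this]
    rw [Finset.sum_range_sub (fun j => ((τ ((1 / 2) ^ (k + m))) ^ j) v), hpow, smul_smul, ← pow_add,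
      add_comm m k]
    congr 3
    · push_cast
      rw [pow_add]
      congr 1
      have : (2:ℝ) ^ m * (1 / 2) ^ m = 1 := by rw [← mul_pow]; norm_num
      rw [mul_left_comm, this, mul_one]
  have hmono : Monotone fun k => ‖x k‖ := by
    refine monotone_nat_of_le_succ fun k => ?_
    have := hsum k 1
    have h2 : ‖(2 : ℝ) ^ 1 • x k‖ ≤ 2 * ‖x (k + 1)‖ := by
      rw [← this]
      refine (norm_sum_le _ _).trans ?_
      simp
    rw [norm_smul] at h2
    norm_num at h2
    exact h2
  have hkey : ∀ k m : ℕ, ‖x (k + 1) - x (k + 1 + m)‖ ^ 2 ≤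
      8 * (‖x (k + 1 + m)‖ ^ 2 - ‖x k‖ ^ 2) := by
    intro k m
    have := norm_sum_orbit_sub_sq_le (τ ((1 / 2) ^ (k + 1 + m))) (x (k + 1 + m)) (2 ^ m)
    rw [hsum (k + 1) m] at this
    have h2 := hsum k (m + 1)
    rw [show k + (m + 1) = k + 1 + m by ring, show 2 ^ (m + 1) = 2 * 2 ^ m by ring] at h2
    rw [h2] at this
    push_cast at this
    rw [← smul_sub, norm_smul ((2 : ℝ) ^ m), norm_smul ((2 : ℝ) ^ (m + 1)), mul_pow, mul_pow] at this
    have hp : (0 : ℝ) < (2 ^ m) ^ 2 := by positivity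
    rw [Real.norm_of_nonneg (by positivity), Real.norm_of_nonneg (by positivity)] at this
    have h4 : ((2 : ℝ) ^ (m + 1)) ^ 2 = 4 * (2 ^ m) ^ 2 := by ring
    rw [h4] at this
    have : (2 ^ m) ^ 2 * ‖x (k + 1) - x (k + 1 + m)‖ ^ 2 ≤
        (2 ^ m) ^ 2 * (8 * (‖x (k + 1 + m)‖ ^ 2 - ‖x k‖ ^ 2)) := by linarith
    exact le_of_mul_le_mul_left this hp
  obtain ⟨L, hL⟩ : ∃ L, Filter.Tendsto (fun k => ‖x k‖ ^ 2) Filter.atTop (𝓝 L) := by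
    have hm2 : Monotone fun k => ‖x k‖ ^ 2 := fun a b h =>
      pow_le_pow_left₀ (norm_nonneg _) (hmono h) 2
    refine ⟨_, tendsto_atTop_ciSup hm2 ?_⟩
    obtain ⟨k0, hk0⟩ := Filter.eventually_atTop.1 hC
    refine ⟨C ^ 2, ?_⟩
    rintro _ ⟨k, rfl⟩
    exact pow_le_pow_left₀ (norm_nonneg _)
      ((hmono (le_max_left k k0)).trans (hk0 _ (le_max_right k k0))) 2
  have hcauchy := hL.cauchySeq
  rw [Metric.cauchySeq_iff'] at hcauchy ⊢
  intro ε hε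
  have hL2 : ∀ᶠ k in Filter.atTop, |‖x k‖ ^ 2 - L| < ε ^ 2 / 32 := by
    have := (Metric.tendsto_atTop.1 hL) (ε ^ 2 / 32) (by positivity)
    exact Filter.eventually_atTop.2 this
  obtain ⟨N, hN⟩ := Filter.eventually_atTop.1 hL2
  refine ⟨N + 1, fun l hl => ?_⟩
  obtain ⟨m, rfl⟩ := Nat.exists_eq_add_of_le hl
  have h1 := hkey N m
  have h2 := abs_lt.1 (hN N le_rfl)
  have h3 := abs_lt.1 (hN (N + 1 + m) (by omega))
  rw [dist_eq_norm, norm_sub_rev]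
  refine lt_of_pow_lt_pow_left₀ 2 hε.le ?_
  nlinarith

end HilbertAverages

section DominatedSubsequence

variable {α E : Type*} [MeasurableSpace α] {μ : Measure α} [NormedAddCommGroup E]

/-- Finitely many sequences converging in `L²` have a common subsequence that converges almost
everywhere and is dominated by a square integrable function. -/
theorem exists_subseq_dominated {ι : Type*} [Fintype ι] (x : ι → ℕ → Lp E 2 μ) (H : ι → Lp E 2 μ)
    (hx : ∀ i, Filter.Tendsto (x i) Filter.atTop (𝓝 (H i))) :
    ∃ φ : ℕ → ℕ, StrictMono φ ∧ ∃ Z : α → ℝ, Integrable Z μ ∧ (∀ a, 0 ≤ Z a) ∧ ∀ i,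
      (∀ᵐ a ∂μ, Filter.Tendsto (fun k => x i (φ k) a) Filter.atTop (𝓝 (H i a))) ∧
      ∀ k, ∀ᵐ a ∂μ, ‖x i (φ k) a‖ ^ 2 ≤ Z a := by
  have hev : ∀ k : ℕ, ∀ᶠ m in Filter.atTop, ∀ i, ‖x i m - H i‖ ≤ (1 / 2) ^ k := by
    intro k
    rw [Filter.eventually_all]
    intro i
    have := (tendsto_iff_norm_sub_tendsto_zero.1 (hx i)).eventually
      (eventually_le_nhds (b := (1 / 2 : ℝ) ^ k) (by positivity))
    exact this
  obtain ⟨φ, hφ, hφk⟩ := Filter.extraction_forall_of_eventually hev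
  refine ⟨φ, hφ, ?_⟩
  set S : α → ℝ≥0∞ := fun a => ∑' k, ∑ i, ‖x i (φ k) a - H i a‖ₑ ^ 2 with hS
  have hSmeas : AEMeasurable S μ := by
    refine AEMeasurable.tsum fun k => ?_
    refine Finset.aemeasurable_fun_sum _ fun i _ => ?_
    exact (((Lp.aestronglyMeasurable _).sub (Lp.aestronglyMeasurable _)).enorm).pow_const 2
  have hterm : ∀ k i, ∫⁻ a, ‖x i (φ k) a - H i a‖ₑ ^ 2 ∂μ ≤ ENNReal.ofReal ((1 / 4) ^ k) := by
    intro k i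
    have h1 : eLpNorm (x i (φ k) - H i : Lp E 2 μ) 2 μ ≤ ENNReal.ofReal ((1 / 2) ^ k) := by
      have := hφk k i
      rw [Lp.norm_def] at this
      exact (ENNReal.le_ofReal_iff_toReal_le (Lp.eLpNorm_ne_top _) (by positivity)).2 this
    have h2 : ∫⁻ a, ‖x i (φ k) a - H i a‖ₑ ^ 2 ∂μ =
        (eLpNorm (x i (φ k) - H i : Lp E 2 μ) 2 μ) ^ 2 := by
      rw [eLpNorm_eq_lintegral_rpow_enorm_toReal (by norm_num) (by norm_num)]
      simp only [ENNReal.toReal_ofNat, one_div]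
      rw [← ENNReal.rpow_natCast, ← ENNReal.rpow_mul]
      norm_num
      refine lintegral_congr_ae ?_
      filter_upwards [Lp.coeFn_sub (x i (φ k)) (H i)] with a ha
      rw [← Pi.sub_apply, ← ha]; rfl
    rw [h2]
    calc _ ≤ (ENNReal.ofReal ((1 / 2) ^ k)) ^ 2 := by gcongr
      _ = _ := by
        rw [← ENNReal.ofReal_pow (by positivity), ← pow_mul, mul_comm, pow_mul]; norm_num
  have hSint : ∫⁻ a, S a ∂μ ≠ ∞ := by
    rw [hS, lintegral_tsum]
    · have : ∀ k, ∫⁻ a, ∑ i, ‖x i (φ k) a - H i a‖ₑ ^ 2 ∂μ ≤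
          Fintype.card ι * ENNReal.ofReal ((1 / 4) ^ k) := by
        intro k
        rw [lintegral_finsetSum']
        · refine (Finset.sum_le_sum fun i _ => hterm k i).trans ?_
          simp
        · intro i _
          exact (((Lp.aestronglyMeasurable _).sub (Lp.aestronglyMeasurable _)).enorm).pow_const 2
      refine ne_top_of_le_ne_top ?_ (ENNReal.tsum_le_tsum this)
      rw [ENNReal.tsum_mul_left]
      refine ENNReal.mul_ne_top (by simp) ?_
      rw [← ENNReal.ofReal_tsum_of_nonneg (fun k => by positivity)
        (summable_geometric_of_lt_one (by norm_num) (by norm_num))]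
      exact ENNReal.ofReal_ne_top
    · intro k
      refine Finset.aemeasurable_fun_sum _ fun i _ => ?_
      exact (((Lp.aestronglyMeasurable _).sub (Lp.aestronglyMeasurable _)).enorm).pow_const 2
  have hSfin : ∀ᵐ a ∂μ, S a < ∞ := ae_lt_top' hSmeas hSint
  have hle : ∀ a, S a < ∞ → ∀ i k, ‖x i (φ k) a - H i a‖ ^ 2 ≤ (S a).toReal := by
    intro a ha i k
    have h1 : ‖x i (φ k) a - H i a‖ₑ ^ 2 ≤ S a :=
      (Finset.single_le_sum (f := fun i => ‖x i (φ k) a - H i a‖ₑ ^ 2) (fun _ _ => by simp)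
        (Finset.mem_univ i)).trans (ENNReal.le_tsum k)
    have := ENNReal.toReal_mono ha.ne h1
    simpa using this
  refine ⟨fun a => 2 * ((S a).toReal + ∑ i, ‖H i a‖ ^ 2), ?_, fun a => by positivity, fun i =>
    ⟨?_, fun k => ?_⟩⟩
  · refine Integrable.const_mul (Integrable.add ?_ ?_) 2
    · exact integrable_toReal_of_lintegral_ne_top hSmeas hSint
    · refine integrable_finsetSum _ fun i _ => ?_
      exact (Lp.memLp (H i)).integrable_norm_pow (by norm_num)
  · filter_upwards [hSfin] with a ha
    have h1 : Filter.Tendsto (fun k => ∑ i, ‖x i (φ k) a - H i a‖ₑ ^ 2) Filter.atTop (𝓝 0) :=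
      ENNReal.tendsto_atTop_zero_of_tsum_ne_top ha.ne
    have h2 : Filter.Tendsto (fun k => ‖x i (φ k) a - H i a‖ₑ ^ 2) Filter.atTop (𝓝 0) :=
      tendsto_of_tendsto_of_tendsto_of_le_of_le tendsto_const_nhds h1 (fun _ => by simp)
        (fun k => Finset.single_le_sum (f := fun i => ‖x i (φ k) a - H i a‖ₑ ^ 2)
          (fun _ _ => by simp) (Finset.mem_univ i))
    have h3 : Filter.Tendsto (fun k => ‖x i (φ k) a - H i a‖ ^ 2) Filter.atTop (𝓝 0) := by
      have := (ENNReal.tendsto_toReal (by simp : (0:ℝ≥0∞) ≠ ∞)).comp h2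
      simpa [Function.comp_def] using this
    rw [tendsto_iff_norm_sub_tendsto_zero]
    have h4 := (Real.continuous_sqrt.tendsto 0).comp h3
    simpa [Function.comp_def, Real.sqrt_sq] using h4
  · filter_upwards [hSfin] with a ha
    have h1 := hle a ha i k
    have h2 : ‖x i (φ k) a‖ ≤ ‖x i (φ k) a - H i a‖ + ‖H i a‖ := by
      simpa using norm_add_le (x i (φ k) a - H i a) (H i a)
    have h3 : ‖H i a‖ ^ 2 ≤ ∑ i, ‖H i a‖ ^ 2 :=
      Finset.single_le_sum (f := fun i => ‖H i a‖ ^ 2) (fun _ _ => by positivity)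
        (Finset.mem_univ i)
    nlinarith [norm_nonneg (x i (φ k) a), sq_nonneg (‖x i (φ k) a - H i a‖ - ‖H i a‖)]

end DominatedSubsequence

section DifferenceQuotients

variable {F : Type*} [NormedAddCommGroup F] [NormedSpace ℝ F]

/-- The forward difference quotient of `g` in the `i`-th coordinate direction with step `h`. -/
def diffQuot (i : Fin n) (h : ℝ) (g : Euc n → F) (x : Euc n) : F :=
  h⁻¹ • (g (x + h • EuclideanSpace.single i 1) - g x)

theorem integral_comp_add_euc (f : Euc n → F) (v : Euc n) :
    ∫ x, f (x + v) = ∫ x, f x :=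
  integral_add_right_eq_self f v

/-- Translation by `s` in the direction `e` as an isometry of `L²`. -/
def translateL2 {E : Type*} [NormedAddCommGroup E] [InnerProductSpace ℝ E] (e : Euc n) (s : ℝ) :
    Lp E 2 (volume : Measure (Euc n)) →ₗᵢ[ℝ] Lp E 2 (volume : Measure (Euc n)) :=
  Lp.compMeasurePreservingₗᵢ ℝ (fun x => x + s • e) (measurePreserving_add_right volume (s • e))

theorem translateL2_coeFn {E : Type*} [NormedAddCommGroup E] [InnerProductSpace ℝ E] (e : Euc n)
    (s : ℝ) (g : Lp E 2 (volume : Measure (Euc n))) :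
    translateL2 e s g =ᵐ[volume] fun x => g (x + s • e) :=
  Lp.coeFn_compMeasurePreserving g (measurePreserving_add_right volume (s • e))

theorem translateL2_add {E : Type*} [NormedAddCommGroup E] [InnerProductSpace ℝ E] (e : Euc n)
    (s t : ℝ) : (translateL2 e (s + t) : Lp E 2 (volume : Measure (Euc n)) →ₗᵢ[ℝ] _) =
      translateL2 e s * translateL2 e t := by
  ext1 g
  rw [LinearIsometry.coe_mul, Function.comp_apply]
  apply Lp.ext
  have h1 := translateL2_coeFn e (s + t) g
  have h2 := translateL2_coeFn e s (translateL2 e t g)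
  have h3 := (measurePreserving_add_right (volume : Measure (Euc n))
    (s • e)).quasiMeasurePreserving.ae_eq_comp (translateL2_coeFn e t g)
  filter_upwards [h1, h2, h3] with x hx1 hx2 hx3
  rw [hx1, hx2]
  simp only [Function.comp_apply] at hx3
  rw [hx3]
  congr 1
  rw [add_smul, add_assoc]

theorem translateL2_zero {E : Type*} [NormedAddCommGroup E] [InnerProductSpace ℝ E] (e : Euc n) :
    (translateL2 e 0 : Lp E 2 (volume : Measure (Euc n)) →ₗᵢ[ℝ] _) = 1 := by
  ext1 g
  apply Lp.ext
  filter_upwards [translateL2_coeFn e 0 g] with x hx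
  rw [hx]; simp

theorem dyadic_quotient_translateL2_ae {E : Type*} [NormedAddCommGroup E] [InnerProductSpace ℝ E]
    (v : Euc n → E) (hv : MemLp v 2 volume) (i : Fin n) (k : ℕ) :
    ((2 : ℝ) ^ k • (translateL2 (EuclideanSpace.single i 1) ((1 / 2) ^ k) (hv.toLp v) - hv.toLp v) :
      Lp E 2 (volume : Measure (Euc n))) =ᵐ[volume] diffQuot i ((1 / 2) ^ k) v := by
  have h1 := translateL2_coeFn (EuclideanSpace.single i (1 : ℝ)) ((1 / 2) ^ k) (hv.toLp v)
  have h2 := (measurePreserving_add_right (volume : Measure (Euc n))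
    (((1 / 2 : ℝ) ^ k) • EuclideanSpace.single i (1 : ℝ))).quasiMeasurePreserving.ae_eq_comp
      hv.coeFn_toLp
  filter_upwards [h1, h2, hv.coeFn_toLp,
    Lp.coeFn_smul ((2 : ℝ) ^ k)
      (translateL2 (EuclideanSpace.single i (1 : ℝ)) ((1 / 2) ^ k) (hv.toLp v) - hv.toLp v),
    Lp.coeFn_sub (translateL2 (EuclideanSpace.single i (1 : ℝ)) ((1 / 2) ^ k) (hv.toLp v))
      (hv.toLp v)] with x h1 h2 h3 h4 h5
  rw [h4, Pi.smul_apply, h5, Pi.sub_apply, h1, h3]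
  simp only [Function.comp_apply] at h2
  rw [h2]
  simp [diffQuot]

/-- A square integrable function with bounded dyadic difference quotients in all coordinate
directions has a subsequence of dyadic difference quotients which converges almost everywhere and
is dominated in `L²`. -/
theorem exists_diffQuot_limit {E : Type*} [NormedAddCommGroup E] [InnerProductSpace ℝ E]
    [CompleteSpace E] (v : Euc n → E)
    (hv : MemLp v 2 volume) (C : ℝ)
    (hC : ∀ i, ∀ᶠ k : ℕ in Filter.atTop,
      eLpNorm (diffQuot i ((1 / 2) ^ k) v) 2 volume ≤ ENNReal.ofReal C) :
    ∃ φ : ℕ → ℕ, StrictMono φ ∧ ∃ (H : Fin n → Euc n → E) (Z : Euc n → ℝ),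
      (∀ i, MemLp (H i) 2 volume) ∧ (∀ i, StronglyMeasurable (H i)) ∧
      Integrable Z volume ∧ (∀ x, 0 ≤ Z x) ∧ ∀ i,
      (∀ᵐ x, Filter.Tendsto (fun k => diffQuot i ((1 / 2) ^ (φ k)) v x) Filter.atTop
        (𝓝 (H i x))) ∧
      ∀ k, ∀ᵐ x, ‖diffQuot i ((1 / 2) ^ (φ k)) v x‖ ^ 2 ≤ Z x := by
  let X : Fin n → ℕ → Lp E 2 (volume : Measure (Euc n)) := fun i k =>
    (2 : ℝ) ^ k • (translateL2 (EuclideanSpace.single i 1) ((1 / 2) ^ k) (hv.toLp v) - hv.toLp v)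
  have hXe : ∀ i k, X i k =ᵐ[volume] diffQuot i ((1 / 2) ^ k) v :=
    dyadic_quotient_translateL2_ae v hv
  have hXn : ∀ i, ∀ᶠ k in Filter.atTop, ‖X i k‖ ≤ max C 0 := by
    intro i
    filter_upwards [hC i] with k hk
    rw [Lp.norm_def, eLpNorm_congr_ae (hXe i k)]
    refine ENNReal.toReal_le_of_le_ofReal (le_max_right _ _) (hk.trans ?_)
    exact ENNReal.ofReal_le_ofReal (le_max_left _ _)
  have hcau : ∀ i, CauchySeq (X i) := by
    intro i
    have := cauchySeq_dyadic_quotient (translateL2 (E := E) (EuclideanSpace.single i (1 : ℝ)))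
      (translateL2_add _) (translateL2_zero _) (hv.toLp v) _ (hXn i)
    exact this
  choose H hH using fun i => cauchySeq_tendsto_of_complete (hcau i)
  obtain ⟨φ, hφ, Z, hZ, hZ0, hall⟩ := exists_subseq_dominated X H hH
  refine ⟨φ, hφ, fun i => (H i : Euc n → E), Z, fun i => Lp.memLp _, fun i => Lp.stronglyMeasurable _, hZ, hZ0,
    fun i => ⟨?_, fun k => ?_⟩⟩
  · filter_upwards [(hall i).1, ae_all_iff.2 fun k => hXe i (φ k)] with x hx1 hx2
    simpa [hx2] using hx1
  · filter_upwards [(hall i).2 k, hXe i (φ k)] with x hx1 hx2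
    simpa [hx2] using hx1

end DifferenceQuotients

/-- Approximation of compactly supported `C¹` functions by smooth ones in `C¹`. -/
theorem exists_smooth_approx (Ω : Set (Euc n)) (hΩ : IsOpen Ω) (ψ : Euc n → ℝ)
    (hψ : ContDiff ℝ 1 ψ) (hc : HasCompactSupport ψ) (hs : tsupport ψ ⊆ Ω) :
    ∃ K : Set (Euc n), IsCompact K ∧ K ⊆ Ω ∧ tsupport ψ ⊆ K ∧ ∀ δ > 0, ∃ ψ' : Euc n → ℝ,
      ContDiff ℝ (⊤ : ℕ∞) ψ' ∧ tsupport ψ' ⊆ K ∧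
      ∀ x, ‖ψ' x - ψ x‖ ≤ δ ∧ ‖fderiv ℝ ψ' x - fderiv ℝ ψ x‖ ≤ δ := by
  obtain ⟨r, hr, hrΩ⟩ := hc.isCompact.exists_cthickening_subset_open hΩ hs
  refine ⟨_, hc.isCompact.cthickening, hrΩ, Metric.self_subset_cthickening _, fun δ hδ => ?_⟩
  have hu1 : UniformContinuous ψ := hc.uniformContinuous_of_continuous hψ.continuous
  have hu2 : UniformContinuous (fderiv ℝ ψ) :=
    (hc.fderiv ℝ).uniformContinuous_of_continuous (hψ.continuous_fderiv one_ne_zero)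
  obtain ⟨r1, hr1, h1⟩ := Metric.uniformContinuous_iff.1 hu1 δ hδ
  obtain ⟨r2, hr2, h2⟩ := Metric.uniformContinuous_iff.1 hu2 δ hδ
  obtain ⟨s, hs0, hs⟩ := exists_between (lt_min hr (lt_min hr1 hr2))
  obtain ⟨hsr, hs12⟩ := lt_min_iff.1 hs
  obtain ⟨hsr1, hsr2⟩ := lt_min_iff.1 hs12
  let φ : ContDiffBump (0 : Euc n) := ⟨s / 2, s, by positivity, by linarith⟩
  let L := ContinuousLinearMap.lsmul ℝ ℝ (E := ℝ)
  have hli : LocallyIntegrable (φ.normed volume) :=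
    φ.continuous_normed.locallyIntegrable
  have hd : ∀ x, HasFDerivAt (convolution (φ.normed volume) ψ L volume)
      (convolution (φ.normed volume) (fderiv ℝ ψ) (ContinuousLinearMap.lsmul ℝ ℝ) volume x) x := by
    intro x
    have e : L.precompR (Euc n) = ContinuousLinearMap.lsmul ℝ ℝ := by
      ext; simp [L, ContinuousLinearMap.precompR]
    have := hc.hasFDerivAt_convolution_right L hli hψ x
    rwa [e] at this
  refine ⟨convolution (φ.normed volume) ψ L volume, ?_, ?_, fun x => ⟨?_, ?_⟩⟩
  · exact φ.hasCompactSupport_normed.contDiff_convolution_left L φ.contDiff_normed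
      hψ.continuous.locallyIntegrable
  · refine (closure_minimal ?_ Metric.isClosed_cthickening)
    refine (support_convolution_subset_swap L).trans ?_
    rintro x ⟨a, ha, b, hb, rfl⟩
    rw [φ.support_normed_eq] at hb
    refine Metric.mem_cthickening_of_dist_le _ a _ _ (subset_tsupport _ ha) ?_
    have : ‖b‖ < s := by simpa using hb
    simp only [dist_eq_norm, add_sub_cancel_left]
    linarith
  · rw [← dist_eq_norm]
    refine φ.dist_normed_convolution_le hψ.continuous.aestronglyMeasurable fun y hy => ?_
    exact (h1 ((Metric.mem_ball.1 hy).trans hsr1)).le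
  · rw [← dist_eq_norm, (hd x).fderiv]
    refine φ.dist_normed_convolution_le
      (hψ.continuous_fderiv one_ne_zero).aestronglyMeasurable fun y hy => ?_
    exact (h2 ((Metric.mem_ball.1 hy).trans hsr2)).le

/-- The weak form of `-div V = f` on `Ω` for continuously differentiable test functions. -/
def WeakDiv (Ω : Set (Euc n)) (V : Euc n → Euc n) (f : Euc n → ℝ) : Prop :=
  ∀ ψ : Euc n → ℝ, ContDiff ℝ 1 ψ → HasCompactSupport ψ → tsupport ψ ⊆ Ω →
    ∫ x, fderiv ℝ ψ x (V x) = ∫ x, f x * ψ x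

theorem fderiv_eq_zero_of_notMem {E : Type*} [NormedAddCommGroup E] [NormedSpace ℝ E]
    (ψ : Euc n → E) (K : Set (Euc n)) (h : tsupport ψ ⊆ K)
    (x : Euc n) (hx : x ∉ K) : fderiv ℝ ψ x = 0 := by
  by_contra h0
  exact hx (h (support_fderiv_subset ℝ h0))

/-- A bound of an integral over a compact set. -/
theorem norm_integral_le_of_compact {E : Type*} [NormedAddCommGroup E] [NormedSpace ℝ E]
    (K : Set (Euc n)) (hK : IsCompact K) (g : Euc n → E) (C : ℝ) (hg : ∀ x ∈ K, ‖g x‖ ≤ C)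
    (hg0 : ∀ x, x ∉ K → g x = 0) : ‖∫ x, g x‖ ≤ C * volume.real K := by
  rw [← setIntegral_eq_integral_of_forall_compl_eq_zero hg0]
  exact norm_setIntegral_le_of_norm_le_const hK.measure_lt_top hg

theorem weakDiv_of_smooth (Ω : Set (Euc n)) (hΩ : IsOpen Ω) (V : Euc n → Euc n) (f : Euc n → ℝ)
    (hV : Continuous V) (hf : Continuous f)
    (h : ∀ ψ : Euc n → ℝ, ContDiff ℝ (⊤ : ℕ∞) ψ → HasCompactSupport ψ → tsupport ψ ⊆ Ω →
      ∫ x, fderiv ℝ ψ x (V x) = ∫ x, f x * ψ x) : WeakDiv Ω V f := by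
  intro ψ hψ hc hs
  obtain ⟨K, hK, hKΩ, hψK, happ⟩ := exists_smooth_approx Ω hΩ ψ hψ hc hs
  obtain ⟨A, hA⟩ := hK.exists_bound_of_continuousOn hV.continuousOn
  obtain ⟨B, hB⟩ := hK.exists_bound_of_continuousOn hf.continuousOn
  rw [← sub_eq_zero, ← norm_le_zero_iff]
  have hint : ∀ ψ : Euc n → ℝ, ContDiff ℝ 1 ψ → HasCompactSupport ψ →
      Integrable (fun x => fderiv ℝ ψ x (V x)) ∧ Integrable (fun x => f x * ψ x) := by
    intro ψ hψ hc
    refine ⟨Continuous.integrable_of_hasCompactSupport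
      ((hψ.continuous_fderiv one_ne_zero).clm_apply hV) ?_,
      (hf.mul hψ.continuous).integrable_of_hasCompactSupport hc.mul_left⟩
    exact (hc.fderiv ℝ).mono (fun x hx h0 => hx (by simp [h0]))
  have key : ∀ δ > 0, ‖(∫ x, fderiv ℝ ψ x (V x)) - ∫ x, f x * ψ x‖ ≤
      δ * ((max A 0 + max B 0) * volume.real K) := by
    intro δ hδ
    obtain ⟨ψ', h1, h2, h3⟩ := happ δ hδ
    have hc' : HasCompactSupport ψ' := HasCompactSupport.of_support_subset_isCompact hK
      ((subset_tsupport _).trans h2)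
    have he := h ψ' h1 hc' (h2.trans hKΩ)
    have h1' : ContDiff ℝ 1 ψ' := h1.of_le (by exact_mod_cast le_top)
    have e : (∫ x, fderiv ℝ ψ x (V x)) - ∫ x, f x * ψ x =
        ∫ x, ((fderiv ℝ ψ x (V x) - fderiv ℝ ψ' x (V x)) - (f x * ψ x - f x * ψ' x)) := by
      rw [integral_sub, integral_sub (hint ψ hψ hc).1 (hint ψ' h1' hc').1,
        integral_sub (hint ψ hψ hc).2 (hint ψ' h1' hc').2, he]
      · ring
      · exact (hint ψ hψ hc).1.sub (hint ψ' h1' hc').1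
      · exact (hint ψ hψ hc).2.sub (hint ψ' h1' hc').2
    rw [e, ← mul_assoc]
    refine norm_integral_le_of_compact K hK _ _ ?_ ?_
    · intro x hx
      have a1 : ‖fderiv ℝ ψ x (V x) - fderiv ℝ ψ' x (V x)‖ ≤ δ * max A 0 := by
        rw [← sub_apply]
        refine (ContinuousLinearMap.le_opNorm _ _).trans ?_
        gcongr
        · rw [norm_sub_rev]; exact (h3 x).2
        · exact (hA x hx).trans (le_max_left _ _)
      have a2 : ‖f x * ψ x - f x * ψ' x‖ ≤ δ * max B 0 := by
        rw [← mul_sub, norm_mul, mul_comm]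
        gcongr
        · rw [norm_sub_rev]; exact (h3 x).1
        · exact (hB x hx).trans (le_max_left _ _)
      calc _ ≤ _ := norm_sub_le _ _
        _ ≤ δ * max A 0 + δ * max B 0 := add_le_add a1 a2
        _ = _ := by ring
    · intro x hx
      rw [fderiv_eq_zero_of_notMem ψ K hψK x hx, fderiv_eq_zero_of_notMem ψ' K h2 x hx,
        image_eq_zero_of_notMem_tsupport fun h => hx (hψK h),
        image_eq_zero_of_notMem_tsupport fun h => hx (h2 h)]
      simp
  refine le_of_forall_pos_le_add fun ε hε => ?_
  have hpos : 0 < (max A 0 + max B 0) * volume.real K + 1 := by positivity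
  refine (key (ε / ((max A 0 + max B 0) * volume.real K + 1)) (by positivity)).trans ?_
  rw [zero_add, div_mul_eq_mul_div, div_le_iff₀ hpos]
  nlinarith

theorem weakDiv_translate (Ω : Set (Euc n)) (V : Euc n → Euc n) (f : Euc n → ℝ)
    (hV : Continuous V) (hf : Continuous f) (h : WeakDiv Ω V f) (v : Euc n) (φ : Euc n → ℝ)
    (hφ : ContDiff ℝ 1 φ) (hc : HasCompactSupport φ) (hs : tsupport φ ⊆ Ω)
    (hsv : ∀ x ∈ tsupport φ, x + v ∈ Ω) :
    ∫ x, fderiv ℝ φ x (V (x + v) - V x) = ∫ x, (f (x + v) - f x) * φ x := by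
  have hint : ∀ V : Euc n → Euc n, Continuous V → Integrable (fun x => fderiv ℝ φ x (V x)) := by
    intro V hV
    refine Continuous.integrable_of_hasCompactSupport
      ((hφ.continuous_fderiv one_ne_zero).clm_apply hV) ?_
    exact (hc.fderiv ℝ).mono (fun x hx h0 => hx (by simp [h0]))
  have hint2 : ∀ f : Euc n → ℝ, Continuous f → Integrable (fun x => f x * φ x) := fun f hf =>
    (hf.mul hφ.continuous).integrable_of_hasCompactSupport hc.mul_left
  have hVv : Continuous fun x => V (x + v) := hV.comp (continuous_id.add continuous_const)
  have hfv : Continuous fun x => f (x + v) := hf.comp (continuous_id.add continuous_const)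
  have h1 := h φ hφ hc hs
  have h2 := h (fun x => φ (x - v)) (hφ.comp (contDiff_id.sub contDiff_const))
    (hc.comp_homeomorph (Homeomorph.subRight v)) (by
      have : tsupport (fun x => φ (x - v)) = (Homeomorph.subRight v) ⁻¹' tsupport φ :=
        tsupport_comp_eq_preimage φ (Homeomorph.subRight v)
      rw [this]
      intro x hx
      simpa using hsv _ hx)
  rw [← integral_comp_add_euc _ v, ← integral_comp_add_euc (fun x => f x * _) v] at h2
  simp only [fderiv_comp_sub, add_sub_cancel_right] at h2
  simp only [map_sub, sub_mul]
  rw [integral_sub (hint _ hVv) (hint _ hV), integral_sub (hint2 _ hfv) (hint2 _ hf), h1, h2]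

theorem lintegral_translate_sub_le {E : Type*} [NormedAddCommGroup E] [NormedSpace ℝ E]
    [CompleteSpace E] [SecondCountableTopology E] (W : Euc n → E) (hW : ContDiff ℝ 1 W) (e : Euc n)
    (h : ℝ) (hh : 0 ≤ h) :
    ∫⁻ x, ‖W (x + h • e) - W x‖ₑ ≤ ENNReal.ofReal h * ∫⁻ x, ‖fderiv ℝ W x e‖ₑ := by
  have hcd : Continuous fun x => fderiv ℝ W x e :=
    (hW.continuous_fderiv one_ne_zero).clm_apply continuous_const
  have hcd2 : Continuous fun z : Euc n × ℝ => fderiv ℝ W (z.1 + z.2 • e) e :=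
    hcd.comp (by fun_prop)
  have h1 : ∀ x, ‖W (x + h • e) - W x‖ₑ ≤
      ∫⁻ t in Set.Ioc 0 h, ‖fderiv ℝ W (x + t • e) e‖ₑ := by
    intro x
    have hd : ∀ t ∈ Set.uIcc 0 h, HasDerivAt (fun t : ℝ => W (x + t • e))
        (fderiv ℝ W (x + t • e) e) t := by
      intro t _
      have h2 : HasDerivAt (fun t : ℝ => x + t • e) e t := by
        simpa using ((hasDerivAt_id t).smul_const e).const_add x
      exact ((hW.differentiable one_ne_zero).differentiableAt.hasFDerivAt).comp_hasDerivAt t h2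
    have h3 := intervalIntegral.integral_eq_sub_of_hasDerivAt hd
      ((hcd2.comp (by fun_prop : Continuous fun t : ℝ => (x, t))).intervalIntegrable _ _)
    simp only [zero_smul, add_zero] at h3
    rw [← h3, intervalIntegral.integral_of_le hh]
    exact enorm_integral_le_lintegral_enorm _
  calc _ ≤ ∫⁻ x, ∫⁻ t in Set.Ioc 0 h, ‖fderiv ℝ W (x + t • e) e‖ₑ := lintegral_mono h1
    _ = ∫⁻ t in Set.Ioc 0 h, ∫⁻ x, ‖fderiv ℝ W (x + t • e) e‖ₑ :=
      lintegral_lintegral_swap hcd2.enorm.measurable.aemeasurable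
    _ = ∫⁻ t in Set.Ioc 0 h, ∫⁻ x, ‖fderiv ℝ W x e‖ₑ := by
      refine lintegral_congr fun t => ?_
      exact lintegral_add_right_eq_self (fun x => ‖fderiv ℝ W x e‖ₑ) (t • e)
    _ = _ := by rw [setLIntegral_const, Real.volume_Ioc, sub_zero, mul_comm]

theorem integral_translate_sub_le {E : Type*} [NormedAddCommGroup E] [NormedSpace ℝ E]
    [CompleteSpace E] [SecondCountableTopology E] (W : Euc n → E) (hW : ContDiff ℝ 1 W)
    (hc : HasCompactSupport W) (e : Euc n) (h : ℝ) (hh : 0 ≤ h) :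
    ∫ x, ‖W (x + h • e) - W x‖ ≤ h * ∫ x, ‖fderiv ℝ W x e‖ := by
  have hcd : Continuous fun x => fderiv ℝ W x e :=
    (hW.continuous_fderiv one_ne_zero).clm_apply continuous_const
  have hi : Integrable fun x => fderiv ℝ W x e :=
    hcd.integrable_of_hasCompactSupport
      ((hc.fderiv ℝ).mono (fun x hx h0 => hx (by simp [h0])))
  have hiW := hW.continuous.integrable_of_hasCompactSupport (μ := volume) hc
  have hi2 : Integrable (fun x => W (x + h • e) - W x) volume :=
    (hiW.comp_add_right (h • e)).sub hiW
  have h1 := lintegral_translate_sub_le W hW e h hh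
  rw [← ofReal_integral_norm_eq_lintegral_enorm hi,
    ← ofReal_integral_norm_eq_lintegral_enorm hi2,
    ← ENNReal.ofReal_mul hh] at h1
  exact (ENNReal.ofReal_le_ofReal_iff (mul_nonneg hh (integral_nonneg fun x => norm_nonneg _))).1 h1

/-- The vector field `z ↦ |z|^{p-2} z` of the `p`-Laplace operator. -/
def stress (p : ℝ) (z : Euc n) : Euc n := ‖z‖ ^ (p - 2) • z

theorem norm_stress (p : ℝ) (hp : p ≠ 1) (z : Euc n) : ‖stress p z‖ = ‖z‖ ^ (p - 1) := by
  rw [stress, norm_smul, Real.norm_of_nonneg (by positivity)]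
  rcases eq_or_ne z 0 with rfl | hz
  · simp [Real.zero_rpow (sub_ne_zero.2 hp)]
  · rw [show p - 1 = (p - 2) + 1 by ring, Real.rpow_add_one (norm_ne_zero_iff.2 hz)]

theorem continuous_stress (p : ℝ) (hp : 1 < p) : Continuous (stress p : Euc n → Euc n) := by
  rw [continuous_iff_continuousAt]
  intro z
  rcases eq_or_ne z 0 with rfl | hz
  · rw [ContinuousAt, tendsto_iff_norm_sub_tendsto_zero]
    have h0 : stress p (0 : Euc n) = 0 := by simp [stress]
    simp only [h0, sub_zero, norm_stress p hp.ne']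
    have : Filter.Tendsto (fun x : Euc n => ‖x‖ ^ (p - 1)) (𝓝 0) (𝓝 (‖(0 : Euc n)‖ ^ (p - 1))) :=
      (continuous_norm.rpow_const fun x => Or.inr (by linarith)).tendsto 0
    simpa [Real.zero_rpow (by linarith : p - 1 ≠ 0)] using this
  · exact (continuous_norm.continuousAt.rpow_const (Or.inl (norm_ne_zero_iff.2 hz))).smul
      continuousAt_id

theorem rpow_sub_mul_sub_ge (p M r s : ℝ) (hp1 : 1 < p) (hp2 : p ≤ 2) (hs : 0 < s) (hr : 0 < r)
    (hrM : r ≤ M) (hsM : s ≤ M) :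
    (p - 1) * M ^ (p - 2) * (r - s) ^ 2 ≤ (r ^ (p - 1) - s ^ (p - 1)) * (r - s) := by
  wlog hsr : s ≤ r generalizing r s
  · have := this s r hr hs hsM hrM (le_of_not_ge hsr)
    nlinarith
  have h1 : (1 + (s / r - 1)) ^ (p - 1) ≤ 1 + (p - 1) * (s / r - 1) :=
    rpow_one_add_le_one_add_mul_self (by have := div_pos hs hr; linarith) (by linarith)
      (by linarith)
  rw [add_sub_cancel, Real.div_rpow hs.le hr.le, div_le_iff₀ (by positivity)] at h1
  have h2 : r ^ (p - 1) = r ^ (p - 2) * r := by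
    rw [show p - 1 = (p - 2) + 1 by ring, Real.rpow_add_one hr.ne']
  have h3 : (1 + (p - 1) * (s / r - 1)) * r ^ (p - 1) =
      r ^ (p - 1) + (p - 1) * r ^ (p - 2) * (s - r) := by
    rw [h2]; field_simp
  have h4 : M ^ (p - 2) ≤ r ^ (p - 2) :=
    Real.rpow_le_rpow_of_nonpos hr hrM (by linarith)
  have h5 : (p - 1) * M ^ (p - 2) * (r - s) ≤ r ^ (p - 1) - s ^ (p - 1) := by
    have : (p - 1) * M ^ (p - 2) * (r - s) ≤ (p - 1) * r ^ (p - 2) * (r - s) := by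
      gcongr
    linarith
  calc _ = (p - 1) * M ^ (p - 2) * (r - s) * (r - s) := by ring
    _ ≤ _ := by gcongr

/-- Strong monotonicity of the stress on bounded sets, in the singular range. -/
theorem stress_monotone (p M : ℝ) (hp1 : 1 < p) (hp2 : p ≤ 2) (hM : 0 < M) (a b : Euc n)
    (ha : ‖a‖ ≤ M) (hb : ‖b‖ ≤ M) :
    (p - 1) * M ^ (p - 2) * ‖a - b‖ ^ 2 ≤ ⟪stress p a - stress p b, a - b⟫_ℝ := by
  have key0 : ∀ b : Euc n, ‖b‖ ≤ M → (p - 1) * M ^ (p - 2) * ‖b‖ ^ 2 ≤ ⟪stress p b, b⟫_ℝ := by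
    intro b hb
    rw [stress, real_inner_smul_left, real_inner_self_eq_norm_sq]
    rcases eq_or_ne b 0 with rfl | hb0
    · simp
    · gcongr
      have h4 : M ^ (p - 2) ≤ ‖b‖ ^ (p - 2) :=
        Real.rpow_le_rpow_of_nonpos (norm_pos_iff.2 hb0) hb (by linarith)
      have : 0 < M ^ (p - 2) := by positivity
      nlinarith
  rcases eq_or_ne a 0 with rfl | ha0
  · simpa [stress] using key0 b hb
  rcases eq_or_ne b 0 with rfl | hb0
  · simpa [stress] using key0 a ha
  have hr := norm_pos_iff.2 ha0
  have hs := norm_pos_iff.2 hb0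
  have h1 := rpow_sub_mul_sub_ge p M ‖a‖ ‖b‖ hp1 hp2 hs hr ha hb
  have hA : M ^ (p - 2) ≤ ‖a‖ ^ (p - 2) := Real.rpow_le_rpow_of_nonpos hr ha (by linarith)
  have hB : M ^ (p - 2) ≤ ‖b‖ ^ (p - 2) := Real.rpow_le_rpow_of_nonpos hs hb (by linarith)
  have hm : 0 < M ^ (p - 2) := by positivity
  have h2 : ‖a‖ ^ (p - 1) = ‖a‖ ^ (p - 2) * ‖a‖ := by
    rw [show p - 1 = (p - 2) + 1 by ring, Real.rpow_add_one hr.ne']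
  have h3 : ‖b‖ ^ (p - 1) = ‖b‖ ^ (p - 2) * ‖b‖ := by
    rw [show p - 1 = (p - 2) + 1 by ring, Real.rpow_add_one hs.ne']
  rw [h2, h3] at h1
  have hc : ⟪a, b⟫_ℝ ≤ ‖a‖ * ‖b‖ := real_inner_le_norm a b
  rw [norm_sub_sq_real]
  simp only [stress, inner_sub_left, inner_sub_right, real_inner_smul_left,
    real_inner_self_eq_norm_sq, real_inner_comm a b]
  set A := ‖a‖ ^ (p - 2)
  set B := ‖b‖ ^ (p - 2)
  set m := M ^ (p - 2)
  set c := ⟪a, b⟫_ℝ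
  have h5 : 0 ≤ (A + B - 2 * ((p - 1) * m)) * (‖a‖ * ‖b‖ - c) := by
    apply mul_nonneg
    · nlinarith
    · linarith
  nlinarith

theorem continuous_gradient (u : Euc n → ℝ) (hu : ContDiff ℝ 1 u) : Continuous (gradient u) :=
  (InnerProductSpace.toDual ℝ (Euc n)).symm.continuous.comp (hu.continuous_fderiv one_ne_zero)

theorem hasCompactSupport_gradient (u : Euc n → ℝ) (hu : HasCompactSupport u) :
    HasCompactSupport (gradient u) :=
  (hu.fderiv ℝ).comp_left (map_zero _)

theorem one_add_one_le_smooth : (1 : WithTop ℕ∞) + 1 ≤ ((⊤ : ℕ∞) : WithTop ℕ∞) := by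
  have : ((1 + 1 : ℕ∞) : WithTop ℕ∞) ≤ ((⊤ : ℕ∞) : WithTop ℕ∞) := WithTop.coe_le_coe.2 le_top
  simpa using this

theorem exists_bound_fderiv {E : Type*} [NormedAddCommGroup E] [NormedSpace ℝ E] (W : Euc n → E)
    (hW : ContDiff ℝ 1 W) (hc : HasCompactSupport W) : ∃ A, ∀ x, ‖fderiv ℝ W x‖ ≤ A :=
  (hc.fderiv ℝ).exists_bound_of_continuous (hW.continuous_fderiv one_ne_zero)

set_option maxHeartbeats 800000 in
theorem caccioppoli (p : ℝ) (hp1 : 1 < p) (hp2 : p ≤ 2) (Ω : Set (Euc n)) (hΩ : IsOpen Ω)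
    (u f : Euc n → ℝ) (hu : ContDiff ℝ 1 u) (huc : HasCompactSupport u) (hf : ContDiff ℝ 1 f)
    (hfc : HasCompactSupport f) (heq : WeakDiv Ω (fun x => stress p (gradient u x)) f)
    (η : Euc n → ℝ) (hη : ContDiff ℝ (⊤ : ℕ∞) η) (hηc : HasCompactSupport η)
    (hηs : tsupport η ⊆ Ω) (e : Euc n) (he : ‖e‖ = 1) :
    ∃ C h0 : ℝ, 0 < h0 ∧ ∀ h, 0 < h → h < h0 →
      ∫ x, η x ^ 2 * ⟪stress p (gradient u (x + h • e)) - stress p (gradient u x),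
        gradient u (x + h • e) - gradient u x⟫_ℝ ≤ C * h ^ 2 := by
  obtain ⟨h0, hh0, hthick⟩ := hηc.isCompact.exists_cthickening_subset_open hΩ hηs
  have hGc := continuous_gradient u hu
  have hVc : Continuous fun x => stress p (gradient u x) := (continuous_stress p hp1).comp hGc
  obtain ⟨M0, hM0⟩ := (hasCompactSupport_gradient u huc).exists_bound_of_continuous hGc
  obtain ⟨M, hM0M⟩ := exists_gt (max M0 0)
  have hMpos : 0 < M := (le_max_right _ _).trans_lt hM0M
  have hM : ∀ x, ‖gradient u x‖ ≤ M := fun x => (hM0 x).trans ((le_max_left _ _).trans hM0M.le)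
  obtain ⟨Mf, hMf⟩ := ContDiff.lipschitzWith_of_hasCompactSupport hfc hf one_ne_zero
  obtain ⟨Mu, hMu⟩ := ContDiff.lipschitzWith_of_hasCompactSupport huc hu one_ne_zero
  have hVb : ∀ x, ‖stress p (gradient u x)‖ ≤ M ^ (p - 1) := fun x => by
    rw [norm_stress p hp1.ne']
    exact Real.rpow_le_rpow (norm_nonneg _) (hM x) (by linarith)
  have hη1 : ContDiff ℝ 1 η := hη.of_le (by exact_mod_cast le_top)
  set θ : Euc n → ℝ := fun x => η x ^ 2 with hθ
  have hθs : ContDiff ℝ (⊤ : ℕ∞) θ := hη.pow 2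
  have hθ1 : ContDiff ℝ 1 θ := hη1.pow 2
  have hθc : HasCompactSupport θ := hηc.comp_left (g := fun t : ℝ => t ^ 2) (by simp)
  have hθK : tsupport θ ⊆ tsupport η := closure_mono fun x hx h0 => hx (by simp [hθ, h0])
  obtain ⟨B, hB⟩ := hθc.exists_bound_of_continuous hθ1.continuous
  obtain ⟨A, hA⟩ := (hηc.fderiv ℝ).exists_bound_of_continuous (hη1.continuous_fderiv one_ne_zero)
  set Θ : Euc n → (Euc n →L[ℝ] ℝ) := fderiv ℝ θ with hΘ
  have hΘ1 : ContDiff ℝ 1 Θ := hθs.fderiv_right one_add_one_le_smooth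
  have hΘc : HasCompactSupport Θ := hθc.fderiv ℝ
  obtain ⟨A2, hA2⟩ := exists_bound_fderiv Θ hΘ1 hΘc
  have hΘη : ∀ x, ‖Θ x‖ ≤ 2 * |η x| * A := by
    intro x
    have : Θ x = (2 * η x) • fderiv ℝ η x := by
      simp only [hΘ, hθ]
      rw [fderiv_fun_pow 2 (hη1.differentiable one_ne_zero x)]
      simp
    rw [this, norm_smul]
    have h2 : ‖(2 * η x : ℝ)‖ = 2 * |η x| := by simp
    rw [h2]
    gcongr
    exact hA x
  set κ : ℝ := (p - 1) * M ^ (p - 2) with hκ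
  have hκpos : 0 < κ := mul_pos (by linarith) (by positivity)
  set K := tsupport η
  have hKm : MeasurableSet K := (isClosed_tsupport η).measurableSet
  set MV := M ^ (p - 1)
  have hMV : 0 < MV := by positivity
  set vK := volume.real K
  set C1 : ℝ := Mf * (B * Mu) * vK with hC1
  set C2 : ℝ := MV * (Mu * A2) + (2 * MV * A) ^ 2 / (2 * κ) with hC2
  refine ⟨2 * (C1 + C2 * vK), h0, hh0, fun h hh hhh => ?_⟩
  have hhe : ‖h • e‖ = h := by rw [norm_smul, he, mul_one, Real.norm_of_nonneg hh.le]
  set G := gradient u with hG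
  set V : Euc n → Euc n := fun x => stress p (G x) with hV
  set Q : Euc n → ℝ := fun x => ⟪V (x + h • e) - V x, G (x + h • e) - G x⟫_ℝ with hQ
  set D : Euc n → ℝ := fun x => u (x + h • e) - u x with hD
  have hD1 : ContDiff ℝ 1 D := (hu.comp (contDiff_id.add contDiff_const)).sub hu
  have hDb : ∀ x, |D x| ≤ Mu * h := by
    intro x
    have := hMu.dist_le_mul (x + h • e) x
    rwa [Real.dist_eq, dist_eq_norm, add_sub_cancel_left, hhe] at this
  have hDd : ∀ x v, fderiv ℝ D x v = ⟪G (x + h • e) - G x, v⟫_ℝ := by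
    intro x v
    have hdu := hu.differentiable one_ne_zero
    have hdu' : DifferentiableAt ℝ (fun x => u (x + h • e)) x :=
      DifferentiableAt.comp x hdu.differentiableAt (by fun_prop)
    rw [inner_sub_left, hG, inner_gradient_left, inner_gradient_left, hD,
      fderiv_fun_sub hdu' (hdu x),
      sub_apply, fderiv_comp_add_right]
  have hQc : Continuous Q := by
    have hsh : Continuous fun x : Euc n => x + h • e := continuous_id.add continuous_const
    exact ((hVc.comp hsh).sub hVc).inner ((hGc.comp hsh).sub hGc)
  have hQi : Integrable (fun x => θ x * Q x) volume :=
    (hθ1.continuous.mul hQc).integrable_of_hasCompactSupport hθc.mul_right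
  set W : Euc n → (Euc n →L[ℝ] ℝ) := fun x => D x • Θ x with hW
  have hW1 : ContDiff ℝ 1 W := hD1.smul hΘ1
  have hWc : HasCompactSupport W := hΘc.mono fun x hx h0 => hx (by simp [hW, h0])
  have hφd : ∀ x v, fderiv ℝ (fun x => θ x * D x) x v =
      θ x * ⟪v, G (x + h • e) - G x⟫_ℝ + W x v := by
    intro x v
    rw [fderiv_fun_mul (hθ1.differentiable one_ne_zero x) (hD1.differentiable one_ne_zero x)]
    simp only [add_apply, smul_apply, smul_eq_mul, hDd, hW]
    rw [real_inner_comm]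
  have hsub : tsupport (fun x => θ x * D x) ⊆ K := (tsupport_mul_subset_left).trans hθK
  have htest := weakDiv_translate Ω V f hVc hf.continuous heq (h • e) (fun x => θ x * D x)
    (hθ1.mul hD1) hθc.mul_right (hsub.trans hηs) (by
      intro x hx
      apply hthick
      refine Metric.mem_cthickening_of_dist_le _ x _ _ (hsub hx) ?_
      rw [dist_eq_norm, add_sub_cancel_left, hhe]
      exact hhh.le)
  simp only [hφd] at htest
  have hWi : ∀ Y : Euc n → Euc n, Continuous Y → Integrable (fun x => W x (Y x)) volume := by
    intro Y hY
    refine (hW1.continuous.clm_apply hY).integrable_of_hasCompactSupport ?_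
    exact hWc.mono (fun x hx h0 => hx (by simp [h0]))
  have hVs : Continuous fun x => V (x + h • e) := hVc.comp (continuous_id.add continuous_const)
  have hWΔ : Integrable (fun x => W x (V (x + h • e) - V x)) volume := hWi _ (hVs.sub hVc)
  change (∫ x, (θ x * Q x + W x (V (x + h • e) - V x))) = _ at htest
  rw [integral_add hQi hWΔ] at htest
  have hfirst : |∫ x, (f (x + h • e) - f x) * (θ x * D x)| ≤ C1 * h ^ 2 := by
    have := norm_integral_le_of_compact K hηc.isCompact
      (fun x => (f (x + h • e) - f x) * (θ x * D x)) (Mf * h * (B * (Mu * h))) (by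
        intro x _
        rw [norm_mul, norm_mul]
        gcongr
        · have := hMf.dist_le_mul (x + h • e) x
          rwa [dist_eq_norm, dist_eq_norm, add_sub_cancel_left, hhe] at this
        · exact (norm_nonneg _).trans (hB x)
        · exact hB x
        · exact hDb x) (by
        intro x hx
        have : η x = 0 := image_eq_zero_of_notMem_tsupport hx
        simp [hθ, this])
    rw [← Real.norm_eq_abs]
    refine this.trans (le_of_eq ?_)
    rw [hC1]; ring
  have hWd : ∀ x, ‖fderiv ℝ W x e‖ ≤ Mu * h * A2 +
      ‖G (x + h • e) - G x‖ * (2 * |η x| * A) := by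
    intro x
    rw [hW, fderiv_fun_smul (hD1.differentiable one_ne_zero x) (hΘ1.differentiable one_ne_zero x)]
    simp only [add_apply, smul_apply, ContinuousLinearMap.smulRight_apply]
    refine (norm_add_le _ _).trans (add_le_add ?_ ?_)
    · rw [norm_smul]
      have hΘe : ‖fderiv ℝ Θ x e‖ ≤ A2 := by
        refine (ContinuousLinearMap.le_opNorm _ _).trans ?_
        rw [he, mul_one]; exact hA2 x
      exact mul_le_mul (hDb x) hΘe (norm_nonneg _) (by positivity)
    · rw [norm_smul, hDd]
      gcongr
      · refine (norm_inner_le_norm _ _).trans ?_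
        rw [he, mul_one]
      · exact hΘη x
  have hW0 : ∀ x, x ∉ K → fderiv ℝ W x e = 0 := by
    intro x hx
    rw [fderiv_eq_zero_of_notMem W K ?_ x hx]
    · simp
    · refine (closure_mono ?_).trans ((tsupport_fderiv_subset ℝ).trans hθK)
      intro y hy h0
      exact hy (by simp [hW, hΘ, h0])
  have hyoung : ∀ x, MV * h * ‖fderiv ℝ W x e‖ ≤
      (1 / 2) * (θ x * Q x) + K.indicator (fun _ => C2 * h ^ 2) x := by
    intro x
    have hQx : κ * ‖G (x + h • e) - G x‖ ^ 2 ≤ Q x :=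
      stress_monotone p M hp1 hp2 hMpos _ _ (hM _) (hM _)
    have hθx : 0 ≤ θ x := sq_nonneg _
    by_cases hx : x ∈ K
    · rw [Set.indicator_of_mem hx]
      set g := ‖G (x + h • e) - G x‖
      have h1 : θ x * (κ * g ^ 2) ≤ θ x * Q x := by gcongr
      have h2 : θ x = |η x| ^ 2 := by rw [sq_abs]
      have h3 : MV * h * (g * (2 * |η x| * A)) ≤
          (1 / 2) * (κ * (|η x| * g) ^ 2) + (2 * MV * A) ^ 2 / (2 * κ) * h ^ 2 := by
        have := sq_nonneg (κ * (|η x| * g) - 2 * MV * A * h)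
        rw [← sub_nonneg]
        have e : (1 / 2) * (κ * (|η x| * g) ^ 2) + (2 * MV * A) ^ 2 / (2 * κ) * h ^ 2 -
          MV * h * (g * (2 * |η x| * A)) = (κ * (|η x| * g) - 2 * MV * A * h) ^ 2 / (2 * κ) := by
          field_simp
          ring
        rw [e]; positivity
      calc _ ≤ MV * h * (Mu * h * A2 + g * (2 * |η x| * A)) := by
            gcongr; exact hWd x
        _ = MV * (Mu * A2) * h ^ 2 + MV * h * (g * (2 * |η x| * A)) := by ring
        _ ≤ MV * (Mu * A2) * h ^ 2 + ((1 / 2) * (θ x * (κ * g ^ 2)) +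
            (2 * MV * A) ^ 2 / (2 * κ) * h ^ 2) := by
            rw [h2]
            nlinarith
        _ ≤ _ := by rw [hC2]; nlinarith
    · rw [hW0 x hx, Set.indicator_of_notMem hx, norm_zero, mul_zero, add_zero]
      have : 0 ≤ Q x := le_trans (by positivity) hQx
      positivity
  have hdWi : Integrable (fun x => ‖fderiv ℝ W x e‖) volume := by
    refine Integrable.norm ?_
    refine Continuous.integrable_of_hasCompactSupport
      ((hW1.continuous_fderiv one_ne_zero).clm_apply continuous_const)
      ((hWc.fderiv ℝ).mono (fun x hx h0 => hx (by simp [h0])))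
  have hind : Integrable (K.indicator fun _ : Euc n => C2 * h ^ 2) volume :=
    (integrable_indicator_iff hKm).2 (integrableOn_const hηc.isCompact.measure_lt_top.ne)
  have hsecond : |∫ x, W x (V (x + h • e) - V x)| ≤
      (1 / 2) * (∫ x, θ x * Q x) + C2 * h ^ 2 * vK := by
    have hWs : Continuous fun x => W (x - h • e) :=
      hW1.continuous.comp (continuous_id.sub continuous_const)
    have e1 : ∫ x, W x (V (x + h • e) - V x) = ∫ x, (W (x - h • e) - W x) (V x) := by
      simp only [map_sub, sub_apply]
      have i1 : Integrable (fun x => W (x - h • e) (V x)) volume := by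
        have := (hWi _ hVs).comp_sub_right (h • e)
        simpa using this
      rw [integral_sub (hWi _ hVs) (hWi _ hVc), integral_sub i1 (hWi _ hVc)]
      congr 1
      rw [← integral_comp_add_euc (fun x => W (x - h • e) (V x)) (h • e)]
      simp
    rw [e1]
    have e2 : ∫ x, ‖W (x - h • e) - W x‖ = ∫ x, ‖W (x + h • e) - W x‖ := by
      rw [← integral_comp_add_euc _ (h • e)]
      simp only [add_sub_cancel_right]
      simp only [norm_sub_rev]
    have hWsi : Integrable (fun x => ‖W (x - h • e) - W x‖) volume := by
      have := hW1.continuous.integrable_of_hasCompactSupport (μ := volume) hWc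
      exact ((this.comp_sub_right (h • e)).sub this).norm
    calc |∫ x, (W (x - h • e) - W x) (V x)| ≤ ∫ x, ‖W (x - h • e) - W x‖ * MV := by
          rw [← Real.norm_eq_abs]
          refine norm_integral_le_of_norm_le (hWsi.mul_const _) (Filter.Eventually.of_forall ?_)
          intro x
          refine (ContinuousLinearMap.le_opNorm _ _).trans ?_
          gcongr
          exact hVb x
      _ = MV * ∫ x, ‖W (x + h • e) - W x‖ := by rw [integral_mul_const, e2, mul_comm]
      _ ≤ MV * (h * ∫ x, ‖fderiv ℝ W x e‖) := by
          gcongr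
          exact integral_translate_sub_le W hW1 hWc e h hh.le
      _ = ∫ x, MV * h * ‖fderiv ℝ W x e‖ := by rw [integral_const_mul]; ring
      _ ≤ ∫ x, ((1 / 2) * (θ x * Q x) + K.indicator (fun _ => C2 * h ^ 2) x) :=
          integral_mono (hdWi.const_mul _) ((hQi.const_mul _).add hind) hyoung
      _ = _ := by
          rw [integral_add (hQi.const_mul _) hind, integral_const_mul, integral_indicator hKm,
            setIntegral_const, smul_eq_mul]
          ring
  have := abs_le.1 hfirst
  have := abs_le.1 hsecond
  change ∫ x, θ x * Q x ≤ _
  linarith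

section DifferenceQuotientLimits

variable {E : Type*} [NormedAddCommGroup E] [NormedSpace ℝ E]
variable {F : Type*} [NormedAddCommGroup F] [NormedSpace ℝ F]

/-- Along the step sizes `h`, the difference quotients of `g` converge almost everywhere in `Ω` to
the fields `H i` and are locally dominated in `L²`. -/
def IsDQLimit (Ω : Set (Euc n)) (h : ℕ → ℝ) (g : Euc n → E) (H : Fin n → Euc n → E) : Prop :=
  (∀ i, ∀ᵐ x, x ∈ Ω →
    Filter.Tendsto (fun k => diffQuot i (h k) g x) Filter.atTop (𝓝 (H i x))) ∧
  ∀ K, IsCompact K → K ⊆ Ω → ∃ Z : Euc n → ℝ, Integrable Z volume ∧ (∀ x, 0 ≤ Z x) ∧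
    ∀ i, ∀ᶠ k in Filter.atTop, ∀ᵐ x, x ∈ K → ‖diffQuot i (h k) g x‖ ^ 2 ≤ Z x

theorem diffQuot_continuous (i : Fin n) (h : ℝ) (g : Euc n → E) (hg : Continuous g) :
    Continuous (diffQuot i h g) := by
  unfold diffQuot
  fun_prop

theorem tendsto_translate (h : ℕ → ℝ) (h0 : Filter.Tendsto h Filter.atTop (𝓝 0)) (x e : Euc n) :
    Filter.Tendsto (fun k => x + h k • e) Filter.atTop (𝓝 x) := by
  simpa using (h0.smul_const e).const_add x

theorem tendsto_diffQuot (i : Fin n) (h : ℕ → ℝ) (h0 : Filter.Tendsto h Filter.atTop (𝓝 0))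
    (hne : ∀ k, h k ≠ 0) (g : Euc n → E) (x : Euc n) (hg : DifferentiableAt ℝ g x) :
    Filter.Tendsto (fun k => diffQuot i (h k) g x) Filter.atTop
      (𝓝 (fderiv ℝ g x (EuclideanSpace.single i 1))) := by
  have hc : Filter.Tendsto (fun k => (h k)⁻¹ • (h k • (EuclideanSpace.single i (1 : ℝ) : Euc n)))
      Filter.atTop (𝓝 (EuclideanSpace.single i 1)) := by
    refine tendsto_const_nhds.congr fun k => ?_
    rw [smul_smul, inv_mul_cancel₀ (hne k), one_smul]
  have hd : Filter.Tendsto (fun k => h k • (EuclideanSpace.single i (1 : ℝ) : Euc n))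
      Filter.atTop (𝓝 0) := by simpa using h0.smul_const (EuclideanSpace.single i (1 : ℝ))
  exact (hasFDerivWithinAt_univ.2 hg.hasFDerivAt).lim hd
    (Filter.Eventually.of_forall fun _ => Set.mem_univ _) hc

theorem norm_diffQuot_le (i : Fin n) (h : ℝ) (g : Euc n → E) (L : ℝ≥0) (hg : LipschitzWith L g)
    (x : Euc n) : ‖diffQuot i h g x‖ ≤ L := by
  rcases eq_or_ne h 0 with rfl | hh
  · simp [diffQuot]
  · rw [diffQuot, norm_smul, norm_inv, inv_mul_le_iff₀ (norm_pos_iff.2 hh)]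
    have := hg.norm_sub_le (x + h • EuclideanSpace.single i 1) x
    simpa [norm_smul, mul_comm] using this

theorem diffQuot_eq_zero (i : Fin n) (h r : ℝ) (g : Euc n → E) (x : Euc n) (hr : |h| ≤ r)
    (hx : x ∉ Metric.cthickening r (tsupport g)) : diffQuot i h g x = 0 := by
  have h1 : g x = 0 := image_eq_zero_of_notMem_tsupport fun h =>
    hx (Metric.self_subset_cthickening _ h)
  have h2 : g (x + h • EuclideanSpace.single i 1) = 0 := image_eq_zero_of_notMem_tsupport fun h' => by
    refine hx (Metric.mem_cthickening_of_dist_le _ _ _ _ h' ?_)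
    simpa [norm_smul] using hr
  simp [diffQuot, h1, h2]

variable {h : ℕ → ℝ} (hpos : ∀ k, 0 < h k) (h0 : Filter.Tendsto h Filter.atTop (𝓝 0))
  {Ω : Set (Euc n)}

theorem IsDQLimit.mono {Ω' : Set (Euc n)} {g : Euc n → E} {H : Fin n → Euc n → E}
    (hg : IsDQLimit Ω h g H) (hs : Ω' ⊆ Ω) : IsDQLimit Ω' h g H :=
  ⟨fun i => (hg.1 i).mono fun _ hx hx' => hx (hs hx'), fun K hK hK' => hg.2 K hK (hK'.trans hs)⟩

theorem IsDQLimit.prodMk {g : Euc n → E} {H : Fin n → Euc n → E} {g' : Euc n → F}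
    {H' : Fin n → Euc n → F} (hg : IsDQLimit Ω h g H) (hg' : IsDQLimit Ω h g' H') :
    IsDQLimit Ω h (fun x => (g x, g' x)) (fun i x => (H i x, H' i x)) := by
  have e : ∀ i k x, diffQuot i (h k) (fun x => (g x, g' x)) x =
      (diffQuot i (h k) g x, diffQuot i (h k) g' x) := fun i k x => by simp [diffQuot]
  refine ⟨fun i => ?_, fun K hK hKΩ => ?_⟩
  · filter_upwards [hg.1 i, hg'.1 i] with x h1 h2 hx
    simp only [e]
    exact (h1 hx).prodMk_nhds (h2 hx)
  · obtain ⟨Z, hZ, hZ0, hd⟩ := hg.2 K hK hKΩ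
    obtain ⟨Z', hZ', hZ0', hd'⟩ := hg'.2 K hK hKΩ
    refine ⟨fun x => Z x + Z' x, hZ.add hZ', fun x => add_nonneg (hZ0 x) (hZ0' x), fun i => ?_⟩
    filter_upwards [hd i, hd' i] with k hk hk'
    filter_upwards [hk, hk'] with x hx hx' hxK
    have h1 := hx hxK
    have h2 := hx' hxK
    rw [e, Prod.norm_def]
    rcases max_cases ‖diffQuot i (h k) g x‖ ‖diffQuot i (h k) g' x‖ with h | h
    · rw [h.1]; have := hZ0' x; linarith
    · rw [h.1]; have := hZ0 x; linarith

include h0 in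
theorem IsDQLimit.comp [ProperSpace E] {g : Euc n → E} {H : Fin n → Euc n → E}
    (hg : IsDQLimit Ω h g H) (hpos : ∀ k, 0 < h k) (R : ℝ) (hR : ∀ x, ‖g x‖ ≤ R) (Ψ : E → F)
    (hΨ : ContDiff ℝ 1 Ψ) :
    IsDQLimit Ω h (fun x => Ψ (g x)) (fun i x => fderiv ℝ Ψ (g x) (H i x)) := by
  refine ⟨fun i => ?_, fun K hK hKΩ => ?_⟩
  · filter_upwards [hg.1 i] with x hx hxΩ
    have h1 := hx hxΩ
    have h2 : Filter.Tendsto (fun k => g (x + h k • EuclideanSpace.single i 1) - g x)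
        Filter.atTop (𝓝 0) := by
      have := h0.smul h1
      rw [zero_smul] at this
      refine this.congr fun k => ?_
      rw [diffQuot, smul_smul, mul_inv_cancel₀ (hpos k).ne', one_smul]
    have h3 := (hasFDerivWithinAt_univ.2 ((hΨ.differentiable one_ne_zero) (g x)).hasFDerivAt).lim
      h2 (Filter.Eventually.of_forall fun _ => Set.mem_univ _) h1
    simpa [diffQuot] using h3
  · obtain ⟨Z, hZ, hZ0, hd⟩ := hg.2 K hK hKΩ
    obtain ⟨L, hL⟩ := hΨ.contDiffOn.exists_lipschitzOnWith one_ne_zero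
      (convex_closedBall (0 : E) R) (isCompact_closedBall _ _)
    refine ⟨fun x => L ^ 2 * Z x, hZ.const_mul _, fun x => mul_nonneg (by positivity) (hZ0 x),
      fun i => ?_⟩
    filter_upwards [hd i] with k hk
    filter_upwards [hk] with x hx hxK
    have h1 : ‖diffQuot i (h k) (fun x => Ψ (g x)) x‖ ≤ L * ‖diffQuot i (h k) g x‖ := by
      rw [diffQuot, diffQuot, norm_smul, norm_smul, mul_left_comm]
      gcongr
      exact hL.norm_sub_le (by simpa using hR _) (by simpa using hR _)
    calc _ ≤ (L * ‖diffQuot i (h k) g x‖) ^ 2 := by gcongr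
      _ = L ^ 2 * ‖diffQuot i (h k) g x‖ ^ 2 := by ring
      _ ≤ _ := by gcongr; exact hx hxK

include hpos h0 in
theorem isDQLimit_of_contDiff (g : Euc n → E) (hg : ContDiff ℝ 1 g) (hc : HasCompactSupport g) :
    IsDQLimit Ω h g (fun i x => fderiv ℝ g x (EuclideanSpace.single i 1)) := by
  refine ⟨fun i => ?_, fun K hK hKΩ => ?_⟩
  · exact Filter.Eventually.of_forall fun x _ => tendsto_diffQuot i h h0 (fun k => (hpos k).ne') g x
      (hg.differentiable one_ne_zero x)
  · obtain ⟨L, hL⟩ := ContDiff.lipschitzWith_of_hasCompactSupport hc hg one_ne_zero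
    refine ⟨K.indicator fun _ => (L : ℝ) ^ 2, (integrable_indicator_iff hK.measurableSet).2
      (integrableOn_const hK.measure_lt_top.ne),
      fun x => Set.indicator_nonneg (fun _ _ => by positivity) x, fun i => ?_⟩
    refine Filter.Eventually.of_forall fun k => Filter.Eventually.of_forall fun x hx => ?_
    rw [Set.indicator_of_mem hx]
    gcongr
    exact norm_diffQuot_le i _ g L hL x

include h0 in
theorem IsDQLimit.extend (hΩ : IsOpen Ω) {g : Euc n → E} {H : Fin n → Euc n → E}
    (hg : IsDQLimit Ω h g H) (hc : HasCompactSupport g) (hs : tsupport g ⊆ Ω) :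
    IsDQLimit Set.univ h g (fun i => (tsupport g).indicator (H i)) := by
  obtain ⟨r, hr, hrΩ⟩ := hc.isCompact.exists_cthickening_subset_open hΩ hs
  refine ⟨fun i => ?_, fun K _ _ => ?_⟩
  · filter_upwards [hg.1 i] with x hx _
    by_cases hxs : x ∈ tsupport g
    · rw [Set.indicator_of_mem hxs]; exact hx (hs hxs)
    · rw [Set.indicator_of_notMem hxs]
      have hopen : ∀ᶠ y in 𝓝 x, g y = 0 := by
        filter_upwards [(isClosed_tsupport g).isOpen_compl.mem_nhds hxs] with y hy
        exact image_eq_zero_of_notMem_tsupport hy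
      refine tendsto_const_nhds.congr' ?_
      filter_upwards [(tendsto_translate h h0 x (EuclideanSpace.single i 1)).eventually hopen]
        with k hk
      simp [diffQuot, hk, image_eq_zero_of_notMem_tsupport hxs]
  · obtain ⟨Z, hZ, hZ0, hd⟩ := hg.2 _ hc.isCompact.cthickening hrΩ
    refine ⟨Z, hZ, hZ0, fun i => ?_⟩
    filter_upwards [hd i, h0.eventually (Metric.ball_mem_nhds 0 hr)] with k hk hkr
    filter_upwards [hk] with x hx _
    by_cases hxs : x ∈ Metric.cthickening r (tsupport g)
    · exact hx hxs
    · have : |h k| < r := by simpa using hkr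
      rw [diffQuot_eq_zero i (h k) r g x this.le hxs]
      simpa using hZ0 x

theorem IsDQLimit.memLp {g : Euc n → E} {H : Fin n → Euc n → E} (hg : IsDQLimit Ω h g H)
    (hcont : Continuous g) [SecondCountableTopology E] (K : Set (Euc n)) (hK : IsCompact K)
    (hKΩ : K ⊆ Ω) (i : Fin n) : MemLp (H i) 2 (volume.restrict K) := by
  have hconv : ∀ᵐ x ∂volume.restrict K,
      Filter.Tendsto (fun k => diffQuot i (h k) g x) Filter.atTop (𝓝 (H i x)) := by
    rw [ae_restrict_iff' hK.measurableSet]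
    filter_upwards [hg.1 i] with x hx hxK using hx (hKΩ hxK)
  have hm : AEStronglyMeasurable (H i) (volume.restrict K) :=
    aestronglyMeasurable_of_tendsto_ae Filter.atTop
      (fun k => (diffQuot_continuous i (h k) g hcont).aestronglyMeasurable) hconv
  obtain ⟨Z, hZ, hZ0, hd⟩ := hg.2 K hK hKΩ
  rw [memLp_two_iff_integrable_sq_norm hm]
  refine (hZ.restrict (s := K)).mono' (hm.norm.pow 2) ?_
  obtain ⟨N, hN⟩ := Filter.eventually_atTop.1 (hd i)
  have hall : ∀ᵐ x ∂volume.restrict K, ∀ k, N ≤ k → ‖diffQuot i (h k) g x‖ ^ 2 ≤ Z x := by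
    rw [ae_all_iff]; intro k
    rw [ae_restrict_iff' hK.measurableSet]
    by_cases hk : N ≤ k
    · filter_upwards [hN k hk] with x hx hxK _ using hx hxK
    · exact Filter.Eventually.of_forall fun x _ h => absurd h hk
  filter_upwards [hall, hconv] with x hx hx'
  rw [Real.norm_of_nonneg (by positivity)]
  exact le_of_tendsto (hx'.norm.pow 2) (Filter.eventually_atTop.2 ⟨N, hx⟩)

theorem integral_diffQuot_mul (i : Fin n) (t : ℝ) (g ψ : Euc n → ℝ) (hg : Continuous g)
    (hψ : Continuous ψ) (hc : HasCompactSupport ψ) :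
    ∫ x, diffQuot i t g x * ψ x = - ∫ x, g x * diffQuot i (-t) ψ x := by
  set v : Euc n := t • EuclideanSpace.single i 1 with hv
  have hsc : Continuous fun x => g (x + v) := hg.comp (continuous_id.add continuous_const)
  have i1 : Integrable (fun x => g (x + v) * ψ x) volume :=
    (hsc.mul hψ).integrable_of_hasCompactSupport hc.mul_left
  have i2 : Integrable (fun x => g x * ψ x) volume :=
    (hg.mul hψ).integrable_of_hasCompactSupport hc.mul_left
  have i3 : Integrable (fun x => g x * ψ (x - v)) volume := by
    simpa using i1.comp_sub_right v
  have e1 : ∀ x, diffQuot i t g x * ψ x = t⁻¹ * (g (x + v) * ψ x - g x * ψ x) := by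
    intro x; simp [diffQuot, hv]; ring
  have e2 : ∀ x, g x * diffQuot i (-t) ψ x = -(t⁻¹ * (g x * ψ (x - v) - g x * ψ x)) := by
    intro x; simp [diffQuot, hv, inv_neg, ← sub_eq_add_neg]; ring
  simp only [e1, e2]
  rw [integral_neg, integral_const_mul, integral_const_mul, integral_sub i1 i2,
    integral_sub i3 i2, neg_neg]
  congr 2
  rw [← integral_comp_add_euc (fun x => g x * ψ (x - v)) v]
  simp

include hpos h0 in
/-- Limits of difference quotients are weak derivatives. -/
theorem IsDQLimit.integral_mul_fderiv {g : Euc n → ℝ} {H : Fin n → Euc n → ℝ}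
    (hg : IsDQLimit Ω h g H) (hcont : Continuous g) (ψ : Euc n → ℝ) (hψ : ContDiff ℝ 1 ψ)
    (hc : HasCompactSupport ψ) (hs : tsupport ψ ⊆ Ω) (i : Fin n) :
    ∫ x, g x * fderiv ℝ ψ x (EuclideanSpace.single i 1) = - ∫ x, H i x * ψ x := by
  obtain ⟨B, hB⟩ := hc.exists_bound_of_continuous hψ.continuous
  obtain ⟨L, hL⟩ := ContDiff.lipschitzWith_of_hasCompactSupport hc hψ one_ne_zero
  have hKm := (isClosed_tsupport ψ).measurableSet
  have hleft : Filter.Tendsto (fun k => ∫ x, diffQuot i (h k) g x * ψ x) Filter.atTop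
      (𝓝 (∫ x, H i x * ψ x)) := by
    obtain ⟨Z, hZ, hZ0, hd⟩ := hg.2 _ hc.isCompact hs
    refine tendsto_integral_filter_of_dominated_convergence
      ((tsupport ψ).indicator fun x => (1 + Z x) * B) ?_ ?_ ?_ ?_
    · exact Filter.Eventually.of_forall fun k =>
        ((diffQuot_continuous i (h k) g hcont).mul hψ.continuous).aestronglyMeasurable
    · filter_upwards [hd i] with k hk
      filter_upwards [hk] with x hx
      by_cases hxs : x ∈ tsupport ψ
      · rw [Set.indicator_of_mem hxs, norm_mul]
        have := hx hxs
        gcongr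
        · exact add_nonneg zero_le_one (hZ0 x)
        · nlinarith [sq_nonneg (‖diffQuot i (h k) g x‖ - 1)]
        · exact hB x
      · rw [Set.indicator_of_notMem hxs, image_eq_zero_of_notMem_tsupport hxs]; simp
    · rw [integrable_indicator_iff hKm]
      exact ((integrableOn_const hc.isCompact.measure_lt_top.ne).add hZ.integrableOn).mul_const _
    · filter_upwards [hg.1 i] with x hx
      by_cases hxs : x ∈ tsupport ψ
      · exact (hx (hs hxs)).mul_const _
      · simp [image_eq_zero_of_notMem_tsupport hxs]
  have hright : Filter.Tendsto (fun k => ∫ x, g x * diffQuot i (-h k) ψ x) Filter.atTop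
      (𝓝 (∫ x, g x * fderiv ℝ ψ x (EuclideanSpace.single i 1))) := by
    have hK' : IsCompact (Metric.cthickening 1 (tsupport ψ)) := hc.isCompact.cthickening
    obtain ⟨A, hA⟩ := hK'.exists_bound_of_continuousOn hcont.continuousOn
    refine tendsto_integral_filter_of_dominated_convergence
      ((Metric.cthickening 1 (tsupport ψ)).indicator fun x => A * L) ?_ ?_ ?_ ?_
    · exact Filter.Eventually.of_forall fun k =>
        (hcont.mul (diffQuot_continuous i (-h k) ψ hψ.continuous)).aestronglyMeasurable
    · filter_upwards [h0.eventually (Metric.ball_mem_nhds 0 one_pos)] with k hk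
      refine Filter.Eventually.of_forall fun x => ?_
      have hk1 : |-h k| ≤ 1 := by
        have : |h k| < 1 := by simpa using hk
        rw [abs_neg]; exact this.le
      by_cases hxs : x ∈ Metric.cthickening 1 (tsupport ψ)
      · rw [Set.indicator_of_mem hxs, norm_mul]
        exact mul_le_mul (hA x hxs) (norm_diffQuot_le i _ ψ L hL x) (norm_nonneg _)
          ((norm_nonneg _).trans (hA x hxs))
      · rw [Set.indicator_of_notMem hxs, diffQuot_eq_zero i _ 1 ψ x hk1 hxs]; simp
    · rw [integrable_indicator_iff hK'.measurableSet]
      exact integrableOn_const hK'.measure_lt_top.ne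
    · refine Filter.Eventually.of_forall fun x => Filter.Tendsto.const_mul _ ?_
      exact tendsto_diffQuot i (fun k => -h k) (by simpa using h0.neg)
        (fun k => neg_ne_zero.2 (hpos k).ne') ψ x (hψ.differentiable one_ne_zero x)
  have := tendsto_nhds_unique hleft ((hright.neg).congr fun k =>
    (integral_diffQuot_mul i (h k) g ψ hcont hψ.continuous hc).symm)
  rw [this, neg_neg]

end DifferenceQuotientLimits

/-- Smooth cut-off functions. -/
theorem exists_cutoff (K Ω : Set (Euc n)) (hK : IsCompact K) (hΩ : IsOpen Ω) (hKΩ : K ⊆ Ω) :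
    ∃ (η : Euc n → ℝ) (U : Set (Euc n)), ContDiff ℝ (⊤ : ℕ∞) η ∧ HasCompactSupport η ∧
      tsupport η ⊆ Ω ∧ (∀ x, 0 ≤ η x) ∧ (∀ x, η x ≤ 1) ∧ IsOpen U ∧ K ⊆ U ∧ U ⊆ tsupport η ∧
      ∀ x ∈ U, η x = 1 := by
  obtain ⟨K', hK', hKK', hK'Ω⟩ := exists_compact_between hK hΩ hKΩ
  obtain ⟨η, h1, h0, h01⟩ := exists_contMDiffMap_one_nhds_of_subset_interior
    (modelWithCornersSelf ℝ (Euc n)) (n := (⊤ : ℕ∞)) hK.isClosed hKK'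
  obtain ⟨U, hU, hKU, hU1⟩ := mem_nhdsSet_iff_exists.1 h1
  have hts : tsupport η ⊆ K' := closure_minimal
    (fun x hx => by by_contra h; exact hx (h0 x h)) hK'.isClosed
  exact ⟨η, U, η.contMDiff.contDiff, HasCompactSupport.of_support_subset_isCompact hK'
    ((subset_tsupport _).trans hts), hts.trans hK'Ω, fun x => (h01 x).1, fun x => (h01 x).2, hU,
    hKU, fun x hx => subset_tsupport _ (by
      rw [Function.mem_support, show η x = 1 from hU1 hx]; exact one_ne_zero), fun x hx => hU1 hx⟩

/-- Fatou's lemma for nonnegative real functions with bounded integrals. -/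
theorem integrable_of_tendsto_of_integral_le {X : Type*} [MeasurableSpace X] {μ : Measure X}
    (F : ℕ → X → ℝ) (F' : X → ℝ) (C : ℝ)
    (hF : ∀ k, Integrable (F k) μ) (h0 : ∀ k, 0 ≤ᵐ[μ] F k)
    (hC : ∀ᶠ k in Filter.atTop, ∫ x, F k x ∂μ ≤ C)
    (hlim : ∀ᵐ x ∂μ, Filter.Tendsto (fun k => F k x) Filter.atTop (𝓝 (F' x))) :
    Integrable F' μ ∧ 0 ≤ᵐ[μ] F' ∧ ∫ x, F' x ∂μ ≤ C := by
  have hm : AEStronglyMeasurable F' μ :=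
    aestronglyMeasurable_of_tendsto_ae Filter.atTop (fun k => (hF k).1) hlim
  have h0' : 0 ≤ᵐ[μ] F' := by
    filter_upwards [ae_all_iff.2 h0, hlim] with x hx hl using ge_of_tendsto' hl hx
  have hle : ∫⁻ x, ENNReal.ofReal (F' x) ∂μ ≤ ENNReal.ofReal C := by
    calc _ = ∫⁻ x, Filter.liminf (fun k => ENNReal.ofReal (F k x)) Filter.atTop ∂μ := by
          refine lintegral_congr_ae ?_
          filter_upwards [hlim] with x hx
          exact ((ENNReal.continuous_ofReal.tendsto _).comp hx).liminf_eq.symm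
      _ ≤ Filter.liminf (fun k => ∫⁻ x, ENNReal.ofReal (F k x) ∂μ) Filter.atTop :=
          lintegral_liminf_le' fun k => (hF k).1.aemeasurable.ennreal_ofReal
      _ ≤ _ := by
          refine Filter.liminf_le_of_frequently_le' (Filter.Eventually.frequently ?_)
          filter_upwards [hC] with k hk
          rw [← ofReal_integral_eq_lintegral_ofReal (hF k) (h0 k)]
          exact ENNReal.ofReal_le_ofReal hk
  have hC0 : 0 ≤ C := by
    obtain ⟨k, hk⟩ := hC.exists
    exact (integral_nonneg_of_ae (h0 k)).trans hk
  have hi : Integrable F' μ := by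
    refine ⟨hm, ?_⟩
    rw [hasFiniteIntegral_iff_ofReal h0']
    exact hle.trans_lt ENNReal.ofReal_lt_top
  refine ⟨hi, h0', ?_⟩
  rw [← ofReal_integral_eq_lintegral_ofReal hi h0'] at hle
  exact (ENNReal.ofReal_le_ofReal_iff hC0).1 hle

theorem eLpNorm_two_le_of_integral_sq_le {X E : Type*} [MeasurableSpace X] {μ : Measure X}
    [NormedAddCommGroup E] (g : X → E) (hg : MemLp g 2 μ) (C : ℝ)
    (h : ∫ x, ‖g x‖ ^ 2 ∂μ ≤ C) : eLpNorm g 2 μ ≤ ENNReal.ofReal (1 + C) := by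
  have h0 : 0 ≤ ∫ x, ‖g x‖ ^ 2 ∂μ := integral_nonneg fun x => by positivity
  rw [hg.eLpNorm_eq_integral_rpow_norm (by norm_num) (by norm_num)]
  apply ENNReal.ofReal_le_ofReal
  have e : ∫ x, ‖g x‖ ^ (ENNReal.toReal 2) ∂μ = ∫ x, ‖g x‖ ^ 2 ∂μ := by
    simp
  rw [e, ENNReal.toReal_ofNat, ← one_div, ← Real.sqrt_eq_rpow]
  apply Real.sqrt_le_iff.2
  constructor <;> nlinarith

theorem diffQuot_smul_eq {E : Type*} [NormedAddCommGroup E] [NormedSpace ℝ E] (i : Fin n) (h : ℝ)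
    (η : Euc n → ℝ) (G : Euc n → E) (x : Euc n) :
    diffQuot i h (fun y => η y • G y) x =
      diffQuot i h η x • G (x + h • EuclideanSpace.single i 1) + η x • diffQuot i h G x := by
  simp only [diffQuot, smul_sub, sub_smul, smul_eq_mul, mul_sub, mul_smul, smul_comm (η x)]
  abel

/-- The gradient of a weak solution is locally a limit of difference quotients in `L²`; the limits
vanish on the critical set if `p < 2`. -/
theorem exists_isDQLimit_gradient (p : ℝ) (hp1 : 1 < p) (hp2 : p ≤ 2) (Ω : Set (Euc n))
    (hΩ : IsOpen Ω) (u f : Euc n → ℝ) (hu : ContDiff ℝ 1 u) (huc : HasCompactSupport u)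
    (hf : ContDiff ℝ 1 f) (hfc : HasCompactSupport f)
    (heq : WeakDiv Ω (fun x => stress p (gradient u x)) f) (K : Set (Euc n)) (hK : IsCompact K)
    (hKΩ : K ⊆ Ω) :
    ∃ U : Set (Euc n), IsOpen U ∧ K ⊆ U ∧ U ⊆ Ω ∧ ∃ h : ℕ → ℝ, (∀ k, 0 < h k) ∧
      Filter.Tendsto h Filter.atTop (𝓝 0) ∧ ∃ H : Fin n → Euc n → Euc n,
        (∀ i, StronglyMeasurable (H i)) ∧ IsDQLimit U h (gradient u) H ∧
        (p < 2 → ∀ i, ∀ᵐ x, x ∈ U → gradient u x = 0 → H i x = 0) := by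
  obtain ⟨η, U0, hη, hηc, hηs, hη0, hη1, hU0, hKU0, hU0s, hU01⟩ := exists_cutoff K Ω hK hΩ hKΩ
  set G : Euc n → Euc n := gradient u with hG
  have hGc : Continuous G := continuous_gradient u hu
  have hGs : HasCompactSupport G := hasCompactSupport_gradient u huc
  obtain ⟨M0, hM0⟩ := hGs.exists_bound_of_continuous hGc
  obtain ⟨M, hM⟩ := exists_gt (max M0 0)
  have hMpos : 0 < M := (le_max_right _ _).trans_lt hM
  have hGM : ∀ x, ‖G x‖ ≤ M := fun x => (hM0 x).trans ((le_max_left _ _).trans hM.le)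
  have hc0 : 0 < (p - 1) * M ^ (p - 2) := mul_pos (by linarith) (by positivity)
  have hcacc : ∀ i : Fin n, ∃ C h0 : ℝ, 0 < h0 ∧ ∀ h, 0 < h → h < h0 →
      ∫ x, η x ^ 2 * ⟪stress p (G (x + h • EuclideanSpace.single i 1)) - stress p (G x),
        G (x + h • EuclideanSpace.single i 1) - G x⟫_ℝ ≤ C * h ^ 2 := fun i =>
    caccioppoli p hp1 hp2 Ω hΩ u f hu huc hf hfc heq η hη hηc hηs (EuclideanSpace.single i 1)
      (by simp)
  choose C h0 hh0 hC using hcacc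
  set Q : Fin n → ℝ → Euc n → ℝ := fun i h x =>
    η x ^ 2 * ⟪stress p (G (x + h • EuclideanSpace.single i 1)) - stress p (G x),
        G (x + h • EuclideanSpace.single i 1) - G x⟫_ℝ with hQ
  have hsc : ∀ i (h : ℝ), Continuous fun x => G (x + h • EuclideanSpace.single i (1 : ℝ)) :=
    fun i h => hGc.comp (continuous_id.add continuous_const)
  have hQi : ∀ i h, Integrable (Q i h) volume := by
    intro i h
    refine Continuous.integrable_of_hasCompactSupport ?_
      (hηc.mono fun x hx h0 => hx (by simp [hQ, h0]))
    have h2 := (continuous_stress (n := n) p hp1).comp (hsc i h)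
    have h3 := (continuous_stress (n := n) p hp1).comp hGc
    exact (hη.continuous.pow 2).mul ((h2.sub h3).inner ((hsc i h).sub hGc))
  have hQlow : ∀ i h x, (p - 1) * M ^ (p - 2) *
      (η x ^ 2 * ‖G (x + h • EuclideanSpace.single i 1) - G x‖ ^ 2) ≤ Q i h x := by
    intro i h x
    have := mul_le_mul_of_nonneg_left
      (stress_monotone p M hp1 hp2 hMpos _ _ (hGM (x + h • EuclideanSpace.single i 1)) (hGM x))
      (sq_nonneg (η x))
    simp only [hQ]
    linarith
  set v : Euc n → Euc n := fun y => η y • G y with hv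
  have hvc : Continuous v := hη.continuous.smul hGc
  have hvs : HasCompactSupport v := hηc.mono fun x hx h0 => hx (by simp [hv, h0])
  have hpow : ∀ k : ℕ, (0 : ℝ) < (1 / 2) ^ k := fun k => by positivity
  have hpow0 : Filter.Tendsto (fun k : ℕ => ((1 : ℝ) / 2) ^ k) Filter.atTop (𝓝 0) :=
    tendsto_pow_atTop_nhds_zero_of_lt_one (by norm_num) (by norm_num)
  have hdqsq : ∀ i h x, 0 < h → ‖η x • diffQuot i h G x‖ ^ 2 =
      (h ^ 2)⁻¹ * (η x ^ 2 * ‖G (x + h • EuclideanSpace.single i 1) - G x‖ ^ 2) := by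
    intro i h x hh
    simp only [diffQuot, norm_smul, norm_inv, Real.norm_eq_abs, mul_pow, sq_abs, inv_pow]
    ring
  have hlp : ∀ g : Euc n → Euc n, Continuous g → HasCompactSupport g → MemLp g 2 volume :=
    fun g hg hgc => hg.memLp_of_hasCompactSupport hgc
  have hdG : ∀ i h, MemLp (fun x => η x • diffQuot i h G x) 2 volume := fun i h =>
    hlp _ (hη.continuous.smul (diffQuot_continuous i h G hGc))
      (hηc.mono fun x hx h0 => hx (by simp [h0]))
  obtain ⟨L, hL⟩ := ContDiff.lipschitzWith_of_hasCompactSupport hηc hη (by simp)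
  have hbd : ∃ C' : ℝ, ∀ i, ∀ᶠ k : ℕ in Filter.atTop,
      eLpNorm (diffQuot i ((1 / 2) ^ k) v) 2 volume ≤ ENNReal.ofReal C' := by
    have hA : ∃ A : ℝ, 0 ≤ A ∧ ∀ i (h : ℝ), eLpNorm (fun x => diffQuot i h η x •
        G (x + h • EuclideanSpace.single i 1)) 2 volume ≤ ENNReal.ofReal A := by
      refine ⟨(ENNReal.ofReal L * eLpNorm G 2 volume).toReal, ENNReal.toReal_nonneg,
        fun i h => ?_⟩
      rw [ENNReal.ofReal_toReal (ENNReal.mul_ne_top ENNReal.ofReal_ne_top (hlp G hGc hGs).2.ne)]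
      have h1 : eLpNorm (fun x => G (x + h • EuclideanSpace.single i (1 : ℝ))) 2 volume =
          eLpNorm G 2 volume :=
        eLpNorm_comp_measurePreserving hGc.aestronglyMeasurable
          (measurePreserving_add_right volume (h • EuclideanSpace.single i (1 : ℝ)))
      rw [← h1]
      refine eLpNorm_le_mul_eLpNorm_of_ae_le_mul (Filter.Eventually.of_forall fun x => ?_) 2
      rw [norm_smul]
      gcongr
      exact norm_diffQuot_le i h η L hL x
    obtain ⟨A, hA0, hA⟩ := hA
    refine ⟨A + ∑ j, (1 + ((p - 1) * M ^ (p - 2))⁻¹ * |C j|), fun i => ?_⟩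
    filter_upwards [hpow0.eventually (gt_mem_nhds (hh0 i))] with k hk
    set h : ℝ := (1 / 2) ^ k
    have hB : eLpNorm (fun x => η x • diffQuot i h G x) 2 volume ≤
        ENNReal.ofReal (1 + ((p - 1) * M ^ (p - 2))⁻¹ * |C i|) := by
      refine eLpNorm_two_le_of_integral_sq_le _ (hdG i h) _ ?_
      have h2 : 0 < h ^ 2 := pow_pos (hpow k) 2
      have hne : h ≠ 0 := (hpow k).ne'
      calc ∫ x, ‖η x • diffQuot i h G x‖ ^ 2
          ≤ ∫ x, ((p - 1) * M ^ (p - 2))⁻¹ * (h ^ 2)⁻¹ * Q i h x := by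
            refine integral_mono ((memLp_two_iff_integrable_sq_norm (hdG i h).1).1 (hdG i h))
              ((hQi i h).const_mul _) fun x => ?_
            simp only []
            rw [hdqsq i h x (hpow k), mul_comm _⁻¹ (h ^ 2)⁻¹, mul_assoc]
            refine mul_le_mul_of_nonneg_left ?_ (by positivity)
            rw [le_inv_mul_iff₀ hc0]
            exact hQlow i h x
        _ = ((p - 1) * M ^ (p - 2))⁻¹ * (h ^ 2)⁻¹ * ∫ x, Q i h x := integral_const_mul _ _
        _ ≤ ((p - 1) * M ^ (p - 2))⁻¹ * (h ^ 2)⁻¹ * (|C i| * h ^ 2) := by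
            gcongr
            exact (hC i h (hpow k) hk).trans (by gcongr; exact le_abs_self _)
        _ = _ := by field_simp
    have e : diffQuot i h v = (fun x => diffQuot i h η x •
        G (x + h • EuclideanSpace.single i 1)) + fun x => η x • diffQuot i h G x := by
      ext1 x; exact diffQuot_smul_eq i h η G x
    rw [e]
    refine (eLpNorm_add_le ?_ (hdG i h).1 (by norm_num)).trans ?_
    · exact ((diffQuot_continuous i h η hη.continuous).smul (hsc i h)).aestronglyMeasurable
    · refine (add_le_add (hA i h) hB).trans ?_
      rw [← ENNReal.ofReal_add hA0 (by positivity)]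
      apply ENNReal.ofReal_le_ofReal
      gcongr
      exact Finset.single_le_sum (f := fun j => 1 + ((p - 1) * M ^ (p - 2))⁻¹ * |C j|)
        (fun j _ => by positivity) (Finset.mem_univ i)
  obtain ⟨C', hC'⟩ := hbd
  obtain ⟨φ, hφ, H, Z, hH2, hHm, hZ, hZ0, hHZ⟩ := exists_diffQuot_limit v (hlp v hvc hvs) C' hC'
  set h : ℕ → ℝ := fun k => (1 / 2) ^ (φ k) with hh
  have hpos : ∀ k, 0 < h k := fun k => hpow _
  have hh0' : Filter.Tendsto h Filter.atTop (𝓝 0) := hpow0.comp hφ.tendsto_atTop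
  have hvG : ∀ x ∈ U0, v x = G x := fun x hx => by simp [hv, hU01 x hx]
  have hlimU : ∀ i, ∀ᵐ x, x ∈ U0 →
      Filter.Tendsto (fun k => diffQuot i (h k) G x) Filter.atTop (𝓝 (H i x)) := by
    intro i
    filter_upwards [(hHZ i).1] with x hx hxU
    refine hx.congr' ?_
    filter_upwards [(tendsto_translate h hh0' x (EuclideanSpace.single i 1)).eventually
      (hU0.mem_nhds hxU)] with k hk
    simp only [diffQuot]
    rw [hvG _ hk, hvG _ hxU]
  refine ⟨U0, hU0, hKU0, hU0s.trans hηs, h, hpos, hh0', H, hHm, ⟨hlimU, ?_⟩, ?_⟩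
  · intro K' hK' hK'U
    obtain ⟨r, hr, hrU⟩ := hK'.exists_cthickening_subset_open hU0 hK'U
    refine ⟨Z, hZ, hZ0, fun i => ?_⟩
    filter_upwards [hh0'.eventually (Metric.ball_mem_nhds 0 hr)] with k hk
    filter_upwards [(hHZ i).2 k] with x hx hxK
    have h1 : x + h k • EuclideanSpace.single i (1 : ℝ) ∈ U0 := by
      refine hrU (Metric.mem_cthickening_of_dist_le _ _ _ _ hxK ?_)
      have : |h k| < r := by simpa using hk
      simpa [norm_smul] using this.le
    have e : diffQuot i (h k) v x = diffQuot i (h k) G x := by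
      simp only [diffQuot]
      rw [hvG _ h1, hvG _ (hK'U hxK)]
    rw [← e]; exact hx
  · intro hp i
    have hclosed : IsClosed {x | G x = 0} := isClosed_eq hGc continuous_const
    set S : Set (Euc n) := U0 ∩ {x | G x = 0} with hS
    have hSm : MeasurableSet S := hU0.measurableSet.inter hclosed.measurableSet
    have hGu : UniformContinuous G := hGs.uniformContinuous_of_continuous hGc
    have hFat : ∀ δ > 0, Integrable (fun x => ‖H i x‖ ^ 2) (volume.restrict S) ∧
        0 ≤ᵐ[volume.restrict S] (fun x => ‖H i x‖ ^ 2) ∧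
        ∫ x in S, ‖H i x‖ ^ 2 ≤ δ ^ (2 - p) * |C i| := by
      intro δ hδ
      obtain ⟨r, hr, hrG⟩ := Metric.uniformContinuous_iff.1 hGu δ hδ
      refine integrable_of_tendsto_of_integral_le
        (fun k x => ‖η x • diffQuot i (h k) G x‖ ^ 2) _ _ (fun k =>
          ((memLp_two_iff_integrable_sq_norm (hdG i (h k)).1).1 (hdG i (h k))).restrict)
        (fun k => Filter.Eventually.of_forall fun x => by positivity) ?_ ?_
      · filter_upwards [hh0'.eventually (gt_mem_nhds (hh0 i)), hh0'.eventually (gt_mem_nhds hr)]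
          with k hk hkr
        have h2 : 0 < h k ^ 2 := pow_pos (hpos k) 2
        have hne : h k ≠ 0 := (hpos k).ne'
        calc ∫ x in S, ‖η x • diffQuot i (h k) G x‖ ^ 2
            ≤ ∫ x in S, δ ^ (2 - p) * (h k ^ 2)⁻¹ * Q i (h k) x := by
              refine setIntegral_mono_on
                ((memLp_two_iff_integrable_sq_norm (hdG i (h k)).1).1 (hdG i (h k))).integrableOn
                ((hQi i (h k)).const_mul _).integrableOn hSm fun x hx => ?_
              have hx0 : G x = 0 := hx.2
              rw [hdqsq i (h k) x (hpos k), mul_comm (δ ^ (2 - p)), mul_assoc]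
              refine mul_le_mul_of_nonneg_left ?_ (by positivity)
              simp only [hQ, hx0, sub_zero]
              have hst : stress p (0 : Euc n) = 0 := by simp [stress]
              rw [hst, sub_zero, stress, real_inner_smul_left, real_inner_self_eq_norm_sq]
              have hsmall : ‖G (x + h k • EuclideanSpace.single i 1)‖ ≤ δ := by
                have := hrG (a := x + h k • EuclideanSpace.single i 1) (b := x)
                  (by simpa [norm_smul, abs_of_pos (hpos k)] using hkr)
                rw [hx0, dist_zero_right] at this
                exact this.le
              set a := G (x + h k • EuclideanSpace.single i 1)
              rcases eq_or_ne a 0 with ha | ha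
              · simp [ha]
              · have ha' : 0 < ‖a‖ := norm_pos_iff.2 ha
                have h3 : 1 ≤ δ ^ (2 - p) * ‖a‖ ^ (p - 2) := by
                  calc (1 : ℝ) = ‖a‖ ^ (2 - p) * ‖a‖ ^ (p - 2) := by
                        rw [← Real.rpow_add ha']; simp
                    _ ≤ _ := by
                      gcongr
                nlinarith [mul_nonneg (sq_nonneg (η x)) (sq_nonneg ‖a‖)]
          _ ≤ ∫ x, δ ^ (2 - p) * (h k ^ 2)⁻¹ * Q i (h k) x := by
              refine setIntegral_le_integral ((hQi i (h k)).const_mul _)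
                (Filter.Eventually.of_forall fun x => ?_)
              have := (mul_nonneg hc0.le (by positivity)).trans (hQlow i (h k) x)
              exact mul_nonneg (by positivity) this
          _ = δ ^ (2 - p) * (h k ^ 2)⁻¹ * ∫ x, Q i (h k) x := integral_const_mul _ _
          _ ≤ δ ^ (2 - p) * (h k ^ 2)⁻¹ * (|C i| * h k ^ 2) := by
              gcongr
              exact (hC i (h k) (hpos k) hk).trans (by gcongr; exact le_abs_self _)
          _ = _ := by field_simp
      · rw [ae_restrict_iff' hSm]
        filter_upwards [hlimU i] with x hx hxS
        have := (hx hxS.1).norm.pow 2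
        simpa [hU01 x hxS.1] using this
    have hzero : ∫ x in S, ‖H i x‖ ^ 2 ≤ 0 := by
      refine ge_of_tendsto (x := 𝓝[>] (0 : ℝ)) (f := fun δ => δ ^ (2 - p) * |C i|) ?_ ?_
      · have : Filter.Tendsto (fun δ : ℝ => δ ^ (2 - p) * |C i|) (𝓝 0) (𝓝 ((0 : ℝ) ^ (2 - p) * |C i|)) :=
          ((Real.continuousAt_rpow_const 0 (2 - p) (Or.inr (by linarith))).tendsto).mul_const _
        rw [Real.zero_rpow (by linarith), zero_mul] at this
        exact this.mono_left nhdsWithin_le_nhds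
      · filter_upwards [self_mem_nhdsWithin] with δ hδ using (hFat δ hδ).2.2
    obtain ⟨hI, hn, -⟩ := hFat 1 one_pos
    have h1 := (integral_eq_zero_iff_of_nonneg_ae hn hI).1
      (le_antisymm hzero (integral_nonneg_of_ae hn))
    rw [Filter.EventuallyEq, ae_restrict_iff' hSm] at h1
    filter_upwards [h1] with x hx hxU hxG
    have := hx ⟨hxU, hxG⟩
    simpa using this

/-- The function `t ↦ t ^ (s / 2)`, smoothly cut off to zero for `t ≤ ε ^ 2`. -/
def cutPow (ε s t : ℝ) : ℝ := Real.smoothTransition (t / ε ^ 2 - 1) * t ^ (s / 2)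

/-- The field `z ↦ ‖z‖ ^ s • z`, smoothly cut off near the origin. -/
def cutField (ε s : ℝ) (z : Euc n) : Euc n := cutPow ε s (‖z‖ ^ 2) • z

theorem cutPow_eq_zero (ε s t : ℝ) (hε : 0 < ε) (ht : t ≤ ε ^ 2) : cutPow ε s t = 0 := by
  rw [cutPow, Real.smoothTransition.zero_of_nonpos, zero_mul]
  rw [sub_nonpos, div_le_one (by positivity)]; exact ht

theorem cutPow_eq (ε s t : ℝ) (hε : 0 < ε) (ht : 2 * ε ^ 2 ≤ t) : cutPow ε s t = t ^ (s / 2) := by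
  rw [cutPow, Real.smoothTransition.one_of_one_le, one_mul]
  have : 2 ≤ t / ε ^ 2 := (le_div_iff₀ (by positivity)).2 ht
  linarith

theorem cutPow_nonneg (ε s t : ℝ) (hε : 0 < ε) : 0 ≤ cutPow ε s t := by
  rcases le_or_gt t (ε ^ 2) with h | h
  · rw [cutPow_eq_zero ε s t hε h]
  · exact mul_nonneg (Real.smoothTransition.nonneg _)
      (Real.rpow_nonneg ((by positivity : 0 ≤ ε ^ 2).trans h.le) _)

theorem cutPow_le (ε s t : ℝ) (ht : 0 ≤ t) : cutPow ε s t ≤ t ^ (s / 2) :=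
  mul_le_of_le_one_left (Real.rpow_nonneg ht _) (Real.smoothTransition.le_one _)

theorem contDiff_cutPow (ε s : ℝ) (hε : 0 < ε) : ContDiff ℝ 1 (cutPow ε s) := by
  rw [contDiff_iff_contDiffAt]
  intro t
  rcases lt_or_ge t (ε ^ 2) with h | h
  · refine (contDiffAt_const (c := (0 : ℝ))).congr_of_eventuallyEq ?_
    filter_upwards [gt_mem_nhds h] with y hy using cutPow_eq_zero ε s y hε hy.le
  · have ht : 0 < t := lt_of_lt_of_le (by positivity) h
    refine ContDiffAt.mul ?_ (Real.contDiffAt_rpow_const_of_ne ht.ne')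
    exact (Real.smoothTransition.contDiff.comp (by fun_prop)).contDiffAt

theorem hasDerivAt_cutPow (ε s t : ℝ) (ht : 0 < t) :
    HasDerivAt (cutPow ε s) (deriv Real.smoothTransition (t / ε ^ 2 - 1) * (1 / ε ^ 2) *
      t ^ (s / 2) + Real.smoothTransition (t / ε ^ 2 - 1) * (s / 2 * t ^ (s / 2 - 1))) t := by
  have h1 : HasDerivAt (fun t : ℝ => t / ε ^ 2 - 1) (1 / ε ^ 2) t :=
    ((hasDerivAt_id t).div_const _).sub_const _
  have h2 : HasDerivAt Real.smoothTransition (deriv Real.smoothTransition (t / ε ^ 2 - 1))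
      (t / ε ^ 2 - 1) :=
    (Real.smoothTransition.contDiff (n := 1)).differentiable one_ne_zero _ |>.hasDerivAt
  exact (h2.comp t h1).mul (Real.hasDerivAt_rpow_const (Or.inl ht.ne'))

theorem two_mul_deriv_cutPow (ε s t : ℝ) (ht : 0 < t) :
    2 * deriv (cutPow ε s) t * t = 2 * deriv Real.smoothTransition (t / ε ^ 2 - 1) * (t / ε ^ 2) *
      t ^ (s / 2) + s * cutPow ε s t := by
  rw [(hasDerivAt_cutPow ε s t ht).deriv, cutPow]
  have : t ^ (s / 2 - 1) * t = t ^ (s / 2) := by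
    rw [← Real.rpow_add_one ht.ne']; simp
  rw [← this]; ring

theorem deriv_smoothTransition_nonneg (t : ℝ) : 0 ≤ deriv Real.smoothTransition t :=
  Real.smoothTransition.monotone.deriv_nonneg

theorem mul_cutPow_le (ε s t : ℝ) (hε : 0 < ε) (ht : 0 ≤ t) :
    s * cutPow ε s t ≤ 2 * deriv (cutPow ε s) t * t := by
  rcases ht.eq_or_lt with rfl | ht
  · rw [cutPow_eq_zero ε s 0 hε (by positivity)]; simp
  · rw [two_mul_deriv_cutPow ε s t ht]
    have := deriv_smoothTransition_nonneg (t / ε ^ 2 - 1)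
    have : 0 ≤ 2 * deriv Real.smoothTransition (t / ε ^ 2 - 1) * (t / ε ^ 2) * t ^ (s / 2) := by
      positivity
    linarith

theorem exists_bound_deriv_cutPow (s : ℝ) : ∃ C, 0 ≤ C ∧ ∀ ε t, 0 < ε → 0 ≤ t →
    |2 * deriv (cutPow ε s) t * t| ≤ C * t ^ (s / 2) := by
  have hc : Continuous (deriv Real.smoothTransition) :=
    (Real.smoothTransition.contDiff (n := 1)).continuous_deriv le_rfl
  obtain ⟨A, hA⟩ := (isCompact_Icc (a := (0 : ℝ)) (b := 1)).exists_bound_of_continuousOn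
    hc.continuousOn
  have hA0 : 0 ≤ A := (norm_nonneg _).trans (hA 0 (by simp))
  refine ⟨4 * A + |s|, by positivity, fun ε t hε ht => ?_⟩
  rcases ht.eq_or_lt with rfl | ht
  · simp only [mul_zero, abs_zero]; positivity
  rw [two_mul_deriv_cutPow ε s t ht]
  have h1 : |2 * deriv Real.smoothTransition (t / ε ^ 2 - 1) * (t / ε ^ 2) * t ^ (s / 2)| ≤
      4 * A * t ^ (s / 2) := by
    rw [abs_mul, abs_of_nonneg (Real.rpow_nonneg ht.le _)]
    refine mul_le_mul_of_nonneg_right ?_ (by positivity)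
    rcases lt_or_ge (t / ε ^ 2 - 1) 0 with h | h
    · have : deriv Real.smoothTransition (t / ε ^ 2 - 1) = 0 := by
        have e : Real.smoothTransition =ᶠ[𝓝 (t / ε ^ 2 - 1)] fun _ => 0 := by
          filter_upwards [gt_mem_nhds h] with y hy
          exact Real.smoothTransition.zero_of_nonpos hy.le
        rw [e.deriv_eq]; simp
      rw [this]; simp; positivity
    rcases lt_or_ge 1 (t / ε ^ 2 - 1) with h' | h'
    · have : deriv Real.smoothTransition (t / ε ^ 2 - 1) = 0 := by
        have e : Real.smoothTransition =ᶠ[𝓝 (t / ε ^ 2 - 1)] fun _ => 1 := by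
          filter_upwards [lt_mem_nhds h'] with y hy
          exact Real.smoothTransition.one_of_one_le hy.le
        rw [e.deriv_eq]; simp
      rw [this]; simp; positivity
    have h2 := hA _ ⟨h, h'⟩
    rw [Real.norm_eq_abs] at h2
    rw [abs_mul, abs_mul, abs_of_nonneg (by linarith : (0 : ℝ) ≤ t / ε ^ 2), abs_two]
    nlinarith [abs_nonneg (deriv Real.smoothTransition (t / ε ^ 2 - 1))]
  have h2 : |s * cutPow ε s t| ≤ |s| * t ^ (s / 2) := by
    rw [abs_mul, abs_of_nonneg (cutPow_nonneg ε s t hε)]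
    gcongr
    exact cutPow_le ε s t ht.le
  calc _ ≤ _ := abs_add_le _ _
    _ ≤ 4 * A * t ^ (s / 2) + |s| * t ^ (s / 2) := add_le_add h1 h2
    _ = _ := by ring

theorem contDiff_cutField (ε s : ℝ) (hε : 0 < ε) : ContDiff ℝ 1 (cutField ε s : Euc n → Euc n) :=
  ((contDiff_cutPow ε s hε).comp (contDiff_norm_sq ℝ)).smul contDiff_id

theorem fderiv_cutField (ε s : ℝ) (hε : 0 < ε) (z w : Euc n) :
    fderiv ℝ (cutField ε s) z w = cutPow ε s (‖z‖ ^ 2) • w +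
      (2 * deriv (cutPow ε s) (‖z‖ ^ 2) * ⟪z, w⟫_ℝ) • z := by
  have h1 : HasFDerivAt (fun z : Euc n => ‖z‖ ^ 2) (2 • innerSL ℝ z) z :=
    (hasStrictFDerivAt_norm_sq z).hasFDerivAt
  have h2 := ((contDiff_cutPow ε s hε).differentiable one_ne_zero (‖z‖ ^ 2)).hasDerivAt
  have h3 := (h2.comp_hasFDerivAt z h1).smul (hasFDerivAt_id z)
  have h4 : HasFDerivAt (cutField ε s) _ z := h3
  rw [h4.fderiv]
  simp [mul_assoc, mul_left_comm]

theorem cutField_eq_stress (ε p : ℝ) (hε : 0 < ε) (z : Euc n) (hz : 2 * ε ^ 2 ≤ ‖z‖ ^ 2) :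
    cutField ε (p - 2) z = stress p z := by
  rw [cutField, stress, cutPow_eq ε _ _ hε hz, ← Real.rpow_natCast, ← Real.rpow_mul (norm_nonneg _)]
  congr 2
  push_cast
  ring

theorem clm_apply_eq_sum {F : Type*} [NormedAddCommGroup F] [NormedSpace ℝ F]
    (L : Euc n →L[ℝ] F) (v : Euc n) : L v = ∑ i, v i • L (EuclideanSpace.single i 1) := by
  conv_lhs => rw [← (EuclideanSpace.basisFun (Fin n) ℝ).sum_repr v]
  simp [map_sum]

theorem IsDQLimit.coord {Ω : Set (Euc n)} {h : ℕ → ℝ}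
    (h0 : Filter.Tendsto h Filter.atTop (𝓝 0)) (hpos : ∀ k, 0 < h k) {g : Euc n → Euc n}
    {D : Fin n → Euc n → Euc n} (hg : IsDQLimit Ω h g D) (R : ℝ) (hR : ∀ x, ‖g x‖ ≤ R)
    (j : Fin n) : IsDQLimit Ω h (fun x => g x j) (fun i x => D i x j) := by
  have := hg.comp h0 hpos R hR (EuclideanSpace.proj (𝕜 := ℝ) j) (ContinuousLinearMap.contDiff _)
  simp only [ContinuousLinearMap.fderiv] at this
  exact this

theorem IsDQLimit.integral_div {Ω : Set (Euc n)} {h : ℕ → ℝ} (hpos : ∀ k, 0 < h k)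
    (h0 : Filter.Tendsto h Filter.atTop (𝓝 0)) {g : Euc n → Euc n} {D : Fin n → Euc n → Euc n}
    (hg : IsDQLimit Ω h g D) (hcont : Continuous g) (R : ℝ) (hR : ∀ x, ‖g x‖ ≤ R) (ψ : Euc n → ℝ)
    (hψ : ContDiff ℝ 1 ψ) (hc : HasCompactSupport ψ) (hs : tsupport ψ ⊆ Ω) :
    Integrable (fun x => (∑ i, D i x i) * ψ x) volume ∧
    ∫ x, fderiv ℝ ψ x (g x) = - ∫ x, (∑ i, D i x i) * ψ x := by
  have hgc : ∀ i, Continuous fun x => g x i := fun i => by fun_prop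
  have hi : ∀ i, Integrable (fun x => D i x i * ψ x) volume := by
    intro i
    have h1 := (hg.coord h0 hpos R hR i).memLp (hgc i) _ hc.isCompact hs i
    have : IsFiniteMeasure (volume.restrict (tsupport ψ)) :=
      ⟨by simpa using hc.isCompact.measure_lt_top⟩
    obtain ⟨B, hB⟩ := hc.exists_bound_of_continuous hψ.continuous
    have h2 : IntegrableOn (fun x => D i x i * ψ x) (tsupport ψ) volume :=
      (h1.integrable one_le_two).mul_bdd (c := B) hψ.continuous.aestronglyMeasurable
        (Filter.Eventually.of_forall hB)
    refine (integrableOn_iff_integrable_of_support_subset fun x hx => ?_).1 h2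
    by_contra hx'
    exact hx (by simp [image_eq_zero_of_notMem_tsupport hx'])
  have e1 : ∀ x, fderiv ℝ ψ x (g x) =
      ∑ i, g x i * fderiv ℝ ψ x (EuclideanSpace.single i 1) := fun x => by
    rw [clm_apply_eq_sum]; simp
  have hi2 : ∀ i, Integrable (fun x => g x i * fderiv ℝ ψ x (EuclideanSpace.single i 1))
      volume := by
    intro i
    refine Continuous.integrable_of_hasCompactSupport
      ((hgc i).mul ((hψ.continuous_fderiv one_ne_zero).clm_apply continuous_const))
      ((hc.fderiv ℝ).mono fun x hx h0 => hx (by simp [h0]))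
  simp only [e1, Finset.sum_mul]
  refine ⟨integrable_finsetSum _ fun i _ => hi i, ?_⟩
  rw [integral_finsetSum _ fun i _ => hi2 i, integral_finsetSum _ fun i _ => hi i,
    ← Finset.sum_neg_distrib]
  refine Finset.sum_congr rfl fun i _ => ?_
  exact (hg.coord h0 hpos R hR i).integral_mul_fderiv hpos h0 (hgc i) ψ hψ hc hs i

theorem IsDQLimit.locallyIntegrableOn {Ω : Set (Euc n)} {h : ℕ → ℝ} (hΩ : IsOpen Ω)
    {g : Euc n → ℝ} {D : Fin n → Euc n → ℝ} (hg : IsDQLimit Ω h g D) (hcont : Continuous g)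
    (i : Fin n) : LocallyIntegrableOn (D i) Ω volume := by
  rw [locallyIntegrableOn_iff hΩ.isLocallyClosed]
  intro K hKΩ hK
  have : IsFiniteMeasure (volume.restrict K) := ⟨by simpa using hK.measure_lt_top⟩
  exact (hg.memLp hcont K hK hKΩ i).integrable one_le_two

/-- The pointwise form of an equation in divergence form. -/
theorem ae_sum_fderiv_eq (Ω W : Set (Euc n)) (hW : IsOpen W) (hWΩ : W ⊆ Ω) (h : ℕ → ℝ)
    (hpos : ∀ k, 0 < h k) (h0 : Filter.Tendsto h Filter.atTop (𝓝 0)) (G V : Euc n → Euc n)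
    (f : Euc n → ℝ) (hf : Continuous f) (hG : Continuous G) (hGc : HasCompactSupport G)
    (H : Fin n → Euc n → Euc n) (hH : IsDQLimit Ω h G H) (heq : WeakDiv Ω V f)
    (Ψ : Euc n → Euc n) (hΨ : ContDiff ℝ 1 Ψ) (hV : ∀ x ∈ W, V x = Ψ (G x)) :
    ∀ᵐ x, x ∈ W → ∑ i, fderiv ℝ Ψ (G x) (H i x) i = - f x := by
  obtain ⟨M, hM⟩ := hGc.exists_bound_of_continuous hG
  have hΨG : Continuous fun x => Ψ (G x) := hΨ.continuous.comp hG
  obtain ⟨R, hR⟩ : ∃ R, ∀ x, ‖Ψ (G x)‖ ≤ R := by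
    obtain ⟨R, hR⟩ := (isCompact_closedBall (0 : Euc n) M).exists_bound_of_continuousOn
      hΨ.continuous.continuousOn
    exact ⟨R, fun x => hR _ (by simpa using hM x)⟩
  have hD := (hH.mono hWΩ).comp h0 hpos M hM Ψ hΨ
  have key : ∀ᵐ x, x ∈ W → f x + ∑ i, fderiv ℝ Ψ (G x) (H i x) i = 0 := by
    refine hW.ae_eq_zero_of_integral_contDiff_smul_eq_zero ?_ fun ψ hψ hψc hψs => ?_
    · refine (hf.locallyIntegrable.locallyIntegrableOn _).add ?_
      have : ∀ s : Finset (Fin n), LocallyIntegrableOn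
          (fun x => ∑ i ∈ s, fderiv ℝ Ψ (G x) (H i x) i) W volume := by
        intro s
        induction s using Finset.induction_on with
        | empty =>
          simp only [Finset.sum_empty]
          exact (locallyIntegrable_const 0).locallyIntegrableOn _
        | insert i s hi ih =>
          simp only [Finset.sum_insert hi]
          exact ((hD.coord h0 hpos R hR i).locallyIntegrableOn hW (by fun_prop) i).add ih
      exact this Finset.univ
    · have hψ1 : ContDiff ℝ 1 ψ := hψ.of_le (by exact_mod_cast le_top)
      obtain ⟨hi, he⟩ := hD.integral_div hpos h0 hΨG R hR ψ hψ1 hψc hψs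
      have h1 := heq ψ hψ1 hψc (hψs.trans hWΩ)
      have h2 : ∫ x, fderiv ℝ ψ x (V x) = ∫ x, fderiv ℝ ψ x (Ψ (G x)) := by
        refine integral_congr_ae (Filter.Eventually.of_forall fun x => ?_)
        by_cases hx : x ∈ tsupport ψ
        · simp only [hV x (hψs hx)]
        · simp [fderiv_eq_zero_of_notMem ψ _ subset_rfl x hx]
      have h3 : Integrable (fun x => f x * ψ x) volume :=
        (hf.mul hψ.continuous).integrable_of_hasCompactSupport hψc.mul_left
      have h4 : ∀ x, ψ x • (f x + ∑ i, fderiv ℝ Ψ (G x) (H i x) i) =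
          f x * ψ x + (∑ i, fderiv ℝ Ψ (G x) (H i x) i) * ψ x := fun x => by
        rw [smul_eq_mul]; ring
      simp only [h4]
      rw [integral_add h3 hi, ← h1, h2, he]
      ring
  filter_upwards [key] with x hx hxW
  have := hx hxW
  linarith

/-- The pointwise form of the `p`-Laplace equation. -/
theorem ae_trace_eq (p : ℝ) (hp2 : p ≤ 2) (U : Set (Euc n)) (hU : IsOpen U)
    (h : ℕ → ℝ) (hpos : ∀ k, 0 < h k) (h0 : Filter.Tendsto h Filter.atTop (𝓝 0))
    (G : Euc n → Euc n) (f : Euc n → ℝ) (hf : Continuous f) (hG : Continuous G)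
    (hGc : HasCompactSupport G) (H : Fin n → Euc n → Euc n) (hH : IsDQLimit U h G H)
    (heq : WeakDiv U (fun x => stress p (G x)) f)
    (hZ : p < 2 → ∀ i, ∀ᵐ x, x ∈ U → G x = 0 → H i x = 0) :
    ∀ᵐ x, x ∈ U → ∑ i, H i x i =
      (2 - p) * ∑ i, (‖G x‖⁻¹ • G x) i * ⟪‖G x‖⁻¹ • G x, H i x⟫_ℝ - f x * ‖G x‖ ^ (2 - p) := by
  rcases hp2.eq_or_lt with rfl | hp
  · have := ae_sum_fderiv_eq U U hU subset_rfl h hpos h0 G _ f hf hG hGc H hH heq id contDiff_id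
      (fun x _ => by simp [stress])
    filter_upwards [this] with x hx hxU
    have := hx hxU
    simpa using this
  · have hm : ∀ m : ℕ, ∀ᵐ x, x ∈ U → 2 * (1 / ((m : ℝ) + 1)) ^ 2 < ‖G x‖ ^ 2 →
        ∑ i, fderiv ℝ (cutField (1 / ((m : ℝ) + 1)) (p - 2)) (G x) (H i x) i = - f x := by
      intro m
      have hε : 0 < 1 / ((m : ℝ) + 1) := by positivity
      have := ae_sum_fderiv_eq U (U ∩ {x | 2 * (1 / ((m : ℝ) + 1)) ^ 2 < ‖G x‖ ^ 2})
        (hU.inter (isOpen_lt continuous_const (by fun_prop))) inter_subset_left h hpos h0 G _ f hf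
        hG hGc H hH heq _ (contDiff_cutField _ (p - 2) hε)
        (fun x hx => (cutField_eq_stress _ p hε _ hx.2.le).symm)
      filter_upwards [this] with x hx h1 h2 using hx ⟨h1, h2⟩
    filter_upwards [ae_all_iff.2 hm, ae_all_iff.2 (hZ hp)] with x hx hxZ hxU
    rcases eq_or_ne (G x) 0 with hG0 | hG0
    · simp [hxZ _ hxU hG0, hG0, Real.zero_rpow (by linarith : (2 : ℝ) - p ≠ 0)]
    · have hn : 0 < ‖G x‖ := norm_pos_iff.2 hG0
      obtain ⟨m, hm⟩ := exists_nat_one_div_lt (half_pos hn)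
      have hε : 0 < 1 / ((m : ℝ) + 1) := by positivity
      have hlt : 2 * (1 / ((m : ℝ) + 1)) ^ 2 < ‖G x‖ ^ 2 := by nlinarith
      have h1 := hx m hxU hlt
      have hd : HasDerivAt (cutPow (1 / ((m : ℝ) + 1)) (p - 2))
          ((p - 2) / 2 * (‖G x‖ ^ 2) ^ ((p - 2) / 2 - 1)) (‖G x‖ ^ 2) := by
        refine (Real.hasDerivAt_rpow_const (Or.inl (by positivity))).congr_of_eventuallyEq ?_
        filter_upwards [lt_mem_nhds hlt] with t ht using cutPow_eq _ _ _ hε ht.le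
      have e1 : (‖G x‖ ^ 2) ^ ((p - 2) / 2) = ‖G x‖ ^ (p - 2) := by
        rw [← Real.rpow_natCast, ← Real.rpow_mul hn.le]; congr 1; push_cast; ring
      have e2 : (‖G x‖ ^ 2) ^ ((p - 2) / 2 - 1) = ‖G x‖ ^ (p - 2) * (‖G x‖⁻¹) ^ 2 := by
        rw [Real.rpow_sub_one (by positivity), e1, inv_pow]; rfl
      simp only [fderiv_cutField _ _ hε, hd.deriv, cutPow_eq _ _ _ hε hlt.le, e1, e2,
        PiLp.add_apply, PiLp.smul_apply, smul_eq_mul, Finset.sum_add_distrib,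
        ← Finset.mul_sum] at h1
      have e3 : ‖G x‖ ^ (2 - p) * ‖G x‖ ^ (p - 2) = 1 := by
        rw [← Real.rpow_add hn]; simp
      simp only [PiLp.smul_apply, smul_eq_mul, real_inner_smul_left]
      have h2 : ‖G x‖ ^ (p - 2) * (∑ i, H i x i + (p - 2) *
          ∑ i, ‖G x‖⁻¹ * G x i * (‖G x‖⁻¹ * ⟪G x, H i x⟫_ℝ)) = - f x := by
        rw [← h1, mul_add, Finset.mul_sum, Finset.mul_sum (s := Finset.univ) (a := p - 2),
          Finset.mul_sum]
        congr 1
        refine Finset.sum_congr rfl fun i _ => ?_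
        ring
      have h3 : ∑ i, H i x i + (p - 2) *
          ∑ i, ‖G x‖⁻¹ * G x i * (‖G x‖⁻¹ * ⟪G x, H i x⟫_ℝ) = - f x * ‖G x‖ ^ (2 - p) := by
        rw [← h2]
        rw [mul_comm (_ * _), ← mul_assoc, e3, one_mul]
      linarith

theorem IsDQLimit.tendsto_integral_clm {E : Type*} [NormedAddCommGroup E] [NormedSpace ℝ E]
    {Ω : Set (Euc n)} {h : ℕ → ℝ} {g : Euc n → E} {H : Fin n → Euc n → E}
    (hg : IsDQLimit Ω h g H) (hcont : Continuous g) (B : Euc n → E →L[ℝ] ℝ) (hB : Continuous B)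
    (hc : HasCompactSupport B) (hs : tsupport B ⊆ Ω) (i : Fin n) :
    Filter.Tendsto (fun k => ∫ x, B x (diffQuot i (h k) g x)) Filter.atTop
      (𝓝 (∫ x, B x (H i x))) := by
  obtain ⟨A, hA⟩ := hc.exists_bound_of_continuous hB
  obtain ⟨Z, hZ, hZ0, hd⟩ := hg.2 _ hc.isCompact hs
  have hKm := (isClosed_tsupport B).measurableSet
  refine tendsto_integral_filter_of_dominated_convergence
    ((tsupport B).indicator fun x => A * (1 + Z x)) ?_ ?_ ?_ ?_
  · exact Filter.Eventually.of_forall fun k =>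
      (hB.clm_apply (diffQuot_continuous i (h k) g hcont)).aestronglyMeasurable
  · filter_upwards [hd i] with k hk
    filter_upwards [hk] with x hx
    by_cases hxs : x ∈ tsupport B
    · rw [Set.indicator_of_mem hxs]
      have := hx hxs
      refine (ContinuousLinearMap.le_opNorm _ _).trans ?_
      refine mul_le_mul (hA x) ?_ (norm_nonneg _) ((norm_nonneg _).trans (hA x))
      nlinarith [sq_nonneg (‖diffQuot i (h k) g x‖ - 1)]
    · rw [Set.indicator_of_notMem hxs, image_eq_zero_of_notMem_tsupport hxs]; simp
  · rw [integrable_indicator_iff hKm]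
    exact ((integrableOn_const hc.isCompact.measure_lt_top.ne).add hZ.integrableOn).const_mul _
  · filter_upwards [hg.1 i] with x hx
    by_cases hxs : x ∈ tsupport B
    · exact ((B x).continuous.tendsto _).comp (hx (hs hxs))
    · simp [image_eq_zero_of_notMem_tsupport hxs]

/-- The differentiated equation. -/
theorem integral_fderiv_linearized (W : Set (Euc n)) (hW : IsOpen W) (h : ℕ → ℝ)
    (hpos : ∀ k, 0 < h k) (h0 : Filter.Tendsto h Filter.atTop (𝓝 0)) (G V : Euc n → Euc n)
    (f : Euc n → ℝ) (hf : ContDiff ℝ 1 f) (hfc : HasCompactSupport f) (hG : Continuous G)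
    (hGc : HasCompactSupport G) (H : Fin n → Euc n → Euc n) (hH : IsDQLimit W h G H)
    (hVc : Continuous V) (heq : WeakDiv W V f)
    (Ψ : Euc n → Euc n) (hΨ : ContDiff ℝ 1 Ψ) (hV : ∀ x ∈ W, V x = Ψ (G x)) (ψ : Euc n → ℝ)
    (hψ : ContDiff ℝ 1 ψ) (hc : HasCompactSupport ψ) (hs : tsupport ψ ⊆ W) (i : Fin n) :
    ∫ x, fderiv ℝ ψ x (fderiv ℝ Ψ (G x) (H i x)) =
      ∫ x, fderiv ℝ f x (EuclideanSpace.single i 1) * ψ x := by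
  obtain ⟨M, hM⟩ := hGc.exists_bound_of_continuous hG
  have hD := hH.comp h0 hpos M hM Ψ hΨ
  have hΨG : Continuous fun x => Ψ (G x) := hΨ.continuous.comp hG
  have l1 := hD.tendsto_integral_clm hΨG (fderiv ℝ ψ) (hψ.continuous_fderiv one_ne_zero)
    (hc.fderiv ℝ) ((tsupport_fderiv_subset ℝ).trans hs) i
  have l2 := (isDQLimit_of_contDiff hpos h0 (Ω := Set.univ) f hf hfc).tendsto_integral_clm
    hf.continuous (fun x => ψ x • ContinuousLinearMap.id ℝ ℝ) (hψ.continuous.smul continuous_const)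
    (hc.mono fun x hx h0 => hx (by simp [h0])) (subset_univ _) i
  simp only [smul_apply, ContinuousLinearMap.id_apply, smul_eq_mul] at l2
  simp only [mul_comm (fderiv ℝ f _ _)]
  refine tendsto_nhds_unique (l1.congr' ?_) l2
  obtain ⟨r, hr, hrW⟩ := hc.isCompact.exists_cthickening_subset_open hW hs
  filter_upwards [h0.eventually (Metric.ball_mem_nhds 0 hr)] with k hk
  have hkr : |h k| < r := by simpa using hk
  have hin : ∀ x ∈ tsupport ψ, x + h k • EuclideanSpace.single i (1 : ℝ) ∈ W := fun x hx =>
    hrW (Metric.mem_cthickening_of_dist_le _ _ _ _ hx (by simpa [norm_smul] using hkr.le))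
  have key := weakDiv_translate W V f hVc hf.continuous heq
    (h k • EuclideanSpace.single i (1 : ℝ)) ψ hψ hc hs hin
  calc ∫ x, fderiv ℝ ψ x (diffQuot i (h k) (fun x => Ψ (G x)) x)
      = ∫ x, (h k)⁻¹ * fderiv ℝ ψ x (V (x + h k • EuclideanSpace.single i 1) - V x) := by
        refine integral_congr_ae (Filter.Eventually.of_forall fun x => ?_)
        by_cases hx : x ∈ tsupport ψ
        · simp only [diffQuot, hV x (hs hx), hV _ (hin x hx), map_smul, smul_eq_mul]
        · simp [fderiv_eq_zero_of_notMem ψ _ subset_rfl x hx]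
    _ = ∫ x, (h k)⁻¹ * ((f (x + h k • EuclideanSpace.single i 1) - f x) * ψ x) := by
        rw [integral_const_mul, key, integral_const_mul]
    _ = _ := by
        refine integral_congr_ae (Filter.Eventually.of_forall fun x => ?_)
        simp only [diffQuot, smul_eq_mul]; ring

/-- The linearized operator of `stress p` at `z` is elliptic. -/
theorem inner_linearized (p : ℝ) (z w : Euc n) (hz : z ≠ 0) (hp1 : 1 < p) :
    ⟪w, ‖z‖ ^ (p - 2) • (w + ((p - 2) * (‖z‖⁻¹ ^ 2) * ⟪z, w⟫_ℝ) • z)⟫_ℝ =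
      ‖z‖ ^ (p - 2) * ‖w - ((1 - √(p - 1)) * ‖z‖⁻¹ ^ 2 * ⟪z, w⟫_ℝ) • z‖ ^ 2 := by
  have hn : ‖z‖ ≠ 0 := norm_ne_zero_iff.2 hz
  have hs : √(p - 1) ^ 2 = p - 1 := Real.sq_sqrt (by linarith)
  rw [real_inner_smul_right, inner_add_right, real_inner_self_eq_norm_sq, real_inner_smul_right,
    norm_sub_sq_real, norm_smul, real_inner_smul_right, mul_pow, Real.norm_eq_abs, sq_abs,
    real_inner_comm w z]
  congr 1
  set s := √(p - 1)
  have hp : p = s ^ 2 + 1 := by linarith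
  rw [hp]
  field_simp
  ring

theorem norm_linearized_le (p : ℝ) (hp1 : 1 < p) (hp2 : p ≤ 2) (z w : Euc n) (hz : z ≠ 0) :
    ‖‖z‖ ^ (p - 2) • (w + ((p - 2) * (‖z‖⁻¹ ^ 2) * ⟪z, w⟫_ℝ) • z)‖ ≤ ‖z‖ ^ (p - 2) * ‖w‖ := by
  have hn : ‖z‖ ≠ 0 := norm_ne_zero_iff.2 hz
  rw [norm_smul, Real.norm_of_nonneg (by positivity)]
  gcongr
  apply le_of_sq_le_sq _ (norm_nonneg _)
  rw [norm_add_sq_real, norm_smul, real_inner_smul_right, mul_pow, Real.norm_eq_abs, sq_abs,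
    real_inner_comm w z]
  have : ‖w‖ ^ 2 + 2 * ((p - 2) * ‖z‖⁻¹ ^ 2 * ⟪w, z⟫_ℝ * ⟪w, z⟫_ℝ) +
      ((p - 2) * ‖z‖⁻¹ ^ 2 * ⟪w, z⟫_ℝ) ^ 2 * ‖z‖ ^ 2 =
      ‖w‖ ^ 2 - (2 - p) * p * (‖z‖⁻¹ ^ 2 * ⟪w, z⟫_ℝ ^ 2) := by
    field_simp; ring
  have h2 : 0 ≤ (2 - p) * p * (‖z‖⁻¹ ^ 2 * ⟪w, z⟫_ℝ ^ 2) :=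
    mul_nonneg (mul_nonneg (by linarith) (by linarith)) (by positivity)
  linarith

theorem inner_linearized_ge (p : ℝ) (hp2 : p ≤ 2) (z w : Euc n) (hz : z ≠ 0) :
    (p - 1) * (‖z‖ ^ (p - 2) * ‖w‖ ^ 2) ≤
      ⟪w, ‖z‖ ^ (p - 2) • (w + ((p - 2) * (‖z‖⁻¹ ^ 2) * ⟪z, w⟫_ℝ) • z)⟫_ℝ := by
  have hn : 0 < ‖z‖ := norm_pos_iff.2 hz
  rw [real_inner_smul_right, inner_add_right, real_inner_self_eq_norm_sq, real_inner_smul_right,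
    real_inner_comm w z]
  have h1 : ⟪w, z⟫_ℝ ^ 2 ≤ ‖w‖ ^ 2 * ‖z‖ ^ 2 := by
    rw [← mul_pow, sq_le_sq, abs_of_nonneg (by positivity : 0 ≤ ‖w‖ * ‖z‖)]
    exact abs_real_inner_le_norm w z
  have h2 : ‖z‖⁻¹ ^ 2 * ⟪w, z⟫_ℝ ^ 2 ≤ ‖w‖ ^ 2 := by
    rw [inv_pow, inv_mul_le_iff₀ (by positivity)]; linarith
  have h3 : 0 < ‖z‖ ^ (p - 2) := by positivity
  rw [mul_left_comm]
  gcongr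
  nlinarith

/-- The key algebraic inequality behind the weighted second order estimate. -/
theorem trace_form_ge (p γ ρ ρ1 : ℝ) (hp1 : 1 < p) (hp2 : p ≤ 2) (hγ0 : 0 ≤ γ) (hγ1 : γ < 1)
    (hρ : 0 ≤ ρ) (z : Euc n) (hz : z ≠ 0) (hρ1 : -γ * ρ ≤ ρ1 * ‖z‖ ^ 2)
    (A : Euc n →L[ℝ] Euc n)
    (hA : ∀ w, A w = ‖z‖ ^ (p - 2) • (w + ((p - 2) * (‖z‖⁻¹ ^ 2) * ⟪z, w⟫_ℝ) • z))
    (H : Fin n → Euc n) :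
    (1 - γ) * ((p - 1) * (ρ * (‖z‖ ^ (p - 2) * ∑ i, ‖H i‖ ^ 2))) ≤
      ∑ i, (ρ * ⟪H i, A (H i)⟫_ℝ + ρ1 * (∑ j, z j * ⟪H j, A (H i)⟫_ℝ) * z i) := by
  have hn : 0 < ‖z‖ := norm_pos_iff.2 hz
  set c := (1 - √(p - 1)) * ‖z‖⁻¹ ^ 2 with hc
  set B : Euc n →L[ℝ] Euc n := ContinuousLinearMap.id ℝ _ - c • (innerSL ℝ z).smulRight z with hB
  have hBw : ∀ w, B w = w - (c * ⟪z, w⟫_ℝ) • z := fun w => by simp [hB, mul_smul]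
  have hAB : ∀ w, ⟪w, A w⟫_ℝ = ‖z‖ ^ (p - 2) * ‖B w‖ ^ 2 := fun w => by
    rw [hA, inner_linearized p z w hz hp1, hBw]
  set v := ∑ i, z i • H i with hv
  have hsum : ∑ i, (∑ j, z j * ⟪H j, A (H i)⟫_ℝ) * z i = ⟪v, A v⟫_ℝ := by
    rw [hv, map_sum, inner_sum]
    refine Finset.sum_congr rfl fun i _ => ?_
    rw [sum_inner, Finset.sum_mul]
    refine Finset.sum_congr rfl fun j _ => ?_
    rw [map_smul, real_inner_smul_left, real_inner_smul_right]; ring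
  have hzn : ‖z‖ ^ 2 = ∑ i, z i ^ 2 := by
    rw [EuclideanSpace.norm_sq_eq]; simp
  have hCS : ‖B v‖ ^ 2 ≤ ‖z‖ ^ 2 * ∑ i, ‖B (H i)‖ ^ 2 := by
    have h1 : ‖B v‖ ≤ ∑ i, |z i| * ‖B (H i)‖ := by
      rw [hv, map_sum]
      refine (norm_sum_le _ _).trans (Finset.sum_le_sum fun i _ => ?_)
      rw [map_smul, norm_smul, Real.norm_eq_abs]
    calc ‖B v‖ ^ 2 ≤ (∑ i, |z i| * ‖B (H i)‖) ^ 2 := by gcongr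
      _ ≤ (∑ i, |z i| ^ 2) * ∑ i, ‖B (H i)‖ ^ 2 := Finset.sum_mul_sq_le_sq_mul_sq _ _ _
      _ = _ := by simp [hzn]
  have e : ∑ i, (ρ * ⟪H i, A (H i)⟫_ℝ + ρ1 * (∑ j, z j * ⟪H j, A (H i)⟫_ℝ) * z i) =
      ρ * (‖z‖ ^ (p - 2) * ∑ i, ‖B (H i)‖ ^ 2) + ρ1 * (‖z‖ ^ (p - 2) * ‖B v‖ ^ 2) := by
    simp only [mul_assoc ρ1]
    rw [Finset.sum_add_distrib, ← Finset.mul_sum, ← Finset.mul_sum, ← hAB, ← hsum]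
    congr 2
    rw [Finset.mul_sum]; exact Finset.sum_congr rfl fun i _ => by rw [hAB]
  have hlow : (p - 1) * (‖z‖ ^ (p - 2) * ∑ i, ‖H i‖ ^ 2) ≤
      ‖z‖ ^ (p - 2) * ∑ i, ‖B (H i)‖ ^ 2 := by
    rw [Finset.mul_sum, Finset.mul_sum, Finset.mul_sum]
    refine Finset.sum_le_sum fun i _ => ?_
    rw [← hAB, hA]
    exact inner_linearized_ge p hp2 z (H i) hz
  rw [e]
  set P := ‖z‖ ^ (p - 2)
  have hP : 0 < P := by positivity
  set S := ∑ i, ‖B (H i)‖ ^ 2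
  have hS : 0 ≤ S := Finset.sum_nonneg fun i _ => by positivity
  have h1 : -(γ * ρ * S) ≤ ρ1 * ‖B v‖ ^ 2 := by
    have h2 : 0 ≤ ‖B v‖ ^ 2 := by positivity
    rcases le_or_gt 0 ρ1 with h | h
    · have := mul_nonneg h h2
      have := mul_nonneg (mul_nonneg hγ0 hρ) hS
      linarith
    · have h3 : ρ1 * (‖z‖ ^ 2 * S) ≤ ρ1 * ‖B v‖ ^ 2 := mul_le_mul_of_nonpos_left hCS h.le
      have h4 := mul_le_mul_of_nonneg_right hρ1 hS
      linarith
  calc (1 - γ) * ((p - 1) * (ρ * (P * ∑ i, ‖H i‖ ^ 2)))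
      = (1 - γ) * ρ * ((p - 1) * (P * ∑ i, ‖H i‖ ^ 2)) := by ring
    _ ≤ (1 - γ) * ρ * (P * S) := by
        refine mul_le_mul_of_nonneg_left hlow (mul_nonneg (by linarith) hρ)
    _ = ρ * (P * S) + P * -(γ * ρ * S) := by ring
    _ ≤ ρ * (P * S) + P * (ρ1 * ‖B v‖ ^ 2) := by gcongr
    _ = _ := by ring

theorem fderiv_cutField_eq (ε p : ℝ) (hε : 0 < ε) (z w : Euc n) (hz : 2 * ε ^ 2 < ‖z‖ ^ 2) :
    fderiv ℝ (cutField ε (p - 2)) z w =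
      ‖z‖ ^ (p - 2) • (w + ((p - 2) * (‖z‖⁻¹ ^ 2) * ⟪z, w⟫_ℝ) • z) := by
  have hn : 0 < ‖z‖ := by
    rcases (norm_nonneg z).eq_or_lt with h | h
    · rw [← h] at hz; nlinarith [sq_nonneg ε]
    · exact h
  have hd : HasDerivAt (cutPow ε (p - 2))
      ((p - 2) / 2 * (‖z‖ ^ 2) ^ ((p - 2) / 2 - 1)) (‖z‖ ^ 2) := by
    refine (Real.hasDerivAt_rpow_const (Or.inl (by positivity))).congr_of_eventuallyEq ?_
    filter_upwards [lt_mem_nhds hz] with t ht using cutPow_eq _ _ _ hε ht.le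
  have e1 : (‖z‖ ^ 2) ^ ((p - 2) / 2) = ‖z‖ ^ (p - 2) := by
    rw [← Real.rpow_natCast, ← Real.rpow_mul hn.le]; congr 1; push_cast; ring
  have e2 : (‖z‖ ^ 2) ^ ((p - 2) / 2 - 1) = ‖z‖ ^ (p - 2) * (‖z‖⁻¹) ^ 2 := by
    rw [Real.rpow_sub_one (by positivity), e1, inv_pow]; rfl
  rw [fderiv_cutField _ _ hε, hd.deriv, cutPow_eq _ _ _ hε hz.le, e1, e2, smul_add, smul_smul]
  congr 2
  ring

/-- The vector of difference quotients of `u` with step `t`. -/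
def discreteGrad (t : ℝ) (u : Euc n → ℝ) (x : Euc n) : Euc n :=
  ∑ j, diffQuot j t u x • EuclideanSpace.single j 1

theorem contDiff_discreteGrad (t : ℝ) (u : Euc n → ℝ) (hu : ContDiff ℝ 1 u) :
    ContDiff ℝ 1 (discreteGrad t u) := by
  unfold discreteGrad diffQuot
  fun_prop

theorem fderiv_discreteGrad (t : ℝ) (u : Euc n → ℝ) (hu : ContDiff ℝ 1 u) (x w : Euc n) :
    fderiv ℝ (discreteGrad t u) x w =
      ∑ j, ⟪diffQuot j t (gradient u) x, w⟫_ℝ • EuclideanSpace.single j 1 := by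
  have hd := hu.differentiable one_ne_zero
  have h1 : ∀ j : Fin n, HasFDerivAt (diffQuot j t u)
      (t⁻¹ • (fderiv ℝ u (x + t • EuclideanSpace.single j 1) - fderiv ℝ u x)) x := fun j =>
    (((hasFDerivAt_comp_add_right _).2 (hd _).hasFDerivAt).sub (hd x).hasFDerivAt).const_smul t⁻¹
  have h2 := HasFDerivAt.fun_sum (u := Finset.univ) fun j (_ : j ∈ Finset.univ) =>
    (h1 j).smul_const (EuclideanSpace.single j (1 : ℝ) : Euc n)
  have h3 : HasFDerivAt (discreteGrad t u) _ x := h2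
  rw [h3.fderiv, sum_apply]
  refine Finset.sum_congr rfl fun j _ => ?_
  simp only [ContinuousLinearMap.smulRight_apply, smul_apply, sub_apply, diffQuot,
    real_inner_smul_left, inner_sub_left, inner_gradient_left, smul_eq_mul]

theorem discreteGrad_near (h : ℕ → ℝ) (h0 : Filter.Tendsto h Filter.atTop (𝓝 0))
    (hpos : ∀ k, 0 < h k) (u : Euc n → ℝ) (hu : ContDiff ℝ 1 u) (huc : HasCompactSupport u)
    (δ : ℝ) (hδ : 0 < δ) :
    ∀ᶠ k in Filter.atTop, ∀ x, ‖discreteGrad (h k) u x - gradient u x‖ ≤ δ := by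
  have huni : UniformContinuous (fderiv ℝ u) :=
    (huc.fderiv ℝ).uniformContinuous_of_continuous (hu.continuous_fderiv one_ne_zero)
  set c := δ / (n + 1) with hcdef
  have hc : 0 < c := by positivity
  obtain ⟨r, hr, hur⟩ := Metric.uniformContinuous_iff.1 huni c hc
  filter_upwards [h0.eventually (Metric.ball_mem_nhds 0 hr)] with k hk x
  have hkr : |h k| < r := by simpa using hk
  have hG : gradient u x = ∑ j, fderiv ℝ u x (EuclideanSpace.single j 1) •
      (EuclideanSpace.single j 1 : Euc n) := by
    conv_lhs => rw [← (EuclideanSpace.basisFun (Fin n) ℝ).sum_repr (gradient u x)]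
    refine Finset.sum_congr rfl fun j _ => ?_
    rw [← inner_gradient_left, EuclideanSpace.inner_single_right]
    simp
  rw [discreteGrad, hG, ← Finset.sum_sub_distrib]
  have hj : ∀ j : Fin n, ‖diffQuot j (h k) u x • (EuclideanSpace.single j (1 : ℝ) : Euc n) -
      fderiv ℝ u x (EuclideanSpace.single j 1) • (EuclideanSpace.single j 1 : Euc n)‖ ≤ c := by
    intro j
    set e : Euc n := EuclideanSpace.single j 1 with he
    have hen : ‖e‖ = 1 := by simp [he]
    rw [← sub_smul, norm_smul, hen, mul_one]
    have hmv := (convex_ball x r).norm_image_sub_le_of_norm_fderiv_le' (𝕜 := ℝ) (f := u)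
      (φ := fderiv ℝ u x) (C := c) (x := x) (y := x + h k • e)
      (fun y _ => hu.differentiable one_ne_zero y)
      (fun y hy => by rw [← dist_eq_norm]; exact (hur (Metric.mem_ball.1 hy)).le)
      (Metric.mem_ball_self hr) (by simpa [norm_smul, hen] using hkr)
    have hk0 := hpos k
    have e1 : diffQuot j (h k) u x - fderiv ℝ u x e =
        (h k)⁻¹ * (u (x + h k • e) - u x - fderiv ℝ u x (x + h k • e - x)) := by
      simp only [diffQuot, add_sub_cancel_left, map_smul, smul_eq_mul, ← he]
      field_simp
    rw [e1, norm_mul, norm_inv, Real.norm_of_nonneg hk0.le, inv_mul_le_iff₀ hk0]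
    simpa [norm_smul, hen, abs_of_pos hk0, mul_comm] using hmv
  calc _ ≤ ∑ _j : Fin n, c := (norm_sum_le _ _).trans (Finset.sum_le_sum fun j _ => hj j)
    _ = n * c := by simp
    _ ≤ δ := by
      rw [hcdef, mul_div_assoc', div_le_iff₀ (by positivity)]; nlinarith

set_option maxHeartbeats 1000000 in
/-- The differentiated equation tested with a function of the gradient. -/
theorem integral_linearized_comp (p : ℝ) (hp1 : 1 < p) (U : Set (Euc n)) (hU : IsOpen U)
    (h : ℕ → ℝ) (hpos : ∀ k, 0 < h k) (h0 : Filter.Tendsto h Filter.atTop (𝓝 0))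
    (u f : Euc n → ℝ) (hu : ContDiff ℝ 1 u) (huc : HasCompactSupport u) (hf : ContDiff ℝ 1 f)
    (hfc : HasCompactSupport f) (H : Fin n → Euc n → Euc n) (hHm : ∀ i, StronglyMeasurable (H i))
    (hH : IsDQLimit U h (gradient u) H) (heq : WeakDiv U (fun x => stress p (gradient u x)) f)
    (ε : ℝ) (hε : 0 < ε) (R : Euc n → ℝ) (hR : ContDiff ℝ 1 R) (hR0 : ∀ z, ‖z‖ < ε → R z = 0)
    (χ : Euc n → ℝ) (hχ : ContDiff ℝ 1 χ) (hχc : HasCompactSupport χ) (hχs : tsupport χ ⊆ U)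
    (i : Fin n) :
    Integrable (fun x => R (gradient u x) * fderiv ℝ χ x
          (fderiv ℝ (cutField (ε / 4) (p - 2)) (gradient u x) (H i x)) +
        χ x * fderiv ℝ R (gradient u x) (∑ j, ⟪H j x,
          fderiv ℝ (cutField (ε / 4) (p - 2)) (gradient u x) (H i x)⟫_ℝ •
            EuclideanSpace.single j 1)) volume ∧
    ∫ x, (R (gradient u x) * fderiv ℝ χ x
          (fderiv ℝ (cutField (ε / 4) (p - 2)) (gradient u x) (H i x)) +
        χ x * fderiv ℝ R (gradient u x) (∑ j, ⟪H j x,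
          fderiv ℝ (cutField (ε / 4) (p - 2)) (gradient u x) (H i x)⟫_ℝ •
            EuclideanSpace.single j 1)) =
      ∫ x, fderiv ℝ f x (EuclideanSpace.single i 1) * (χ x * R (gradient u x)) := by
  set G := gradient u with hGdef
  have hG : Continuous G := continuous_gradient u hu
  have hGc : HasCompactSupport G := hasCompactSupport_gradient u huc
  obtain ⟨M, hM⟩ := hGc.exists_bound_of_continuous hG
  have hΨ : ContDiff ℝ 1 (cutField (n := n) (ε / 4) (p - 2)) :=
    contDiff_cutField _ _ (by positivity)
  set A : Euc n → Euc n →L[ℝ] Euc n := fun x => fderiv ℝ (cutField (ε / 4) (p - 2)) (G x) with hA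
  have hAc : Continuous A := (hΨ.continuous_fderiv one_ne_zero).comp hG
  set D : ℕ → Euc n → Euc n := fun k => discreteGrad (h k) u with hD
  have hD1 : ∀ k, ContDiff ℝ 1 (D k) := fun k => contDiff_discreteGrad _ _ hu
  set K := tsupport χ with hK
  have hKc : IsCompact K := hχc.isCompact
  have hKm : MeasurableSet K := hKc.measurableSet
  obtain ⟨Z, hZ, hZ0, hd⟩ := hH.2 K hKc hχs
  -- bounds
  have hball : IsCompact (Metric.closedBall (0 : Euc n) (M + 1)) := isCompact_closedBall _ _
  obtain ⟨CR, hCR⟩ := hball.exists_bound_of_continuousOn hR.continuous.continuousOn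
  obtain ⟨CR', hCR'⟩ := hball.exists_bound_of_continuousOn
    (hR.continuous_fderiv one_ne_zero).continuousOn
  obtain ⟨CA, hCA⟩ := hKc.exists_bound_of_continuousOn hAc.continuousOn
  obtain ⟨Cχ, hCχ⟩ := hχc.exists_bound_of_continuous hχ.continuous
  obtain ⟨Cχ', hCχ'⟩ := exists_bound_fderiv χ hχ hχc
  obtain ⟨Cf, hCf⟩ := exists_bound_fderiv f hf hfc
  have hM0 : 0 ≤ M := (norm_nonneg _).trans (hM 0)
  have hDM : ∀ᶠ k in Filter.atTop, ∀ x, ‖D k x‖ ≤ M + 1 := by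
    filter_upwards [discreteGrad_near h h0 hpos u hu huc 1 one_pos] with k hk x
    have h1 := norm_add_le (D k x - G x) (G x)
    rw [sub_add_cancel] at h1
    linarith [hk x, hM x]
  have hDlim : ∀ x, Filter.Tendsto (fun k => D k x) Filter.atTop (𝓝 (G x)) := by
    intro x
    rw [Metric.tendsto_nhds]
    intro δ hδ
    filter_upwards [discreteGrad_near h h0 hpos u hu huc (δ / 2) (by positivity)] with k hk
    rw [dist_eq_norm]
    exact (hk x).trans_lt (by linarith)
  set I : (Euc n → Euc n) → (Fin n → Euc n → Euc n) → Euc n → ℝ := fun d Y x =>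
    R (d x) * fderiv ℝ χ x (A x (H i x)) + χ x * fderiv ℝ R (d x)
      (∑ j, ⟪Y j x, A x (H i x)⟫_ℝ • EuclideanSpace.single j 1) with hI
  set Y : ℕ → Fin n → Euc n → Euc n := fun k j => diffQuot j (h k) G with hY
  have hAHm : StronglyMeasurable fun x => A x (H i x) :=
    isBoundedBilinearMap_apply.continuous.comp_stronglyMeasurable
      (hAc.stronglyMeasurable.prodMk (hHm i))
  have hIm : ∀ k, AEStronglyMeasurable (I (D k) (Y k)) volume := by
    intro k
    have m1 : StronglyMeasurable fun x => fderiv ℝ χ x (A x (H i x)) :=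
      isBoundedBilinearMap_apply.continuous.comp_stronglyMeasurable
        ((hχ.continuous_fderiv one_ne_zero).stronglyMeasurable.prodMk hAHm)
    have m2 : StronglyMeasurable fun x =>
        ∑ j, ⟪Y k j x, A x (H i x)⟫_ℝ • (EuclideanSpace.single j 1 : Euc n) := by
      refine Finset.stronglyMeasurable_fun_sum _ fun j _ => ?_
      exact ((diffQuot_continuous j _ G hG).stronglyMeasurable.inner hAHm).smul_const _
    have m3 : StronglyMeasurable fun x => fderiv ℝ R (D k x)
        (∑ j, ⟪Y k j x, A x (H i x)⟫_ℝ • (EuclideanSpace.single j 1 : Euc n)) :=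
      isBoundedBilinearMap_apply.continuous.comp_stronglyMeasurable
        (((hR.continuous_fderiv one_ne_zero).comp (hD1 k).continuous).stronglyMeasurable.prodMk m2)
    exact (((hR.continuous.comp (hD1 k).continuous).stronglyMeasurable.mul m1).add
      (hχ.continuous.stronglyMeasurable.mul m3)).aestronglyMeasurable
  have hIlim : Integrable (I G H) volume ∧ Filter.Tendsto (fun k => ∫ x, I (D k) (Y k) x) Filter.atTop
      (𝓝 (∫ x, I G H x)) := by
    have hHi : IntegrableOn (fun x => ‖H i x‖ ^ 2) K volume :=
      (memLp_two_iff_integrable_sq_norm (hHm i).aestronglyMeasurable).1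
        (hH.memLp hG K hKc hχs i)
    suffices hs : (∀ᶠ k in Filter.atTop, ∀ᵐ x, ‖I (D k) (Y k) x‖ ≤
        (K.indicator fun x => CR * (Cχ' * (CA * (1 + ‖H i x‖ ^ 2))) +
          Cχ * (CR' * ∑ _j : Fin n, CA * (Z x + ‖H i x‖ ^ 2))) x) ∧
        Integrable (K.indicator fun x => CR * (Cχ' * (CA * (1 + ‖H i x‖ ^ 2))) +
          Cχ * (CR' * ∑ _j : Fin n, CA * (Z x + ‖H i x‖ ^ 2))) volume ∧
        ∀ᵐ x, Filter.Tendsto (fun k => I (D k) (Y k) x) Filter.atTop (𝓝 (I G H x)) by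
      obtain ⟨s1, s2, s3⟩ := hs
      obtain ⟨N, hN⟩ := Filter.eventually_atTop.1 s1
      have t3 : ∀ᵐ x, Filter.Tendsto (fun k => I (D (k + N)) (Y (k + N)) x) Filter.atTop
          (𝓝 (I G H x)) := s3.mono fun x hx => (Filter.tendsto_add_atTop_iff_nat N).2 hx
      exact ⟨⟨aestronglyMeasurable_of_tendsto_ae _ (fun k => hIm k) s3,
        hasFiniteIntegral_of_dominated_convergence s2.hasFiniteIntegral
          (fun k => hN (k + N) (Nat.le_add_left N k)) t3⟩,
        tendsto_integral_filter_of_dominated_convergence _ (Filter.Eventually.of_forall hIm)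
          s1 s2 s3⟩
    refine ⟨?_, ?_, ?_⟩
    · filter_upwards [hDM, Filter.eventually_all.2 hd] with k hk hdk
      filter_upwards [ae_all_iff.2 hdk] with x hx
      by_cases hxK : x ∈ K
      · rw [Set.indicator_of_mem hxK]
        have hDx : D k x ∈ Metric.closedBall (0 : Euc n) (M + 1) := by simpa using hk x
        have b1 := hCR _ hDx
        have b2 := hCR' _ hDx
        have b3 := hCA x hxK
        have b4 := hCχ x
        have b5 := hCχ' x
        have p1 := (norm_nonneg _).trans b1
        have p2 := (norm_nonneg _).trans b2
        have p3 := (norm_nonneg _).trans b3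
        have p4 := (norm_nonneg _).trans b4
        have p5 := (norm_nonneg _).trans b5
        have c1 : ‖A x (H i x)‖ ≤ CA * ‖H i x‖ := (A x).le_of_opNorm_le b3 _
        have c2 : ‖A x (H i x)‖ ≤ CA * (1 + ‖H i x‖ ^ 2) :=
          c1.trans (mul_le_mul_of_nonneg_left (by nlinarith [sq_nonneg (‖H i x‖ - 1)]) p3)
        refine (norm_add_le _ _).trans (add_le_add ?_ ?_)
        · rw [norm_mul]
          refine mul_le_mul b1 ?_ (norm_nonneg _) p1
          exact ((fderiv ℝ χ x).le_of_opNorm_le b5 _).trans (mul_le_mul_of_nonneg_left c2 p5)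
        · rw [norm_mul]
          refine mul_le_mul b4 ?_ (norm_nonneg _) p4
          refine ((fderiv ℝ R (D k x)).le_of_opNorm_le b2 _).trans
            (mul_le_mul_of_nonneg_left ?_ p2)
          refine (norm_sum_le _ _).trans (Finset.sum_le_sum fun j _ => ?_)
          rw [norm_smul, PiLp.norm_single, norm_one, mul_one]
          refine (norm_inner_le_norm _ _).trans ?_
          have hYx : ‖Y k j x‖ ^ 2 ≤ Z x := hx j hxK
          calc ‖Y k j x‖ * ‖A x (H i x)‖ ≤ ‖Y k j x‖ * (CA * ‖H i x‖) :=
                mul_le_mul_of_nonneg_left c1 (norm_nonneg _)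
            _ = CA * (‖Y k j x‖ * ‖H i x‖) := by ring
            _ ≤ _ := by
              refine mul_le_mul_of_nonneg_left ?_ p3
              nlinarith [sq_nonneg (‖Y k j x‖ - ‖H i x‖), sq_nonneg ‖Y k j x‖, sq_nonneg ‖H i x‖]
      · rw [Set.indicator_of_notMem hxK]
        simp [hI, fderiv_eq_zero_of_notMem χ K subset_rfl x hxK,
          image_eq_zero_of_notMem_tsupport hxK]
    · rw [integrable_indicator_iff hKm]
      have i1 : IntegrableOn (fun _ : Euc n => (1 : ℝ)) K volume :=
        integrableOn_const hKc.measure_lt_top.ne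
      refine Integrable.add ((((i1.add hHi).const_mul _).const_mul _).const_mul _) ?_
      refine Integrable.const_mul (Integrable.const_mul ?_ _) _
      exact integrable_finsetSum _ fun j _ => (hZ.integrableOn.add hHi).const_mul _
    · filter_upwards [ae_all_iff.2 hH.1] with x hx
      by_cases hxK : x ∈ K
      · have l1 := hDlim x
        have l2 : ∀ j, Filter.Tendsto (fun k => Y k j x) Filter.atTop (𝓝 (H j x)) :=
          fun j => hx j (hχs hxK)
        have l3 : Filter.Tendsto (fun k => ∑ j, ⟪Y k j x, A x (H i x)⟫_ℝ •
            (EuclideanSpace.single j 1 : Euc n)) Filter.atTop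
            (𝓝 (∑ j, ⟪H j x, A x (H i x)⟫_ℝ • EuclideanSpace.single j 1)) :=
          tendsto_finsetSum _ fun j _ =>
            (Filter.Tendsto.inner (𝕜 := ℝ) (l2 j) tendsto_const_nhds).smul_const _
        refine Filter.Tendsto.add ?_ (Filter.Tendsto.const_mul _ ?_)
        · exact ((hR.continuous.tendsto _).comp l1).mul_const _
        · refine ((isBoundedBilinearMap_apply (𝕜 := ℝ) (E := Euc n) (F := ℝ)).continuous.tendsto
            (fderiv ℝ R (G x), _)).comp (Filter.Tendsto.prodMk_nhds
              (((hR.continuous_fderiv one_ne_zero).tendsto _).comp l1) l3)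
      · simp [hI, fderiv_eq_zero_of_notMem χ K subset_rfl x hxK,
          image_eq_zero_of_notMem_tsupport hxK]
  have hrlim : Filter.Tendsto (fun k => ∫ x, fderiv ℝ f x (EuclideanSpace.single i 1) *
      (χ x * R (D k x))) Filter.atTop
      (𝓝 (∫ x, fderiv ℝ f x (EuclideanSpace.single i 1) * (χ x * R (G x)))) := by
    refine tendsto_integral_filter_of_dominated_convergence
      (K.indicator fun x => Cf * (Cχ * CR)) ?_ ?_ ?_ ?_
    · refine Filter.Eventually.of_forall fun k => Continuous.aestronglyMeasurable ?_
      exact ((hf.continuous_fderiv one_ne_zero).clm_apply continuous_const).mul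
        (hχ.continuous.mul (hR.continuous.comp (hD1 k).continuous))
    · filter_upwards [hDM] with k hk
      refine Filter.Eventually.of_forall fun x => ?_
      by_cases hxK : x ∈ K
      · rw [Set.indicator_of_mem hxK, norm_mul, norm_mul]
        have b1 := hCR _ (by simpa using hk x : D k x ∈ Metric.closedBall (0 : Euc n) (M + 1))
        have b2 : ‖fderiv ℝ f x (EuclideanSpace.single i 1)‖ ≤ Cf := by
          simpa using (fderiv ℝ f x).le_of_opNorm_le (hCf x) (EuclideanSpace.single i 1)
        refine mul_le_mul b2 (mul_le_mul (hCχ x) b1 (norm_nonneg _) ((norm_nonneg _).trans (hCχ x)))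
          (by positivity) ((norm_nonneg _).trans b2)
      · rw [Set.indicator_of_notMem hxK, image_eq_zero_of_notMem_tsupport hxK]; simp
    · rw [integrable_indicator_iff hKm]; exact integrableOn_const hKc.measure_lt_top.ne
    · exact Filter.Eventually.of_forall fun x =>
        (((hR.continuous.tendsto _).comp (hDlim x)).const_mul _).const_mul _
  refine ⟨hIlim.1, tendsto_nhds_unique (hIlim.2.congr' ?_) hrlim⟩
  filter_upwards [discreteGrad_near h h0 hpos u hu huc (ε / 4) (by positivity)] with k hk
  set W : Set (Euc n) := U ∩ {x | 2 * (ε / 4) ^ 2 < ‖G x‖ ^ 2} with hW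
  have hWo : IsOpen W := hU.inter (isOpen_lt continuous_const (hG.norm.pow 2))
  have hRD : ContDiff ℝ 1 fun x => R (D k x) := hR.comp (hD1 k)
  have hψ1 : ContDiff ℝ 1 fun x => χ x * R (D k x) := hχ.mul hRD
  have hψs : tsupport (fun x => χ x * R (D k x)) ⊆ W := by
    have h1 : tsupport (fun x => χ x * R (D k x)) ⊆ K ∩ {x | ε ≤ ‖D k x‖} := by
      refine closure_minimal (fun x hx => ?_)
        ((isClosed_tsupport χ).inter (isClosed_le continuous_const (hD1 k).continuous.norm))
      rw [Function.mem_support, mul_ne_zero_iff] at hx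
      refine ⟨subset_tsupport _ hx.1, ?_⟩
      by_contra hlt
      exact hx.2 (hR0 _ (not_le.1 hlt))
    intro x hx
    obtain ⟨hx1, hx2⟩ := h1 hx
    refine ⟨hχs hx1, ?_⟩
    have h2 := norm_sub_norm_le (D k x) (G x)
    have h3 := hk x
    have h4 : 3 * (ε / 4) ≤ ‖G x‖ := by
      have : ε ≤ ‖D k x‖ := hx2
      have h3' : ‖D k x - G x‖ ≤ ε / 4 := h3
      linarith
    change 2 * (ε / 4) ^ 2 < ‖G x‖ ^ 2
    nlinarith
  have key := integral_fderiv_linearized W hWo h hpos h0 G (fun x => stress p (G x)) f hf hfc hG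
    hGc H (hH.mono inter_subset_left) ((continuous_stress p hp1).comp hG)
    (fun ψ h1 h2 h3 => heq ψ h1 h2 (h3.trans inter_subset_left)) (cutField (ε / 4) (p - 2)) hΨ
    (fun x hx => (cutField_eq_stress _ _ (by positivity) _ (le_of_lt hx.2)).symm)
    _ hψ1 hχc.mul_right hψs i
  rw [← key]
  refine integral_congr_ae (Filter.Eventually.of_forall fun x => ?_)
  have hdR := ((hR.differentiable one_ne_zero (D k x)).hasFDerivAt.comp x
    ((hD1 k).differentiable one_ne_zero x).hasFDerivAt)
  have hdψ := (hχ.differentiable one_ne_zero x).hasFDerivAt.mul hdR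
  have e1 : fderiv ℝ (fun x => χ x * R (D k x)) x = _ := hdψ.fderiv
  simp only [e1, hI]
  simp only [Function.comp_def, add_apply, smul_apply, ContinuousLinearMap.comp_apply, smul_eq_mul]
  rw [fderiv_discreteGrad _ _ hu, add_comm]

theorem deriv_cutPow_eq_zero (ε s t : ℝ) (hε : 0 < ε) (ht : t ≤ ε ^ 2) :
    deriv (cutPow ε s) t = 0 := by
  refine IsLocalMin.deriv_eq_zero (Filter.Eventually.of_forall fun y => ?_)
  rw [cutPow_eq_zero ε s t hε ht]
  exact cutPow_nonneg ε s y hε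

theorem fderiv_cutField_coord (ε s : ℝ) (hε : 0 < ε) (z v : Euc n) (i : Fin n) :
    fderiv ℝ (fun z : Euc n => cutField ε s z i) z v =
      cutPow ε s (‖z‖ ^ 2) * v i + (2 * deriv (cutPow ε s) (‖z‖ ^ 2) * ⟪z, v⟫_ℝ) * z i := by
  have h1 := ((contDiff_cutField (n := n) ε s hε).differentiable one_ne_zero z).hasFDerivAt
  have h2 := (EuclideanSpace.proj (𝕜 := ℝ) i).hasFDerivAt.comp z h1
  have h3 : HasFDerivAt (fun z : Euc n => cutField ε s z i) _ z := h2
  rw [h3.fderiv, ContinuousLinearMap.comp_apply, fderiv_cutField _ _ hε]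
  simp

theorem two_young (c a b : ℝ) (hc : 0 < c) : 2 * a * b ≤ c / 2 * a ^ 2 + 2 / c * b ^ 2 := by
  have h : c / 2 * a ^ 2 + 2 / c * b ^ 2 - 2 * a * b = c / 2 * (a - 2 / c * b) ^ 2 := by
    field_simp; ring
  have : 0 ≤ c / 2 * (a - 2 / c * b) ^ 2 := by positivity
  linarith

theorem form_lower_bound (p γ ε : ℝ) (hp1 : 1 < p) (hp2 : p ≤ 2) (hγ0 : 0 ≤ γ) (hγ1 : γ < 1)
    (hε : 0 < ε) (z : Euc n) (H : Fin n → Euc n) (η : ℝ) (L : Euc n →L[ℝ] ℝ) :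
    (1 - γ) * (p - 1) / 2 *
        (η ^ 2 * (cutPow ε (-γ) (‖z‖ ^ 2) * (‖z‖ ^ (p - 2) * ∑ i, ‖H i‖ ^ 2))) -
      n * (2 / ((1 - γ) * (p - 1)) * (‖L‖ ^ 2 * (cutPow ε (-γ) (‖z‖ ^ 2) * ‖z‖ ^ p))) ≤
    ∑ i, (cutField ε (-γ) z i * (2 * η * L (fderiv ℝ (cutField (ε / 4) (p - 2)) z (H i))) +
      η ^ 2 * fderiv ℝ (fun z : Euc n => cutField ε (-γ) z i) z (∑ j, ⟪H j,
        fderiv ℝ (cutField (ε / 4) (p - 2)) z (H i)⟫_ℝ • EuclideanSpace.single j 1)) := by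
  set A : Euc n →L[ℝ] Euc n := fderiv ℝ (cutField (ε / 4) (p - 2)) z with hA
  set ρ := cutPow ε (-γ) (‖z‖ ^ 2) with hρ
  set c := (1 - γ) * (p - 1) with hc
  have hc0 : 0 < c := mul_pos (by linarith) (by linarith)
  have hcf : cutField ε (-γ) z = ρ • z := rfl
  simp only [fderiv_cutField_coord ε (-γ) hε, hcf, ← hρ]
  rcases le_or_gt (‖z‖ ^ 2) (ε ^ 2) with h | h
  · rw [deriv_cutPow_eq_zero ε _ _ hε h, hρ, cutPow_eq_zero ε _ _ hε h]
    simp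
  have hz : 0 < ‖z‖ := by
    rcases (norm_nonneg z).eq_or_lt with h' | h'
    · rw [← h'] at h; nlinarith [sq_nonneg ε]
    · exact h'
  have hAf : ∀ w, A w = ‖z‖ ^ (p - 2) • (w + ((p - 2) * (‖z‖⁻¹ ^ 2) * ⟪z, w⟫_ℝ) • z) := fun w =>
    fderiv_cutField_eq _ _ (by positivity) z w (by nlinarith)
  have hρ0 : 0 ≤ ρ := cutPow_nonneg _ _ _ hε
  have h1 := trace_form_ge p γ ρ (2 * deriv (cutPow ε (-γ)) (‖z‖ ^ 2)) hp1 hp2 hγ0 hγ1 hρ0 z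
    (norm_pos_iff.1 hz) (mul_cutPow_le ε (-γ) _ hε (by positivity)) A hAf H
  have hv : ∀ i k : Fin n, (∑ j, ⟪H j, A (H i)⟫_ℝ • (EuclideanSpace.single j 1 : Euc n)) k =
      ⟪H k, A (H i)⟫_ℝ := by
    intro i k
    simp [Pi.single_apply]
  have hin : ∀ i, ⟪z, ∑ j, ⟪H j, A (H i)⟫_ℝ • (EuclideanSpace.single j 1 : Euc n)⟫_ℝ =
      ∑ j, z j * ⟪H j, A (H i)⟫_ℝ := by
    intro i
    rw [inner_sum]
    refine Finset.sum_congr rfl fun j _ => ?_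
    rw [real_inner_smul_right, EuclideanSpace.inner_single_right]
    simp [mul_comm]
  simp only [hv, hin]
  set P := ‖z‖ ^ (p - 2) with hP
  have hP0 : 0 < P := by positivity
  have hPp : P * ‖z‖ ^ 2 = ‖z‖ ^ p := by
    rw [hP, ← Real.rpow_natCast, ← Real.rpow_add hz]; congr 1; push_cast; ring
  have hcross : ∀ i, -(ρ * P * (c / 2 * (η ^ 2 * ‖H i‖ ^ 2) + 2 / c * (‖L‖ ^ 2 * ‖z‖ ^ 2))) ≤
      (ρ • z) i * (2 * η * L (A (H i))) := by
    intro i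
    rw [neg_le]
    have b1 : |z i| ≤ ‖z‖ := PiLp.norm_apply_le z i
    have b2 : |L (A (H i))| ≤ ‖L‖ * (P * ‖H i‖) := by
      refine (L.le_opNorm _).trans (mul_le_mul_of_nonneg_left ?_ (norm_nonneg _))
      rw [hAf]; exact norm_linearized_le p hp1 hp2 z (H i) (norm_pos_iff.1 hz)
    have b3 : |z i| * |L (A (H i))| ≤ ‖z‖ * (‖L‖ * (P * ‖H i‖)) :=
      mul_le_mul b1 b2 (abs_nonneg _) (norm_nonneg _)
    have b4 := two_young c (|η| * ‖H i‖) (‖L‖ * ‖z‖) hc0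
    rw [mul_pow, mul_pow, sq_abs] at b4
    calc -((ρ • z) i * (2 * η * L (A (H i)))) ≤ |(ρ • z) i * (2 * η * L (A (H i)))| := neg_le_abs _
      _ = ρ * (2 * |η|) * (|z i| * |L (A (H i))|) := by
        rw [PiLp.smul_apply, smul_eq_mul, abs_mul, abs_mul, abs_mul, abs_mul, abs_of_nonneg hρ0,
          abs_of_pos (two_pos : (0:ℝ) < 2)]
        ring
      _ ≤ ρ * (2 * |η|) * (‖z‖ * (‖L‖ * (P * ‖H i‖))) :=
        mul_le_mul_of_nonneg_left b3 (by positivity)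
      _ = ρ * P * (2 * (|η| * ‖H i‖) * (‖L‖ * ‖z‖)) := by ring
      _ ≤ _ := mul_le_mul_of_nonneg_left b4 (by positivity)
  rw [Finset.sum_add_distrib, ← Finset.mul_sum]
  have h2 := Finset.sum_le_sum fun i (_ : i ∈ Finset.univ) => hcross i
  have h3 : ∑ i, -(ρ * P * (c / 2 * (η ^ 2 * ‖H i‖ ^ 2) + 2 / c * (‖L‖ ^ 2 * ‖z‖ ^ 2))) =
      -(c / 2 * (η ^ 2 * (ρ * (P * ∑ i, ‖H i‖ ^ 2)))) -
        n * (2 / c * (‖L‖ ^ 2 * (ρ * ‖z‖ ^ p))) := by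
    rw [Finset.sum_neg_distrib, ← Finset.mul_sum, Finset.sum_add_distrib, ← Finset.mul_sum,
      ← Finset.mul_sum, ← hPp]
    simp
    ring
  have h4 := mul_le_mul_of_nonneg_left h1 (sq_nonneg η)
  rw [h3] at h2
  have h5 : η ^ 2 * ((1 - γ) * ((p - 1) * (ρ * (P * ∑ i, ‖H i‖ ^ 2)))) =
      c * (η ^ 2 * (ρ * (P * ∑ i, ‖H i‖ ^ 2))) := by rw [hc]; ring
  rw [h5] at h4
  linarith

set_option maxHeartbeats 1000000 in
/-- The weighted second order estimate. -/
theorem weighted_estimate (p γ : ℝ) (hp1 : 1 < p) (hp2 : p ≤ 2) (hγ0 : 0 ≤ γ) (hγ1 : γ < 1)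
    (U : Set (Euc n)) (hU : IsOpen U)
    (h : ℕ → ℝ) (hpos : ∀ k, 0 < h k) (h0 : Filter.Tendsto h Filter.atTop (𝓝 0))
    (u f : Euc n → ℝ) (hu : ContDiff ℝ 1 u) (huc : HasCompactSupport u) (hf : ContDiff ℝ 1 f)
    (hfc : HasCompactSupport f) (H : Fin n → Euc n → Euc n) (hHm : ∀ i, StronglyMeasurable (H i))
    (hH : IsDQLimit U h (gradient u) H) (heq : WeakDiv U (fun x => stress p (gradient u x)) f)
    (hH0 : ∀ i, ∀ᵐ x, x ∈ U → gradient u x = 0 → H i x = 0)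
    (K : Set (Euc n)) (hK : IsCompact K) (hKU : K ⊆ U) :
    IntegrableOn (fun x => ‖gradient u x‖ ^ (-γ) *
      (‖gradient u x‖ ^ (p - 2) * ∑ i, ‖H i x‖ ^ 2)) K volume := by
  obtain ⟨η, U', hη, hηc, hηs, hη0, hη1, -, hKU', -, hηU'⟩ := exists_cutoff K U hK hU hKU
  set G := gradient u with hGdef
  have hG : Continuous G := continuous_gradient u hu
  obtain ⟨M, hM⟩ := (hasCompactSupport_gradient u huc).exists_bound_of_continuous hG
  obtain ⟨Cf, hCf⟩ := exists_bound_fderiv f hf hfc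
  have hη1' : ContDiff ℝ 1 η := hη.of_le (by exact_mod_cast le_top)
  have hχ : ContDiff ℝ 1 fun x => η x ^ 2 := hη1'.pow 2
  have hsub : tsupport (fun x => η x ^ 2) ⊆ tsupport η :=
    closure_mono fun x hx h0 => hx (by simp [h0])
  have hχc : HasCompactSupport fun x => η x ^ 2 := hηc.mono fun x hx h0 => hx (by simp [h0])
  set c := (1 - γ) * (p - 1) with hc
  have hc0 : 0 < c := mul_pos (by linarith) (by linarith)
  set S : Euc n → ℝ := fun x => ∑ i, ‖H i x‖ ^ 2 with hS
  set ρ : ℝ → Euc n → ℝ := fun ε x => cutPow ε (-γ) (‖G x‖ ^ 2) with hρ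
  have hρ0 : ∀ ε, 0 < ε → ∀ x, 0 ≤ ρ ε x := fun ε hε x => cutPow_nonneg _ _ _ hε
  have hρG : ∀ ε, 0 < ε → ∀ x s, γ < s → ρ ε x * ‖G x‖ ^ s ≤ M ^ (s - γ) := by
    intro ε hε x s hs
    rcases (norm_nonneg (G x)).eq_or_lt with h' | h'
    · simp only [hρ, ← h']
      rw [cutPow_eq_zero _ _ _ hε (by simpa using sq_nonneg ε), zero_mul]
      exact Real.rpow_nonneg ((norm_nonneg _).trans (hM 0)) _
    · have h1 : ρ ε x ≤ ‖G x‖ ^ (-γ) := by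
        refine (cutPow_le _ _ _ (by positivity)).trans_eq ?_
        rw [← Real.rpow_natCast, ← Real.rpow_mul h'.le]; congr 1; push_cast; ring
      calc ρ ε x * ‖G x‖ ^ s ≤ ‖G x‖ ^ (-γ) * ‖G x‖ ^ s := by gcongr
        _ = ‖G x‖ ^ (s - γ) := by rw [← Real.rpow_add h']; congr 1; ring
        _ ≤ _ := Real.rpow_le_rpow h'.le (hM x) (by linarith)
  -- continuity and integrability of the cut off integrand
  have hPc : ∀ ε, 0 < ε → ∀ x, ρ ε x * ‖G x‖ ^ (p - 2) =
      ρ ε x * cutPow (ε / 4) (p - 2) (‖G x‖ ^ 2) := by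
    intro ε hε x
    rcases le_or_gt (‖G x‖ ^ 2) (ε ^ 2) with h' | h'
    · simp only [hρ]; rw [cutPow_eq_zero _ _ _ hε h']; simp
    · rw [cutPow_eq _ _ _ (by positivity) (by nlinarith), ← Real.rpow_natCast,
        ← Real.rpow_mul (norm_nonneg _)]
      congr 2; push_cast; ring
  set F : ℝ → Euc n → ℝ := fun ε x => η x ^ 2 * (ρ ε x * (‖G x‖ ^ (p - 2) * S x)) with hF
  have hSint : IntegrableOn S (tsupport η) volume :=
    integrable_finsetSum _ fun i _ =>
      (memLp_two_iff_integrable_sq_norm (hHm i).aestronglyMeasurable).1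
        (hH.memLp hG _ hηc.isCompact hηs i)
  have hFi : ∀ ε, 0 < ε → Integrable (F ε) volume := by
    intro ε hε
    have e1 : F ε = fun x => (η x ^ 2 * (ρ ε x * cutPow (ε / 4) (p - 2) (‖G x‖ ^ 2))) * S x := by
      funext x; simp only [hF]; rw [← hPc ε hε x]; ring
    have hcont : Continuous fun x =>
        η x ^ 2 * (ρ ε x * cutPow (ε / 4) (p - 2) (‖G x‖ ^ 2)) :=
      hχ.continuous.mul (((contDiff_cutPow _ _ hε).continuous.comp (hG.norm.pow 2)).mul
        ((contDiff_cutPow _ _ (by positivity)).continuous.comp (hG.norm.pow 2)))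
    have h2 := hSint.continuousOn_mul hcont.continuousOn hηc.isCompact
    rw [e1]
    refine (integrableOn_iff_integrable_of_support_subset fun x hx => ?_).1 h2
    by_contra hxs
    exact hx (by simp [image_eq_zero_of_notMem_tsupport hxs])
  set C := n * (Cf * M ^ (1 - γ)) * (∫ x, η x ^ 2) +
    n * (2 / c) * M ^ (p - γ) * ∫ x, ‖fderiv ℝ η x‖ ^ 2 with hC
  have hi1 : Integrable (fun x => η x ^ 2) volume :=
    hχ.continuous.integrable_of_hasCompactSupport hχc
  have hi2 : Integrable (fun x => ‖fderiv ℝ η x‖ ^ 2) volume :=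
    ((hη1'.continuous_fderiv one_ne_zero).norm.pow 2).integrable_of_hasCompactSupport
      ((hηc.fderiv ℝ).mono fun x hx h0 => hx (by simp [h0]))
  have hbound : ∀ ε, 0 < ε → c / 2 * ∫ x, F ε x ≤ C := by
    intro ε hε
    have hRi : ∀ i : Fin n, ContDiff ℝ 1 fun z : Euc n => cutField ε (-γ) z i := fun i =>
      (EuclideanSpace.proj (𝕜 := ℝ) i).contDiff.comp (contDiff_cutField ε (-γ) hε)
    have key := fun i => integral_linearized_comp p hp1 U hU h hpos h0 u f hu huc hf hfc H hHm hH
      heq ε hε (fun z => cutField ε (-γ) z i) (hRi i) (fun z hz => by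
        have : ‖z‖ ^ 2 ≤ ε ^ 2 := by gcongr
        simp [cutField, cutPow_eq_zero _ _ _ hε this])
      (fun x => η x ^ 2) hχ hχc (hsub.trans hηs) i
    have hfd : ∀ x w, fderiv ℝ (fun x => η x ^ 2) x w = 2 * η x * fderiv ℝ η x w := by
      intro x w
      rw [fderiv_fun_pow _ (hη1'.differentiable one_ne_zero x)]
      simp
    simp only [hfd] at key
    have hsum := Finset.sum_congr (rfl : (Finset.univ : Finset (Fin n)) = _)
      fun i _ => (key i).2
    rw [← integral_finsetSum _ fun i _ => (key i).1] at hsum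
    have hlow : c / 2 * (∫ x, F ε x) - n * (2 / c) * M ^ (p - γ) * ∫ x, ‖fderiv ℝ η x‖ ^ 2 ≤
        ∑ i, ∫ x, fderiv ℝ f x (EuclideanSpace.single i 1) *
          (η x ^ 2 * cutField ε (-γ) (G x) i) := by
      rw [← hsum, ← integral_const_mul, ← integral_const_mul, ← integral_sub
        ((hFi ε hε).const_mul _) (hi2.const_mul _)]
      refine integral_mono (((hFi ε hε).const_mul _).sub (hi2.const_mul _))
        (integrable_finsetSum _ fun i _ => (key i).1) fun x => ?_
      refine le_trans ?_ (form_lower_bound p γ ε hp1 hp2 hγ0 hγ1 hε (G x) (fun i => H i x) (η x)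
        (fderiv ℝ η x))
      refine sub_le_sub le_rfl ?_
      have h1 := hρG ε hε x p (by linarith)
      have h2 : ‖fderiv ℝ η x‖ ^ 2 * (ρ ε x * ‖G x‖ ^ p) ≤ ‖fderiv ℝ η x‖ ^ 2 * M ^ (p - γ) := by
        gcongr
      calc (n : ℝ) * (2 / c * (‖fderiv ℝ η x‖ ^ 2 * (ρ ε x * ‖G x‖ ^ p)))
          ≤ n * (2 / c * (‖fderiv ℝ η x‖ ^ 2 * M ^ (p - γ))) := by gcongr
        _ = _ := by ring
    have hup : ∑ i, ∫ x, fderiv ℝ f x (EuclideanSpace.single i 1) *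
          (η x ^ 2 * cutField ε (-γ) (G x) i) ≤
        ∑ _i : Fin n, (Cf * M ^ (1 - γ)) * ∫ x, η x ^ 2 := by
      refine Finset.sum_le_sum fun i _ => ?_
      rw [← integral_const_mul]
      refine (Real.le_norm_self _).trans (norm_integral_le_of_norm_le (hi1.const_mul _)
        (Filter.Eventually.of_forall fun x => ?_))
      have b1 : ‖fderiv ℝ f x (EuclideanSpace.single i 1)‖ ≤ Cf := by
        simpa using (fderiv ℝ f x).le_of_opNorm_le (hCf x) (EuclideanSpace.single i 1)
      have b2 : |cutField ε (-γ) (G x) i| ≤ M ^ (1 - γ) := by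
        refine le_trans ?_ (hρG ε hε x 1 (by linarith))
        rw [cutField, PiLp.smul_apply, smul_eq_mul, abs_mul, abs_of_nonneg (hρ0 ε hε x),
          Real.rpow_one]
        exact mul_le_mul_of_nonneg_left (PiLp.norm_apply_le (G x) i) (hρ0 ε hε x)
      rw [norm_mul, norm_mul, Real.norm_of_nonneg (sq_nonneg (η x)), Real.norm_eq_abs (cutField _ _ _ _)]
      calc _ ≤ Cf * (η x ^ 2 * M ^ (1 - γ)) :=
            mul_le_mul b1 (mul_le_mul_of_nonneg_left b2 (sq_nonneg _)) (by positivity)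
              ((norm_nonneg _).trans b1)
        _ = _ := by ring
    rw [Finset.sum_const, Finset.card_univ, Fintype.card_fin, nsmul_eq_mul] at hup
    rw [hC]
    linarith
  have hlim : ∀ᵐ x, Filter.Tendsto (fun m : ℕ => F (1 / ((m : ℝ) + 1)) x) Filter.atTop
      (𝓝 (η x ^ 2 * (‖G x‖ ^ (-γ) * (‖G x‖ ^ (p - 2) * S x)))) := by
    filter_upwards [ae_all_iff.2 hH0] with x hx
    by_cases hxs : x ∈ tsupport η
    · by_cases hz : G x = 0
      · have : S x = 0 := by
          simp only [hS]
          exact Finset.sum_eq_zero fun i _ => by rw [hx i (hηs hxs) hz]; simp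
        simp [hF, this]
      · have hz' : 0 < ‖G x‖ := norm_pos_iff.2 hz
        refine tendsto_const_nhds.congr' ?_
        have ht := tendsto_one_div_add_atTop_nhds_zero_nat (𝕜 := ℝ)
        filter_upwards [ht.eventually (gt_mem_nhds (by positivity : 0 < ‖G x‖ / 2))] with m hm
        have hm0 : 0 < 1 / ((m : ℝ) + 1) := by positivity
        simp only [hF, hρ]
        have e1 : (‖G x‖ ^ 2) ^ (-γ / 2) = ‖G x‖ ^ (-γ) := by
          rw [← Real.rpow_natCast, ← Real.rpow_mul (norm_nonneg _)]
          congr 1; push_cast; ring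
        rw [cutPow_eq _ _ _ hm0 (by nlinarith), e1]
    · simp [hF, image_eq_zero_of_notMem_tsupport hxs]
  have hfin := (integrable_of_tendsto_of_integral_le (fun m : ℕ => F (1 / ((m : ℝ) + 1))) _
    (2 / c * C) (fun m => hFi _ (by positivity))
    (fun m => Filter.Eventually.of_forall fun x => by
      have := hρ0 (1 / ((m : ℝ) + 1)) (by positivity) x
      have hS0 : 0 ≤ S x := Finset.sum_nonneg fun i _ => by positivity
      simp only [hF, Pi.zero_apply]; positivity)
    (Filter.Eventually.of_forall fun m => by
      have := hbound (1 / ((m : ℝ) + 1)) (by positivity)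
      calc ∫ x, F (1 / ((m : ℝ) + 1)) x = 2 / c * (c / 2 * ∫ x, F (1 / ((m : ℝ) + 1)) x) := by
            field_simp
        _ ≤ _ := by gcongr) hlim).1
  refine (hfin.integrableOn (s := K)).congr_fun (fun x hx => ?_) hK.measurableSet
  simp only [hηU' x (hKU' hx), one_pow, one_mul, hS]

/-- Dominated convergence in `L^s` towards zero. -/
lemma tendsto_eLpNorm_zero_of_dominated {X F : Type*} [MeasurableSpace X] {μ : Measure X}
    [NormedAddCommGroup F] {s : ℝ≥0∞} (hs0 : s ≠ 0) (hst : s ≠ ⊤) (r : ℕ → X → F) (g : X → ℝ)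
    (hr : ∀ k, AEStronglyMeasurable (r k) μ) (hg : MemLp g s μ)
    (hbd : ∀ k, ∀ᵐ x ∂μ, ‖r k x‖ ≤ g x)
    (hlim : ∀ᵐ x ∂μ, Filter.Tendsto (fun k => r k x) Filter.atTop (𝓝 0)) :
    Filter.Tendsto (fun k => eLpNorm (r k) s μ) Filter.atTop (𝓝 0) := by
  have hpos : 0 < s.toReal := ENNReal.toReal_pos hs0 hst
  have key : Filter.Tendsto (fun k => ∫⁻ x, ‖r k x‖ₑ ^ s.toReal ∂μ) Filter.atTop
      (𝓝 (∫⁻ _, 0 ∂μ)) := by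
    refine tendsto_lintegral_of_dominated_convergence' (fun x => ‖g x‖ₑ ^ s.toReal) ?_ ?_ ?_ ?_
    · intro k
      exact (hr k).enorm.pow_const _
    · intro k
      filter_upwards [hbd k] with x hx
      refine ENNReal.rpow_le_rpow ?_ hpos.le
      rw [enorm_le_iff_norm_le]
      exact hx.trans (le_abs_self _)
    · exact (lintegral_rpow_enorm_lt_top_of_eLpNorm_lt_top hs0 hst hg.2).ne
    · filter_upwards [hlim] with x hx
      have h1 : Filter.Tendsto (fun k => ‖r k x‖ₑ) Filter.atTop (𝓝 0) := by
        have := hx.enorm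
        simpa using this
      have h2 := h1.ennrpow_const s.toReal
      rwa [ENNReal.zero_rpow_of_pos hpos] at h2
  simp only [lintegral_zero] at key
  have h3 := key.ennrpow_const (1 / s.toReal)
  rw [ENNReal.zero_rpow_of_pos (by positivity)] at h3
  refine h3.congr fun k => ?_
  rw [eLpNorm_eq_lintegral_rpow_enorm_toReal hs0 hst]

open SchwartzMap FourierTransform in
lemma norm_fourierInv_apply_le (a : 𝓢(Euc n, ℂ)) (x : Euc n) :
    ‖(𝓕⁻ a : 𝓢(Euc n, ℂ)) x‖ ≤ (eLpNorm a 1 volume).toReal := by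
  rw [← norm_toLp]
  have := norm_fourier_apply_le_toLp_one a (-x)
  rw [fourier_coe] at this
  rwa [fourierInv_coe, Real.fourierInv_eq_fourier_neg]

open SchwartzMap FourierTransform in
lemma eLpNorm_two_fourierInv (a : 𝓢(Euc n, ℂ)) :
    eLpNorm (𝓕⁻ a : 𝓢(Euc n, ℂ)) 2 volume = eLpNorm a 2 volume := by
  have h := norm_fourier_toL2_eq (𝓕⁻ a : 𝓢(Euc n, ℂ))
  rw [fourier_fourierInv_eq, norm_toLp, norm_toLp] at h
  exact (ENNReal.toReal_eq_toReal_iff' ((𝓕⁻ a : 𝓢(Euc n, ℂ)).memLp 2 volume).2.ne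
    (a.memLp 2 volume).2.ne).1 h.symm

open SchwartzMap FourierTransform Laplacian in
lemma exists_schwartz_laplacian_approx (hn : 2 ≤ n) (φ : 𝓢(Euc n, ℂ)) {δ : ℝ} (hδ : 0 < δ) :
    ∃ w : 𝓢(Euc n, ℂ), eLpNorm (fun x => φ x - (Δ w) x) 2 volume ≤ ENNReal.ofReal δ ∧
      ∀ x, ‖φ x - (Δ w) x‖ ≤ δ := by
  have : Nonempty (Fin n) := ⟨⟨0, by omega⟩⟩
  have : Nontrivial (Euc n) := inferInstance
  -- annular cutoffs
  have hK : ∀ m : ℕ, IsCompact (Metric.closedBall (0 : Euc n) (m + 1) \ Metric.ball 0 (1 / (m + 1))) :=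
    fun m => (isCompact_closedBall _ _).diff Metric.isOpen_ball
  have hKs : ∀ m : ℕ, Metric.closedBall (0 : Euc n) (m + 1) \ Metric.ball 0 (1 / (m + 1)) ⊆ {0}ᶜ := by
    intro m x hx h0
    rw [mem_singleton_iff] at h0
    refine hx.2 ?_
    rw [h0]
    exact Metric.mem_ball_self (by positivity)
  choose ψ U hψ hψc hψs hψ0 hψ1 hUo hKU hUs hψU using
    fun m => exists_cutoff _ _ (hK m) isOpen_compl_singleton (hKs m)
  have hψlim : ∀ x : Euc n, x ≠ 0 → ∀ᶠ m in Filter.atTop, ψ m x = 1 := by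
    intro x hx
    have hx0 : 0 < ‖x‖ := norm_pos_iff.2 hx
    have e1 : ∀ᶠ m : ℕ in Filter.atTop, ‖x‖ ≤ m := Filter.Tendsto.eventually_ge_atTop tendsto_natCast_atTop_atTop _
    have e2 : ∀ᶠ m : ℕ in Filter.atTop, 1 / ((m : ℝ) + 1) < ‖x‖ :=
      (tendsto_one_div_add_atTop_nhds_zero_nat (𝕜 := ℝ)).eventually_lt_const hx0
    filter_upwards [e1, e2] with m h1 h2
    refine hψU m x (hKU m ⟨?_, ?_⟩)
    · rw [mem_closedBall_zero_iff]; linarith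
    · rw [mem_ball_zero_iff]; linarith
  set Φ := 𝓕 φ with hΦ
  -- the truncated multiplier
  have hsm : ∀ m, ContDiff ℝ (⊤ : ℕ∞) (fun ξ : Euc n => ((-((2 * π) ^ 2 * ‖ξ‖ ^ 2)⁻¹ * ψ m ξ : ℝ) : ℂ) * Φ ξ) := by
    intro m
    refine ContDiff.mul (Complex.ofRealCLM.contDiff.comp ?_) (Φ.smooth _)
    rw [contDiff_iff_contDiffAt]
    intro ξ
    by_cases h : ξ = 0
    · have : (fun ξ : Euc n => -((2 * π) ^ 2 * ‖ξ‖ ^ 2)⁻¹ * ψ m ξ) =ᶠ[𝓝 ξ] fun _ => 0 := by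
        have hnt : ξ ∉ tsupport (ψ m) := fun h' => hψs m h' (by simp [h])
        filter_upwards [(isClosed_tsupport (ψ m)).isOpen_compl.mem_nhds hnt] with y hy
        rw [image_eq_zero_of_notMem_tsupport hy, mul_zero]
      exact contDiffAt_const.congr_of_eventuallyEq this
    · refine ContDiffAt.mul (ContDiffAt.neg (ContDiffAt.inv ?_ ?_)) (hψ m).contDiffAt
      · exact (contDiff_const.mul (contDiff_norm_sq ℝ)).contDiffAt
      · have : 0 < ‖ξ‖ := norm_pos_iff.2 h
        positivity
  have hcs : ∀ m, HasCompactSupport (fun ξ : Euc n => ((-((2 * π) ^ 2 * ‖ξ‖ ^ 2)⁻¹ * ψ m ξ : ℝ) : ℂ) * Φ ξ) := by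
    intro m
    exact (hψc m).mono fun x hx h0 => hx (by simp [h0])
  set S : ℕ → 𝓢(Euc n, ℂ) := fun m => (hcs m).toSchwartzMap (hsm m) with hS
  have hSap : ∀ m ξ, S m ξ = ((-((2 * π) ^ 2 * ‖ξ‖ ^ 2)⁻¹ * ψ m ξ : ℝ) : ℂ) * Φ ξ := fun m ξ => rfl
  set A : ℕ → 𝓢(Euc n, ℂ) := fun m => Φ - (-(2 * π) ^ 2 • smulLeftCLM ℂ (fun x : Euc n => ‖x‖ ^ 2) (S m)) with hA
  have hAap : ∀ m ξ, A m ξ = (if ξ = 0 then Φ ξ else ((1 - ψ m ξ : ℝ) : ℂ) * Φ ξ) := by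
    intro m ξ
    have htg : Function.HasTemperateGrowth (fun x : Euc n => ‖x‖ ^ 2) := by fun_prop
    simp only [hA, sub_apply, smul_apply]
    rw [smulLeftCLM_apply_apply htg, hSap]
    split_ifs with h
    · simp [h]
    · have : (‖ξ‖ : ℂ) ≠ 0 := by simpa using h
      have h2 : (π : ℂ) ≠ 0 := by simp [Real.pi_ne_zero]
      simp only [Complex.real_smul]
      push_cast
      field_simp
  have hAle : ∀ m ξ, ‖A m ξ‖ ≤ ‖Φ ξ‖ := by
    intro m ξ
    rw [hAap]
    split_ifs
    · exact le_rfl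
    · rw [norm_mul, Complex.norm_real, Real.norm_eq_abs]
      refine mul_le_of_le_one_left (norm_nonneg _) ?_
      rw [abs_le]
      constructor <;> linarith [hψ0 m ξ, hψ1 m ξ]
  have hAlim : ∀ᵐ ξ ∂(volume : Measure (Euc n)), Filter.Tendsto (fun m => A m ξ) Filter.atTop (𝓝 0) := by
    have : ∀ᵐ ξ ∂(volume : Measure (Euc n)), ξ ≠ 0 := by
      rw [ae_iff]; simp
    filter_upwards [this] with ξ hξ
    refine tendsto_const_nhds.congr' ?_
    filter_upwards [hψlim ξ hξ] with m hm
    rw [hAap, if_neg hξ, hm]; simp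
  have hT : ∀ s : ℝ≥0∞, s ≠ 0 → s ≠ ⊤ → Filter.Tendsto (fun m => eLpNorm (A m) s volume) Filter.atTop (𝓝 0) := by
    intro s hs0 hst
    refine tendsto_eLpNorm_zero_of_dominated hs0 hst _ (fun ξ => ‖Φ ξ‖) (fun m => (A m).continuous.aestronglyMeasurable) (Φ.memLp s volume).norm ?_ hAlim
    exact fun m => ae_of_all _ (hAle m)
  have hδ' : 0 < ENNReal.ofReal δ := ENNReal.ofReal_pos.2 hδ
  obtain ⟨m, hm2, hm1⟩ := (((hT 2 (by simp) (by simp)).eventually_lt_const hδ').and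
    ((hT 1 (by simp) (by simp)).eventually_lt_const hδ')).exists
  have hrem : φ - Δ (𝓕⁻ (S m) : 𝓢(Euc n, ℂ)) = 𝓕⁻ (A m) := by
    rw [laplacian_eq_fourierMultiplierCLM, fourierMultiplierCLM_apply, fourier_fourierInv_eq]
    have h0 : φ = 𝓕⁻ Φ := by rw [hΦ, fourierInv_fourier_eq]
    have h1 : ∀ a b : 𝓢(Euc n, ℂ), 𝓕⁻ (a - b) = 𝓕⁻ a - 𝓕⁻ b :=
      fun a b => (fourierInvCLM ℂ 𝓢(Euc n, ℂ)).map_sub a b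
    have h2 : ∀ (c : ℝ) (a : 𝓢(Euc n, ℂ)), 𝓕⁻ (c • a) = c • 𝓕⁻ a :=
      fun c a => FourierTransform.fourierInv_smul c a
    change φ - _ = 𝓕⁻ (Φ - (-(2 * π) ^ 2 • smulLeftCLM ℂ (fun x : Euc n => ‖x‖ ^ 2) (S m)))
    rw [h1, h2, ← h0]
  refine ⟨𝓕⁻ (S m), ?_, ?_⟩
  · have : (fun x => φ x - (Δ (𝓕⁻ (S m) : 𝓢(Euc n, ℂ))) x) = ⇑(𝓕⁻ (A m) : 𝓢(Euc n, ℂ)) := by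
      rw [← hrem]; rfl
    rw [this, eLpNorm_two_fourierInv]
    exact hm2.le
  · intro x
    have : φ x - (Δ (𝓕⁻ (S m) : 𝓢(Euc n, ℂ))) x = (𝓕⁻ (A m) : 𝓢(Euc n, ℂ)) x := by rw [← hrem]; rfl
    rw [this]
    refine (norm_fourierInv_apply_le _ _).trans ?_
    exact ENNReal.toReal_le_of_le_ofReal hδ.le hm1.le

lemma natCast_le_smooth (j : ℕ) : (j : WithTop ℕ∞) ≤ ((⊤ : ℕ∞) : WithTop ℕ∞) := by
  exact_mod_cast le_top

open Laplacian in
lemma lapl_eq_laplacian (w : Euc n → ℝ) : lapl w = Δ w := by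
  rw [InnerProductSpace.laplacian_eq_iteratedFDeriv_orthonormalBasis w
    (EuclideanSpace.basisFun (Fin n) ℝ)]
  funext x
  simp [lapl]

lemma abs_lapl_le (w : Euc n → ℝ) (x : Euc n) :
    |lapl w x| ≤ n * ‖iteratedFDeriv ℝ 2 w x‖ := by
  unfold lapl
  refine (Finset.abs_sum_le_sum_abs _ _).trans ?_
  have h : ∀ i ∈ (Finset.univ : Finset (Fin n)),
      |iteratedFDeriv ℝ 2 w x ![EuclideanSpace.single i 1, EuclideanSpace.single i 1]| ≤
        ‖iteratedFDeriv ℝ 2 w x‖ := by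
    intro i _
    have := (iteratedFDeriv ℝ 2 w x).le_opNorm ![EuclideanSpace.single i 1, EuclideanSpace.single i 1]
    simpa [Fin.prod_univ_two, PiLp.norm_single] using this
  refine (Finset.sum_le_sum h).trans ?_
  simp

lemma continuous_lapl (w : Euc n → ℝ) (hw : ContDiff ℝ (⊤ : ℕ∞) w) : Continuous (lapl w) := by
  unfold lapl
  refine continuous_finsetSum _ fun i _ => ?_
  have h : Continuous (iteratedFDeriv ℝ 2 w) :=
    hw.continuous_iteratedFDeriv (natCast_le_smooth 2)
  exact (ContinuousMultilinearMap.apply ℝ (fun _ : Fin 2 => Euc n) ℝ _).continuous.comp h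

lemma hasCompactSupport_lapl (w : Euc n → ℝ) (hw : HasCompactSupport w) :
    HasCompactSupport (lapl w) := by
  refine (hw.iteratedFDeriv (𝕜 := ℝ) 2).mono fun x hx h0 => hx ?_
  simp [lapl, h0]

lemma eLpNorm_le_of_two_of_bound {X : Type*} [MeasurableSpace X] {μ : Measure X} (r : X → ℝ)
    {δ q : ℝ} (hq : 2 ≤ q) (h2 : eLpNorm r 2 μ ≤ ENNReal.ofReal δ)
    (hb : ∀ x, |r x| ≤ δ) : eLpNorm r (ENNReal.ofReal q) μ ≤ ENNReal.ofReal δ := by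
  have hq0 : 0 < q := by linarith
  rw [eLpNorm_eq_lintegral_rpow_enorm_toReal (by simp [hq0]) (by simp),
    ENNReal.toReal_ofReal hq0.le]
  rw [eLpNorm_eq_lintegral_rpow_enorm_toReal (by simp) (by simp)] at h2
  simp only [ENNReal.toReal_ofNat] at h2
  rw [one_div, ENNReal.rpow_inv_le_iff (by norm_num)] at h2
  rw [one_div, ENNReal.rpow_inv_le_iff hq0]
  have hb' : ∀ x, ‖r x‖ₑ ≤ ENNReal.ofReal δ := fun x => by
    rw [enorm_eq_ofReal_abs]
    exact ENNReal.ofReal_le_ofReal (hb x)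
  have hsplit : ∀ c : ℝ≥0∞, c ^ q = c ^ (q - 2) * c ^ (2 : ℝ) := fun c => by
    rw [← ENNReal.rpow_add_of_nonneg _ _ (by linarith) (by norm_num)]
    congr 1; ring
  calc ∫⁻ x, ‖r x‖ₑ ^ q ∂μ ≤ ∫⁻ x, ENNReal.ofReal δ ^ (q - 2) * ‖r x‖ₑ ^ (2 : ℝ) ∂μ := by
        refine lintegral_mono fun x => ?_
        simp only
        rw [hsplit]
        exact mul_le_mul' (ENNReal.rpow_le_rpow (hb' x) (by linarith)) le_rfl
    _ = ENNReal.ofReal δ ^ (q - 2) * ∫⁻ x, ‖r x‖ₑ ^ (2 : ℝ) ∂μ :=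
        lintegral_const_mul' _ _ (ENNReal.rpow_ne_top_of_nonneg (by linarith) (by simp))
    _ ≤ ENNReal.ofReal δ ^ (q - 2) * ENNReal.ofReal δ ^ (2 : ℝ) := by gcongr
    _ = _ := (hsplit _).symm

/-- Spatial cutoffs of a function with rapidly decaying derivatives approximate its Laplacian. -/
lemma exists_test_lapl_near (v : Euc n → ℝ) (hv : ContDiff ℝ (⊤ : ℕ∞) v)
    (hdec : ∀ j ≤ 2, ∃ C, ∀ x, ‖iteratedFDeriv ℝ j v x‖ ≤ C * (1 + ‖x‖) ^ (-((n : ℝ) + 1)))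
    {q δ : ℝ} (hq : 2 ≤ q) (hδ : 0 < δ) :
    ∃ w : Euc n → ℝ, ContDiff ℝ (⊤ : ℕ∞) w ∧ HasCompactSupport w ∧
      eLpNorm (fun x => lapl v x - lapl w x) 2 volume ≤ ENNReal.ofReal δ ∧
      eLpNorm (fun x => lapl v x - lapl w x) (ENNReal.ofReal q) volume ≤ ENNReal.ofReal δ := by
  obtain ⟨χ, U, hχ, hχc, -, hχ0, hχ1, hUo, hKU, -, hχU⟩ :=
    exists_cutoff (Metric.closedBall (0 : Euc n) 1) univ (isCompact_closedBall _ _) isOpen_univ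
      (subset_univ _)
  choose! C hC using hdec
  have hA : ∀ j : ℕ, ∃ A, ∀ x, ‖iteratedFDeriv ℝ j χ x‖ ≤ A := fun j =>
    (hχ.continuous_iteratedFDeriv (m := j) (by exact_mod_cast le_top)).bounded_above_of_compact_support
      (hχc.iteratedFDeriv (𝕜 := ℝ) j)
  choose A hA using hA
  have hA0 : ∀ j, 0 ≤ A j := fun j => (norm_nonneg _).trans (hA j 0)
  have hC0 : ∀ j ≤ 2, 0 ≤ C j := fun j hj => by
    have := (norm_nonneg _).trans (hC j hj 0)
    simpa using this
  set c : ℕ → ℝ := fun k => 1 / ((k : ℝ) + 1) with hc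
  have hc0 : ∀ k, 0 < c k := fun k => by simp only [hc]; positivity
  have hc1 : ∀ k, c k ≤ 1 := fun k => by
    simp only [hc]
    rw [div_le_one (by positivity)]
    linarith [(Nat.cast_nonneg k : (0 : ℝ) ≤ k)]
  set X : ℕ → Euc n → ℝ := fun k x => χ (c k • x) with hX
  have hXs : ∀ k, ContDiff ℝ (⊤ : ℕ∞) (X k) := fun k => hχ.comp (contDiff_const_smul (c k))
  have hXc : ∀ k, HasCompactSupport (X k) := fun k =>
    hχc.comp_homeomorph (Homeomorph.smulOfNeZero (c k) (hc0 k).ne')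
  have hXA : ∀ k j x, ‖iteratedFDeriv ℝ j (X k) x‖ ≤ A j := by
    intro k j x
    have : ContDiff ℝ j χ := hχ.of_le (by exact_mod_cast le_top)
    simp only [hX]
    rw [iteratedFDeriv_comp_const_smul (c k) this]
    simp only [norm_smul, norm_pow, Real.norm_eq_abs, abs_of_pos (hc0 k)]
    refine le_trans (mul_le_of_le_one_left (norm_nonneg _) (pow_le_one₀ (hc0 k).le (hc1 k))) (hA _ _)
  set w : ℕ → Euc n → ℝ := fun k x => X k x * v x with hw
  have hws : ∀ k, ContDiff ℝ (⊤ : ℕ∞) (w k) := fun k => (hXs k).mul hv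
  have hwc : ∀ k, HasCompactSupport (w k) := fun k => (hXc k).mul_right
  set D : ℝ := A 0 * C 2 + 2 * A 1 * C 1 + A 2 * C 0 with hD
  have hwb : ∀ k x, ‖iteratedFDeriv ℝ 2 (w k) x‖ ≤ D * (1 + ‖x‖) ^ (-((n : ℝ) + 1)) := by
    intro k x
    have := norm_iteratedFDeriv_mul_le (hXs k) hv x (natCast_le_smooth 2)
    refine this.trans ?_
    simp only [Finset.sum_range_succ, Finset.sum_range_zero, zero_add]
    have e0 : ‖iteratedFDeriv ℝ 0 (X k) x‖ * ‖iteratedFDeriv ℝ 2 v x‖ ≤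
      A 0 * (C 2 * (1 + ‖x‖) ^ (-((n : ℝ) + 1))) :=
      mul_le_mul (hXA k 0 x) (hC 2 le_rfl x) (norm_nonneg _) (hA0 0)
    have e1 : ‖iteratedFDeriv ℝ 1 (X k) x‖ * ‖iteratedFDeriv ℝ 1 v x‖ ≤
      A 1 * (C 1 * (1 + ‖x‖) ^ (-((n : ℝ) + 1))) :=
      mul_le_mul (hXA k 1 x) (hC 1 (by norm_num) x) (norm_nonneg _) (hA0 1)
    have e2 : ‖iteratedFDeriv ℝ 2 (X k) x‖ * ‖iteratedFDeriv ℝ 0 v x‖ ≤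
      A 2 * (C 0 * (1 + ‖x‖) ^ (-((n : ℝ) + 1))) :=
      mul_le_mul (hXA k 2 x) (hC 0 (by norm_num) x) (norm_nonneg _) (hA0 2)
    have n0 : Nat.choose 2 0 = 1 := rfl
    have n1 : Nat.choose 2 1 = 2 := rfl
    have n2 : Nat.choose 2 2 = 1 := rfl
    simp only [n0, n1, n2, Nat.sub_zero, Nat.cast_one, one_mul, Nat.cast_ofNat,
      Nat.reduceSub, hD]
    nlinarith [e0, e1, e2]
  have hdom : ∀ k x, |lapl v x - lapl (w k) x| ≤ n * (C 2 + D) * (1 + ‖x‖) ^ (-((n : ℝ) + 1)) := by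
    intro k x
    have a1 := (abs_lapl_le v x).trans (mul_le_mul_of_nonneg_left (hC 2 le_rfl x) (Nat.cast_nonneg n))
    have a2 := (abs_lapl_le (w k) x).trans (mul_le_mul_of_nonneg_left (hwb k x) (Nat.cast_nonneg n))
    have := abs_sub (lapl v x) (lapl (w k) x)
    nlinarith
  have hlim : ∀ x, Filter.Tendsto (fun k => lapl v x - lapl (w k) x) Filter.atTop (𝓝 0) := by
    intro x
    refine tendsto_const_nhds.congr' ?_
    have e1 : ∀ᶠ k : ℕ in Filter.atTop, ‖x‖ ≤ k :=
      Filter.Tendsto.eventually_ge_atTop tendsto_natCast_atTop_atTop _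
    filter_upwards [e1] with k hk
    have hnear : w k =ᶠ[𝓝 x] v := by
      have : Metric.ball (0 : Euc n) (k + 1) ∈ 𝓝 x :=
        Metric.isOpen_ball.mem_nhds (by rw [mem_ball_zero_iff]; linarith)
      filter_upwards [this] with y hy
      rw [mem_ball_zero_iff] at hy
      have : X k y = 1 := by
        refine hχU _ (hKU ?_)
        rw [mem_closedBall_zero_iff, norm_smul, Real.norm_eq_abs, abs_of_pos (hc0 k)]
        simp only [hc]
        rw [one_div, inv_mul_le_iff₀ (by positivity)]
        linarith
      simp [hw, this]
    have : lapl (w k) x = lapl v x := by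
      simp only [lapl, (hnear.iteratedFDeriv ℝ 2).eq_of_nhds]
    rw [this, sub_self]
  have hmem : ∀ s : ℝ, 1 ≤ s → MemLp (fun x : Euc n => n * (C 2 + D) * (1 + ‖x‖) ^ (-((n : ℝ) + 1)))
      (ENNReal.ofReal s) volume := by
    intro s hs
    refine MemLp.const_mul ?_ _
    have hmeas : AEStronglyMeasurable (fun x : Euc n => (1 + ‖x‖) ^ (-((n : ℝ) + 1))) volume :=
      Measurable.aestronglyMeasurable (by fun_prop)
    rw [← integrable_norm_rpow_iff hmeas (by simp; linarith) (by simp),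
      ENNReal.toReal_ofReal (by linarith)]
    have := integrable_one_add_norm (E := Euc n) (μ := volume) (r := ((n : ℝ) + 1) * s) (by
      rw [finrank_euclideanSpace_fin]
      nlinarith [(Nat.cast_nonneg n : (0 : ℝ) ≤ n)])
    refine this.congr (ae_of_all _ fun x => ?_)
    have hx : 0 < 1 + ‖x‖ := by positivity
    simp only
    rw [Real.norm_eq_abs, abs_of_nonneg (by positivity), ← Real.rpow_mul hx.le]
    congr 1; ring
  have hT : ∀ s : ℝ, 1 ≤ s → Filter.Tendsto
      (fun k => eLpNorm (fun x => lapl v x - lapl (w k) x) (ENNReal.ofReal s) volume)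
      Filter.atTop (𝓝 0) := by
    intro s hs
    refine tendsto_eLpNorm_zero_of_dominated (by simp; linarith) (by simp) _ _ ?_ (hmem s hs) ?_
      (ae_of_all _ hlim)
    · exact fun k => ((continuous_lapl v hv).sub (continuous_lapl _ (hws k))).aestronglyMeasurable
    · exact fun k => ae_of_all _ (hdom k)
  have hδ' : 0 < ENNReal.ofReal δ := ENNReal.ofReal_pos.2 hδ
  obtain ⟨k, hk2, hkq⟩ := (((hT 2 (by norm_num)).eventually_lt_const hδ').and
    ((hT q (by linarith)).eventually_lt_const hδ')).exists
  rw [ENNReal.ofReal_ofNat] at hk2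
  exact ⟨w k, hws k, hwc k, hk2.le, hkq.le⟩

open SchwartzMap Laplacian in
lemma exists_test_lapl_approx_smooth (hn : 2 ≤ n) (g : Euc n → ℝ) (hg : ContDiff ℝ (⊤ : ℕ∞) g)
    (hgc : HasCompactSupport g) {q δ : ℝ} (hq : 2 ≤ q) (hδ : 0 < δ) :
    ∃ w : Euc n → ℝ, ContDiff ℝ (⊤ : ℕ∞) w ∧ HasCompactSupport w ∧
      eLpNorm (fun x => g x - lapl w x) 2 volume ≤ ENNReal.ofReal δ ∧
      eLpNorm (fun x => g x - lapl w x) (ENNReal.ofReal q) volume ≤ ENNReal.ofReal δ := by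
  have hφs : ContDiff ℝ (⊤ : ℕ∞) (fun x => ((g x : ℝ) : ℂ)) := Complex.ofRealCLM.contDiff.comp hg
  have hφc : HasCompactSupport (fun x => ((g x : ℝ) : ℂ)) :=
    hgc.mono fun x hx h0 => hx (by simp [h0])
  obtain ⟨W, hW2, hWb⟩ := exists_schwartz_laplacian_approx hn (hφc.toSchwartzMap hφs) (half_pos hδ)
  have hφ : ∀ x, (hφc.toSchwartzMap hφs) x = ((g x : ℝ) : ℂ) := fun x => rfl
  simp only [hφ] at hW2 hWb
  set v : Euc n → ℝ := Complex.reCLM ∘ W with hv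
  have hvs : ContDiff ℝ (⊤ : ℕ∞) v := Complex.reCLM.contDiff.comp (W.smooth _)
  have hlv : ∀ x, lapl v x = ((Δ W) x).re := by
    intro x
    rw [lapl_eq_laplacian, hv, SchwartzMap.laplacian_apply,
      ContDiffAt.laplacian_CLM_comp_left ((W.smooth 2).contDiffAt)]
    rfl
  have hre : ∀ x, |g x - lapl v x| ≤ ‖(g x : ℂ) - (Δ W) x‖ := by
    intro x
    have := Complex.abs_re_le_norm ((g x : ℂ) - (Δ W) x)
    rwa [Complex.sub_re, Complex.ofReal_re, ← hlv] at this
  have hdec : ∀ j ≤ 2, ∃ C, ∀ x, ‖iteratedFDeriv ℝ j v x‖ ≤ C * (1 + ‖x‖) ^ (-((n : ℝ) + 1)) := by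
    intro j _
    refine ⟨2 ^ (n + 1) * (Finset.Iic (n + 1, j)).sup (fun m => SchwartzMap.seminorm ℝ m.1 m.2) W,
      fun x => ?_⟩
    have h1 := one_add_le_sup_seminorm_apply (𝕜 := ℝ) (m := (n + 1, j)) le_rfl le_rfl W x
    have h2 : ‖iteratedFDeriv ℝ j v x‖ ≤ ‖iteratedFDeriv ℝ j W x‖ := by
      have := Complex.reCLM.norm_iteratedFDeriv_comp_left (x := x) (n := j) (W.smooth j).contDiffAt le_rfl
      refine this.trans ?_
      rw [Complex.reCLM_norm, one_mul]
    have hx : 0 < 1 + ‖x‖ := by positivity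
    rw [Real.rpow_neg hx.le, ← div_eq_mul_inv, le_div_iff₀ (by positivity), mul_comm]
    have h3 : (1 + ‖x‖) ^ ((n : ℝ) + 1) = (1 + ‖x‖) ^ (n + 1) := by
      rw [← Real.rpow_natCast]; push_cast; rfl
    rw [h3]
    exact (mul_le_mul_of_nonneg_left h2 (by positivity)).trans h1
  obtain ⟨w, hws, hwc, hw2, hwq⟩ := exists_test_lapl_near v hvs hdec hq (half_pos hδ)
  have h2 : eLpNorm (fun x => g x - lapl v x) 2 volume ≤ ENNReal.ofReal (δ / 2) :=
    (eLpNorm_mono fun x => by rw [Real.norm_eq_abs]; exact hre x).trans hW2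
  have hqv := eLpNorm_le_of_two_of_bound (q := q) _ hq h2
    fun x => (hre x).trans (hWb x)
  have hcont1 : Continuous fun x => g x - lapl v x := hg.continuous.sub (continuous_lapl v hvs)
  have hcont2 : Continuous fun x => lapl v x - lapl w x :=
    (continuous_lapl v hvs).sub (continuous_lapl w hws)
  have hsum : (fun x => g x - lapl w x) =
      (fun x => g x - lapl v x) + fun x => lapl v x - lapl w x := by
    funext x; simp
  have hadd : ENNReal.ofReal δ = ENNReal.ofReal (δ / 2) + ENNReal.ofReal (δ / 2) := by
    rw [← ENNReal.ofReal_add (half_pos hδ).le (half_pos hδ).le, add_halves]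
  refine ⟨w, hws, hwc, ?_, ?_⟩
  · rw [hsum, hadd]
    exact (eLpNorm_add_le hcont1.aestronglyMeasurable hcont2.aestronglyMeasurable (by norm_num)).trans
      (add_le_add h2 hw2)
  · rw [hsum, hadd]
    refine (eLpNorm_add_le hcont1.aestronglyMeasurable hcont2.aestronglyMeasurable ?_).trans
      (add_le_add hqv hwq)
    rw [ENNReal.one_le_ofReal]; linarith

lemma exists_test_lapl_approx (hn : 2 ≤ n) (g : Euc n → ℝ) {q δ : ℝ} (hq : 2 ≤ q) (hδ : 0 < δ)
    (hg : MemLp g (ENNReal.ofReal q) volume) (K : Set (Euc n)) (hK : IsCompact K)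
    (hgK : ∀ x, x ∉ K → g x = 0) :
    ∃ w : Euc n → ℝ, ContDiff ℝ (⊤ : ℕ∞) w ∧ HasCompactSupport w ∧
      eLpNorm (fun x => g x - lapl w x) 2 volume ≤ ENNReal.ofReal δ ∧
      eLpNorm (fun x => g x - lapl w x) (ENNReal.ofReal q) volume ≤ ENNReal.ofReal δ := by
  obtain ⟨χ, U, hχ, hχc, -, hχ0, hχ1, hUo, hKU, -, hχU⟩ :=
    exists_cutoff K univ hK isOpen_univ (subset_univ _)
  have hq1 : 1 ≤ ENNReal.ofReal q := by rw [ENNReal.one_le_ofReal]; linarith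
  have h2q : (2 : ℝ≥0∞) ≤ ENNReal.ofReal q := by
    rw [← ENNReal.ofReal_ofNat]; exact ENNReal.ofReal_le_ofReal hq
  set T := tsupport χ with hT
  have hTc : IsCompact T := hχc.isCompact
  set c : ℝ≥0∞ := volume T ^ (1 / (2 : ℝ≥0∞).toReal - 1 / (ENNReal.ofReal q).toReal) with hc
  have hctop : c ≠ ⊤ := by
    refine ENNReal.rpow_ne_top_of_nonneg ?_ hTc.measure_lt_top.ne
    rw [ENNReal.toReal_ofReal (by linarith), ENNReal.toReal_ofNat, sub_nonneg]
    exact one_div_le_one_div_of_le (by norm_num) hq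
  set ε : ℝ := δ / 2 / (1 + c.toReal) with hε
  have hc0 : 0 ≤ c.toReal := ENNReal.toReal_nonneg
  have hε0 : 0 < ε := by positivity
  obtain ⟨g1, hg1c, hg1, hgg1⟩ := hg.exist_eLpNorm_sub_le (by simp) hq1 hε0
  set g2 : Euc n → ℝ := fun x => χ x * g1 x with hg2
  have hg2s : ContDiff ℝ (⊤ : ℕ∞) g2 := hχ.mul hg1
  have hg2c : HasCompactSupport g2 := hχc.mul_right
  have hdiff : (fun x => g x - g2 x) = fun x => χ x * (g x - g1 x) := by
    funext x
    by_cases hx : x ∈ K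
    · simp only [hg2, hχU x (hKU hx), one_mul]
    · simp only [hg2, hgK x hx]; ring
  have hmeas : AEStronglyMeasurable (fun x => g x - g2 x) volume :=
    hg.1.sub hg2s.continuous.aestronglyMeasurable
  have hqn : eLpNorm (fun x => g x - g2 x) (ENNReal.ofReal q) volume ≤ ENNReal.ofReal ε := by
    refine le_trans (eLpNorm_mono fun x => ?_) hgg1
    rw [congrFun hdiff x, norm_mul, Real.norm_eq_abs, abs_of_nonneg (hχ0 x)]
    exact mul_le_of_le_one_left (norm_nonneg _) (hχ1 x)
  have hsupp : Function.support (fun x => g x - g2 x) ⊆ T := by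
    intro x hx
    by_contra h
    refine hx ?_
    change g x - g2 x = 0
    rw [congrFun hdiff x, image_eq_zero_of_notMem_tsupport h, zero_mul]
  have h2n : eLpNorm (fun x => g x - g2 x) 2 volume ≤ ENNReal.ofReal ε * c := by
    have := eLpNorm_le_eLpNorm_mul_rpow_measure_univ h2q (hmeas.restrict (s := T))
    rw [eLpNorm_restrict_eq_of_support_subset hsupp, eLpNorm_restrict_eq_of_support_subset hsupp,
      Measure.restrict_apply_univ] at this
    exact this.trans (by gcongr)
  have hb1 : ENNReal.ofReal ε ≤ ENNReal.ofReal (δ / 2) := by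
    refine ENNReal.ofReal_le_ofReal ?_
    rw [hε]
    exact div_le_self (half_pos hδ).le (by linarith)
  have hb2 : ENNReal.ofReal ε * c ≤ ENNReal.ofReal (δ / 2) := by
    rw [← ENNReal.ofReal_toReal hctop, ← ENNReal.ofReal_mul hε0.le]
    refine ENNReal.ofReal_le_ofReal ?_
    rw [hε, div_mul_eq_mul_div, div_le_iff₀ (by positivity)]
    nlinarith
  obtain ⟨w, hw, hwc, hw2, hwq⟩ := exists_test_lapl_approx_smooth hn g2 hg2s hg2c hq (half_pos hδ)
  have hcont : Continuous fun x => g2 x - lapl w x := hg2s.continuous.sub (continuous_lapl w hw)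
  have hsum : (fun x => g x - lapl w x) =
      (fun x => g x - g2 x) + fun x => g2 x - lapl w x := by
    funext x; simp
  have hadd : ENNReal.ofReal δ = ENNReal.ofReal (δ / 2) + ENNReal.ofReal (δ / 2) := by
    rw [← ENNReal.ofReal_add (half_pos hδ).le (half_pos hδ).le, add_halves]
  refine ⟨w, hw, hwc, ?_, ?_⟩
  · rw [hsum, hadd]
    exact (eLpNorm_add_le hmeas hcont.aestronglyMeasurable (by norm_num)).trans
      (add_le_add (h2n.trans hb2) hw2)
  · rw [hsum, hadd]
    exact (eLpNorm_add_le hmeas hcont.aestronglyMeasurable hq1).trans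
      (add_le_add (hqn.trans hb1) hwq)

section HessianIdentity

variable {h : ℕ → ℝ}

lemma tendsto_integral_mul_diffQuot_of_contDiff (F b : Euc n → ℝ) (hF : Continuous F)
    (hFc : HasCompactSupport F) (hb : ContDiff ℝ 1 b) (hbc : HasCompactSupport b)
    (h0 : Filter.Tendsto h Filter.atTop (𝓝 0)) (hne : ∀ k, h k ≠ 0) (i : Fin n) :
    Filter.Tendsto (fun k => ∫ x, F x * diffQuot i (h k) b x) Filter.atTop
      (𝓝 (∫ x, F x * fderiv ℝ b x (EuclideanSpace.single i 1))) := by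
  obtain ⟨L, hL⟩ := ContDiff.lipschitzWith_of_hasCompactSupport hbc hb one_ne_zero
  refine tendsto_integral_of_dominated_convergence (fun x => ‖F x‖ * L) ?_ ?_ ?_ ?_
  · exact fun k => (hF.mul (diffQuot_continuous i (h k) b hb.continuous)).aestronglyMeasurable
  · exact (hF.integrable_of_hasCompactSupport hFc).norm.mul_const _
  · intro k
    refine Filter.Eventually.of_forall fun x => ?_
    rw [norm_mul]
    exact mul_le_mul_of_nonneg_left (norm_diffQuot_le i _ b L hL x) (norm_nonneg _)
  · exact Filter.Eventually.of_forall fun x => (tendsto_diffQuot i h h0 hne b x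
      (hb.differentiable one_ne_zero x)).const_mul _

lemma fderiv_diffQuot (i : Fin n) (t : ℝ) (a : Euc n → ℝ) (ha : ContDiff ℝ 1 a) (x e : Euc n) :
    fderiv ℝ (diffQuot i t a) x e = diffQuot i t (fun y => fderiv ℝ a y e) x := by
  unfold diffQuot
  have hd : Differentiable ℝ a := ha.differentiable one_ne_zero
  have h1 : DifferentiableAt ℝ (fun y => a (y + t • EuclideanSpace.single i 1)) x :=
    (hd _).comp x (differentiableAt_id.add_const _)
  rw [fderiv_fun_const_smul (h1.fun_sub (hd x)), fderiv_fun_sub h1 (hd x), fderiv_comp_add_right]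
  simp

lemma contDiff_diffQuot (i : Fin n) (t : ℝ) (a : Euc n → ℝ) (ha : ContDiff ℝ 1 a) :
    ContDiff ℝ 1 (diffQuot i t a) := by
  unfold diffQuot
  exact ((ha.comp (contDiff_id.add contDiff_const)).sub ha).const_smul _

lemma hasCompactSupport_diffQuot (i : Fin n) (t : ℝ) (a : Euc n → ℝ) (ha : HasCompactSupport a) :
    HasCompactSupport (diffQuot i t a) := by
  have h1 := (ha.comp_homeomorph (Homeomorph.addRight (t • EuclideanSpace.single i (1 : ℝ)))).sub ha
  refine h1.mono fun x hx h0 => hx ?_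
  have h2 : a (x + t • EuclideanSpace.single i 1) - a x = 0 := h0
  simp [diffQuot, h2]

lemma integral_mul_fderiv_comm (a b : Euc n → ℝ) (ha : ContDiff ℝ 1 a) (hac : HasCompactSupport a)
    (hb : ContDiff ℝ 1 b) (hbc : HasCompactSupport b) (i j : Fin n) :
    ∫ x, fderiv ℝ a x (EuclideanSpace.single i 1) * fderiv ℝ b x (EuclideanSpace.single j 1) =
      ∫ x, fderiv ℝ a x (EuclideanSpace.single j 1) * fderiv ℝ b x (EuclideanSpace.single i 1) := by
  have hcf : ∀ (f : Euc n → ℝ), ContDiff ℝ 1 f → ∀ e, Continuous fun x => fderiv ℝ f x e :=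
    fun f hf e => (hf.continuous_fderiv one_ne_zero).clm_apply continuous_const
  have hcs : ∀ (f : Euc n → ℝ), HasCompactSupport f → ∀ e, HasCompactSupport fun x => fderiv ℝ f x e :=
    fun f hf e => (hf.fderiv ℝ).mono fun x hx h0 => hx (by simp [h0])
  set t : ℕ → ℝ := fun k => 1 / ((k : ℝ) + 1) with ht
  have ht0 : Filter.Tendsto t Filter.atTop (𝓝 0) := tendsto_one_div_add_atTop_nhds_zero_nat
  have htp : ∀ k, t k ≠ 0 := fun k => by simp only [ht]; positivity
  have l1 := tendsto_integral_mul_diffQuot_of_contDiff _ a (hcf b hb (EuclideanSpace.single j 1))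
    (hcs b hbc _) ha hac ht0 htp i
  have l2 := tendsto_integral_mul_diffQuot_of_contDiff _ b (hcf a ha (EuclideanSpace.single j 1))
    (hcs a hac _) hb hbc (h := fun k => - t k) (by simpa using ht0.neg) (fun k => neg_ne_zero.2 (htp k)) i
  simp only [mul_comm (fderiv ℝ b _ _)] at l1
  refine tendsto_nhds_unique l1 (l2.congr fun k => ?_)
  have e1 := integral_diffQuot_mul i (t k) (fun x => fderiv ℝ a x (EuclideanSpace.single j 1)) b
    (hcf a ha _) hb.continuous hbc
  have hd := contDiff_diffQuot i (t k) a ha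
  have hdc := hasCompactSupport_diffQuot i (t k) a hac
  have e2 := integral_mul_fderiv_eq_neg_fderiv_mul_of_integrable (𝕜 := ℝ) (μ := volume)
    (f := diffQuot i (t k) a) (g := b)
    (v := EuclideanSpace.single j 1)
    (((hcf _ hd _).mul hb.continuous).integrable_of_hasCompactSupport hbc.mul_left)
    ((hd.continuous.mul (hcf b hb _)).integrable_of_hasCompactSupport hdc.mul_right)
    ((hd.continuous.mul hb.continuous).integrable_of_hasCompactSupport hbc.mul_left)
    (fun x _ => hd.differentiable one_ne_zero x) (fun x _ => hb.differentiable one_ne_zero x)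
  simp only [fderiv_diffQuot i (t k) a ha] at e2
  rw [e2, e1, neg_neg]

lemma IsDQLimit.ae_eq_zero {E : Type*} [NormedAddCommGroup E] [NormedSpace ℝ E] {Ω : Set (Euc n)}
    (hpos : ∀ k, 0 < h k) (h0 : Filter.Tendsto h Filter.atTop (𝓝 0)) {g : Euc n → E}
    {H : Fin n → Euc n → E} (hg : IsDQLimit Ω h g H) (i : Fin n) :
    ∀ᵐ x, x ∈ Ω → x ∉ tsupport g → H i x = 0 := by
  filter_upwards [hg.1 i] with x hx hxΩ hxs
  have hnear : g =ᶠ[𝓝 x] fun _ => 0 := by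
    filter_upwards [(isClosed_tsupport g).isOpen_compl.mem_nhds hxs] with y hy
    exact image_eq_zero_of_notMem_tsupport hy
  have h1 := tendsto_diffQuot i h h0 (fun k => (hpos k).ne') g x
    ((differentiableAt_const _).congr_of_eventuallyEq hnear)
  rw [hnear.fderiv_eq, fderiv_fun_const] at h1
  exact tendsto_nhds_unique (hx hxΩ) h1

lemma IsDQLimit.memLp_univ {E : Type*} [NormedAddCommGroup E] [NormedSpace ℝ E]
    [SecondCountableTopology E]
    (hpos : ∀ k, 0 < h k) (h0 : Filter.Tendsto h Filter.atTop (𝓝 0)) {g : Euc n → E}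
    {H : Fin n → Euc n → E} (hg : IsDQLimit univ h g H) (hcont : Continuous g)
    (hc : HasCompactSupport g) (i : Fin n) : MemLp (H i) 2 volume := by
  have h1 := hg.memLp hcont (tsupport g) hc.isCompact (subset_univ _) i
  rw [← memLp_indicator_iff_restrict (isClosed_tsupport g).measurableSet] at h1
  refine h1.ae_eq ?_
  filter_upwards [hg.ae_eq_zero hpos h0 i] with x hx
  by_cases hxs : x ∈ tsupport g
  · rw [indicator_of_mem hxs]
  · rw [indicator_of_notMem hxs, hx (mem_univ _) hxs]

lemma IsDQLimit.tendsto_integral_mul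
    (h0 : Filter.Tendsto h Filter.atTop (𝓝 0)) {g g' : Euc n → ℝ} {H H' : Fin n → Euc n → ℝ}
    (hg : IsDQLimit univ h g H) (hg' : IsDQLimit univ h g' H') (hcont : Continuous g)
    (hc : HasCompactSupport g) (hcont' : Continuous g') (i j : Fin n) :
    Filter.Tendsto (fun k => ∫ x, diffQuot i (h k) g x * diffQuot j (h k) g' x) Filter.atTop
      (𝓝 (∫ x, H i x * H' j x)) := by
  set K := Metric.cthickening 1 (tsupport g) with hK
  have hKc : IsCompact K := hc.isCompact.cthickening
  obtain ⟨Z, hZ, hZ0, hd⟩ := hg.2 K hKc (subset_univ _)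
  obtain ⟨Z', hZ', hZ0', hd'⟩ := hg'.2 K hKc (subset_univ _)
  refine tendsto_integral_filter_of_dominated_convergence (fun x => Z x + Z' x) ?_ ?_ (hZ.add hZ') ?_
  · exact Filter.Eventually.of_forall fun k => ((diffQuot_continuous i (h k) g hcont).mul
      (diffQuot_continuous j (h k) g' hcont')).aestronglyMeasurable
  · filter_upwards [hd i, hd' j, h0.eventually (Metric.ball_mem_nhds 0 one_pos)] with k hk hk' hk1
    have hk1 : |h k| ≤ 1 := by
      have : |h k| < 1 := by simpa using hk1
      exact this.le
    filter_upwards [hk, hk'] with x hx hx'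
    by_cases hxK : x ∈ K
    · have a1 := hx hxK
      have a2 := hx' hxK
      rw [norm_mul]
      nlinarith [sq_nonneg (‖diffQuot i (h k) g x‖ - ‖diffQuot j (h k) g' x‖),
        norm_nonneg (diffQuot i (h k) g x), norm_nonneg (diffQuot j (h k) g' x)]
    · rw [diffQuot_eq_zero i (h k) 1 g x hk1 hxK, zero_mul, norm_zero]
      exact add_nonneg (hZ0 x) (hZ0' x)
  · filter_upwards [hg.1 i, hg'.1 j] with x hx hx'
    exact (hx (mem_univ _)).mul (hx' (mem_univ _))

lemma gradient_apply_coord (v : Euc n → ℝ) (x : Euc n) (j : Fin n) :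
    gradient v x j = fderiv ℝ v x (EuclideanSpace.single j 1) := by
  rw [← inner_gradient_left, real_inner_comm, EuclideanSpace.inner_single_left]
  simp

/-- For compactly supported `v`, the `L²` norms of the Hessian and of the Laplacian agree. -/
theorem integral_sum_norm_sq_eq_integral_trace_sq (hpos : ∀ k, 0 < h k)
    (h0 : Filter.Tendsto h Filter.atTop (𝓝 0)) (v : Euc n → ℝ) (hv : ContDiff ℝ 1 v)
    (hvc : HasCompactSupport v) (N : Fin n → Euc n → Euc n) (hN : IsDQLimit univ h (gradient v) N) :
    ∫ x, ∑ i, ‖N i x‖ ^ 2 = ∫ x, (∑ i, N i x i) ^ 2 := by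
  have hGc := continuous_gradient v hv
  have hGs := hasCompactSupport_gradient v hvc
  obtain ⟨R, hR⟩ := hGs.exists_bound_of_continuous hGc
  have hco : ∀ j, IsDQLimit univ h (fun x => gradient v x j) (fun i x => N i x j) := fun j =>
    hN.coord h0 hpos R hR j
  have hcc : ∀ j, Continuous fun x => gradient v x j := fun j => by fun_prop
  have hcs : ∀ j, HasCompactSupport fun x => gradient v x j := fun j =>
    hGs.mono fun x hx h0 => hx (by simp [h0])
  have hL2 : ∀ i j, MemLp (fun x => N i x j) 2 volume := fun i j =>
    (hco j).memLp_univ hpos h0 (hcc j) (hcs j) i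
  have hint : ∀ i j k l, Integrable (fun x => N i x j * N k x l) volume := fun i j k l =>
    (hL2 i j).integrable_mul (hL2 k l)
  have hgr : ∀ j, (fun x => gradient v x j) = fun x => fderiv ℝ v x (EuclideanSpace.single j 1) :=
    fun j => funext fun x => gradient_apply_coord v x j
  have hsymm : ∀ i j, ∀ᵐ x, N i x j = N j x i := by
    intro i j
    refine ae_eq_of_integral_contDiff_smul_eq ((hL2 i j).locallyIntegrable (by norm_num))
      ((hL2 j i).locallyIntegrable (by norm_num)) fun ψ hψ hψc => ?_
    have hψ1 : ContDiff ℝ 1 ψ := hψ.of_le (by exact_mod_cast le_top)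
    have a1 := (hco j).integral_mul_fderiv hpos h0 (hcc j) ψ hψ1 hψc (subset_univ _) i
    have a2 := (hco i).integral_mul_fderiv hpos h0 (hcc i) ψ hψ1 hψc (subset_univ _) j
    have a3 := integral_mul_fderiv_comm v ψ hv hvc hψ1 hψc j i
    simp only [gradient_apply_coord] at a1 a2
    simp only [smul_eq_mul, mul_comm (ψ _)]
    linarith
  have hswap : ∀ i j, ∫ x, N i x j * N j x i = ∫ x, N i x i * N j x j := by
    intro i j
    have l1 := (hco j).tendsto_integral_mul h0 (hco i) (hcc j) (hcs j) (hcc i) i j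
    have l2 := (hco i).tendsto_integral_mul h0 (hco j) (hcc i) (hcs i) (hcc j) i j
    refine tendsto_nhds_unique l1 (l2.congr fun k => ?_)
    have := integral_mul_fderiv_comm (diffQuot i (h k) v) (diffQuot j (h k) v)
      (contDiff_diffQuot i _ v hv) (hasCompactSupport_diffQuot i _ v hvc)
      (contDiff_diffQuot j _ v hv) (hasCompactSupport_diffQuot j _ v hvc) i j
    simp only [fderiv_diffQuot _ _ v hv] at this
    rw [hgr i, hgr j]
    exact this
  have e1 : ∫ x, ∑ i, ‖N i x‖ ^ 2 = ∑ i, ∑ j, ∫ x, N i x j * N i x j := by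
    have : ∀ x, ∑ i, ‖N i x‖ ^ 2 = ∑ i, ∑ j, N i x j * N i x j := fun x => by
      refine Finset.sum_congr rfl fun i _ => ?_
      rw [EuclideanSpace.real_norm_sq_eq]
      exact Finset.sum_congr rfl fun j _ => pow_two _
    simp only [this]
    rw [integral_finsetSum _ fun i _ => integrable_finsetSum _ fun j _ => hint i j i j]
    exact Finset.sum_congr rfl fun i _ => integral_finsetSum _ fun j _ => hint i j i j
  have e2 : ∫ x, (∑ i, N i x i) ^ 2 = ∑ i, ∑ j, ∫ x, N i x i * N j x j := by
    have : ∀ x, (∑ i, N i x i) ^ 2 = ∑ i, ∑ j, N i x i * N j x j := fun x => by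
      rw [pow_two, Finset.sum_mul_sum]
    simp only [this]
    rw [integral_finsetSum _ fun i _ => integrable_finsetSum _ fun j _ => hint i i j j]
    exact Finset.sum_congr rfl fun i _ => integral_finsetSum _ fun j _ => hint i i j j
  rw [e1, e2]
  refine Finset.sum_congr rfl fun i _ => Finset.sum_congr rfl fun j _ => ?_
  rw [← hswap i j]
  refine integral_congr_ae ?_
  filter_upwards [hsymm i j] with x hx
  rw [hx]

end HessianIdentity

lemma inner_fderiv_gradient (w : Euc n → ℝ) (hw : ContDiff ℝ (⊤ : ℕ∞) w) (x a b : Euc n) :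
    ⟪fderiv ℝ (gradient w) x a, b⟫_ℝ = iteratedFDeriv ℝ 2 w x ![a, b] := by
  have hd : DifferentiableAt ℝ (fderiv ℝ w) x :=
    (hw.fderiv_right one_add_one_le_smooth).differentiable one_ne_zero x
  have h1 : HasFDerivAt (gradient w)
      ((InnerProductSpace.toDual ℝ (Euc n)).symm.toContinuousLinearEquiv.toContinuousLinearMap.comp
        (fderiv ℝ (fderiv ℝ w) x)) x :=
    (InnerProductSpace.toDual ℝ (Euc n)).symm.toContinuousLinearEquiv.toContinuousLinearMap.hasFDerivAt.comp
      x hd.hasFDerivAt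
  rw [h1.fderiv, iteratedFDeriv_two_apply]
  exact InnerProductSpace.toDual_symm_apply

lemma contDiff_gradient (w : Euc n → ℝ) (hw : ContDiff ℝ (⊤ : ℕ∞) w) :
    ContDiff ℝ 1 (gradient w) :=
  (InnerProductSpace.toDual ℝ (Euc n)).symm.toContinuousLinearEquiv.toContinuousLinearMap.contDiff.comp
    (hw.fderiv_right one_add_one_le_smooth)

lemma lapl_eq_sum_fderiv_gradient (w : Euc n → ℝ) (hw : ContDiff ℝ (⊤ : ℕ∞) w) (x : Euc n) :
    lapl w x = ∑ i, fderiv ℝ (gradient w) x (EuclideanSpace.single i 1) i := by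
  refine Finset.sum_congr rfl fun i _ => ?_
  rw [← inner_fderiv_gradient w hw, real_inner_comm, EuclideanSpace.inner_single_left]
  simp

lemma abs_iteratedFDeriv_two_apply_le (w : Euc n → ℝ) (x a b : Euc n) :
    |iteratedFDeriv ℝ 2 w x ![a, b]| ≤ ‖iteratedFDeriv ℝ 2 w x‖ * ‖a‖ * ‖b‖ := by
  have := (iteratedFDeriv ℝ 2 w x).le_opNorm ![a, b]
  simpa [Fin.prod_univ_two, mul_assoc] using this

lemma norm_fderiv_gradient_single_le (w : Euc n → ℝ) (hw : ContDiff ℝ (⊤ : ℕ∞) w) (x : Euc n)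
    (i : Fin n) : ‖fderiv ℝ (gradient w) x (EuclideanSpace.single i 1)‖ ≤
      ‖iteratedFDeriv ℝ 2 w x‖ := by
  set z := fderiv ℝ (gradient w) x (EuclideanSpace.single i 1) with hz
  have h1 : ‖z‖ * ‖z‖ ≤ ‖iteratedFDeriv ℝ 2 w x‖ * ‖z‖ := by
    have h2 := abs_iteratedFDeriv_two_apply_le w x (EuclideanSpace.single i 1) z
    rw [← inner_fderiv_gradient w hw, ← hz, real_inner_self_eq_norm_sq, PiLp.norm_single,
      norm_one, mul_one, abs_of_nonneg (sq_nonneg _)] at h2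
    nlinarith
  rcases (norm_nonneg z).eq_or_lt with h0 | h0
  · rw [← h0]; exact norm_nonneg _
  · exact le_of_mul_le_mul_right h1 h0

lemma abs_sum_mul_inner_fderiv_gradient_le (w : Euc n → ℝ) (hw : ContDiff ℝ (⊤ : ℕ∞) w)
    (x ν : Euc n) (hν : ‖ν‖ ≤ 1) :
    |∑ i, ν i * ⟪ν, fderiv ℝ (gradient w) x (EuclideanSpace.single i 1)⟫_ℝ| ≤
      ‖iteratedFDeriv ℝ 2 w x‖ := by
  have h1 : ∑ i, ν i * ⟪ν, fderiv ℝ (gradient w) x (EuclideanSpace.single i 1)⟫_ℝ =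
      iteratedFDeriv ℝ 2 w x ![ν, ν] := by
    rw [← inner_fderiv_gradient w hw, clm_apply_eq_sum, sum_inner]
    refine Finset.sum_congr rfl fun i _ => ?_
    rw [inner_smul_left, real_inner_comm ν]
    simp
  rw [h1]
  refine (abs_iteratedFDeriv_two_apply_le w x ν ν).trans ?_
  have := norm_nonneg ν
  have := norm_nonneg (iteratedFDeriv ℝ 2 w x)
  calc ‖iteratedFDeriv ℝ 2 w x‖ * ‖ν‖ * ‖ν‖ ≤ ‖iteratedFDeriv ℝ 2 w x‖ * 1 * 1 := by gcongr
    _ = _ := by ring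

lemma sq_sum_mul_inner_le (ν : Euc n) (hν : ‖ν‖ ≤ 1) (N : Fin n → Euc n) :
    (∑ i, ν i * ⟪ν, N i⟫_ℝ) ^ 2 ≤ ∑ i, ‖N i‖ ^ 2 := by
  have hν2 : ‖ν‖ ^ 2 ≤ 1 := by nlinarith [norm_nonneg ν]
  refine (Finset.sum_mul_sq_le_sq_mul_sq Finset.univ _ _).trans ?_
  have h1 : ∑ i, ν i ^ 2 ≤ 1 := by rw [← EuclideanSpace.real_norm_sq_eq]; exact hν2
  have h2 : ∑ i, ⟪ν, N i⟫_ℝ ^ 2 ≤ ∑ i, ‖N i‖ ^ 2 := by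
    refine Finset.sum_le_sum fun i _ => ?_
    have h3 := abs_real_inner_le_norm ν (N i)
    have h4 : |⟪ν, N i⟫_ℝ| ≤ ‖N i‖ := h3.trans (mul_le_of_le_one_left (norm_nonneg _) hν)
    rw [← sq_abs]
    gcongr
  calc (∑ i, ν i ^ 2) * ∑ i, ⟪ν, N i⟫_ℝ ^ 2 ≤ 1 * ∑ i, ⟪ν, N i⟫_ℝ ^ 2 := by
        gcongr
    _ ≤ _ := by rw [one_mul]; exact h2

lemma eLpNorm_two_le_of_sq_le {X E : Type*} [MeasurableSpace X] {μ : Measure X}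
    [NormedAddCommGroup E] (a : X → E) (b S : X → ℝ) (hS : Integrable S μ)
    (ha : ∀ x, ‖a x‖ ^ 2 ≤ S x) (hb : MemLp b 2 μ) (h : ∫ x, S x ∂μ = ∫ x, b x ^ 2 ∂μ) :
    eLpNorm a 2 μ ≤ eLpNorm b 2 μ := by
  have hS0 : ∀ x, 0 ≤ S x := fun x => (sq_nonneg _).trans (ha x)
  have key : ∫⁻ x, ‖a x‖ₑ ^ (2 : ℝ) ∂μ ≤ ∫⁻ x, ‖b x‖ₑ ^ (2 : ℝ) ∂μ := by
    calc ∫⁻ x, ‖a x‖ₑ ^ (2 : ℝ) ∂μ ≤ ∫⁻ x, ENNReal.ofReal (S x) ∂μ := by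
          refine lintegral_mono fun x => ?_
          rw [ENNReal.rpow_two, ← ofReal_norm, ← ENNReal.ofReal_pow (norm_nonneg _)]
          exact ENNReal.ofReal_le_ofReal (ha x)
      _ = ENNReal.ofReal (∫ x, b x ^ 2 ∂μ) := by
          rw [← h, ofReal_integral_eq_lintegral_ofReal hS (Filter.Eventually.of_forall hS0)]
      _ = ∫⁻ x, ‖b x‖ₑ ^ (2 : ℝ) ∂μ := by
          rw [ofReal_integral_eq_lintegral_ofReal hb.integrable_sq
            (Filter.Eventually.of_forall fun x => sq_nonneg _)]
          refine lintegral_congr fun x => ?_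
          rw [ENNReal.rpow_two, ← ofReal_norm, ← ENNReal.ofReal_pow (norm_nonneg _),
            Real.norm_eq_abs, sq_abs]
  rw [eLpNorm_eq_lintegral_rpow_enorm_toReal (by simp) (by simp),
    eLpNorm_eq_lintegral_rpow_enorm_toReal (by simp) (by simp), ENNReal.toReal_ofNat]
  exact ENNReal.rpow_le_rpow key (by norm_num)

lemma eLpNorm_iteratedFDeriv_le {q C : ℝ} (hq : 0 < q) (hC : 0 ≤ C) (w : Euc n → ℝ)
    (hw : ContDiff ℝ (⊤ : ℕ∞) w) (hwc : HasCompactSupport w)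
    (h : (∫ x, ‖iteratedFDeriv ℝ 2 w x‖ ^ q) ^ (1 / q) ≤ C * (∫ x, |lapl w x| ^ q) ^ (1 / q)) :
    eLpNorm (iteratedFDeriv ℝ 2 w) (ENNReal.ofReal q) volume ≤
      ENNReal.ofReal C * eLpNorm (lapl w) (ENNReal.ofReal q) volume := by
  have h1 : MemLp (iteratedFDeriv ℝ 2 w) (ENNReal.ofReal q) volume :=
    (hw.continuous_iteratedFDeriv (natCast_le_smooth 2)).memLp_of_hasCompactSupport
      (hwc.iteratedFDeriv 2)
  have h2 : MemLp (lapl w) (ENNReal.ofReal q) volume :=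
    (continuous_lapl w hw).memLp_of_hasCompactSupport (hasCompactSupport_lapl w hwc)
  rw [h1.eLpNorm_eq_integral_rpow_norm (by simp [hq]) (by simp),
    h2.eLpNorm_eq_integral_rpow_norm (by simp [hq]) (by simp), ← ENNReal.ofReal_mul hC,
    ENNReal.toReal_ofReal hq.le, ← one_div]
  exact ENNReal.ofReal_le_ofReal h

section CalderonZygmund

variable {h : ℕ → ℝ}

lemma IsDQLimit.sub_hessian (hpos : ∀ k, 0 < h k) (h0 : Filter.Tendsto h Filter.atTop (𝓝 0))
    {v : Euc n → ℝ} (hv : ContDiff ℝ 1 v) {M : Fin n → Euc n → Euc n}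
    (hM : IsDQLimit univ h (gradient v) M) (hvc : HasCompactSupport v) (w : Euc n → ℝ)
    (hw : ContDiff ℝ (⊤ : ℕ∞) w) (hwc : HasCompactSupport w) :
    IsDQLimit univ h (gradient fun x => v x - w x)
      (fun i x => M i x - fderiv ℝ (gradient w) x (EuclideanSpace.single i 1)) := by
  have hw1 : ContDiff ℝ 1 w := hw.of_le (by exact_mod_cast le_top)
  have hgw := hasCompactSupport_gradient w hwc
  have h1 : IsDQLimit univ h (gradient w)
      (fun i x => fderiv ℝ (gradient w) x (EuclideanSpace.single i 1)) :=
    isDQLimit_of_contDiff hpos h0 _ (contDiff_gradient w hw) hgw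
  obtain ⟨R, hR⟩ := (hasCompactSupport_gradient v hvc).exists_bound_of_continuous
    (continuous_gradient v hv)
  obtain ⟨R', hR'⟩ := hgw.exists_bound_of_continuous (continuous_gradient w hw1)
  have h2 := (hM.prodMk h1).comp h0 hpos (max R R')
    (fun x => by
      rw [Prod.norm_mk]
      exact max_le_max (hR x) (hR' x)) (fun z : Euc n × Euc n => z.1 - z.2)
    (contDiff_fst.sub contDiff_snd)
  have e1 : (gradient fun x => v x - w x) = fun x => gradient v x - gradient w x := by
    funext x
    unfold gradient
    rw [fderiv_fun_sub (hv.differentiable one_ne_zero x) (hw1.differentiable one_ne_zero x), map_sub]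
  rw [e1]
  convert h2 using 3 with i x
  rw [fderiv_fun_sub differentiableAt_fst differentiableAt_snd, fderiv_fst, fderiv_snd]
  rfl

/-- The `L²` distance between Hessians is controlled by that of the Laplacians. -/
lemma integral_sum_norm_sub_hessian_sq (hpos : ∀ k, 0 < h k)
    (h0 : Filter.Tendsto h Filter.atTop (𝓝 0)) {v : Euc n → ℝ} (hv : ContDiff ℝ 1 v)
    (hvc : HasCompactSupport v) {M : Fin n → Euc n → Euc n}
    (hM : IsDQLimit univ h (gradient v) M) (w : Euc n → ℝ)
    (hw : ContDiff ℝ (⊤ : ℕ∞) w) (hwc : HasCompactSupport w) :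
    ∫ x, ∑ i, ‖M i x - fderiv ℝ (gradient w) x (EuclideanSpace.single i 1)‖ ^ 2 =
      ∫ x, ((∑ i, M i x i) - lapl w x) ^ 2 := by
  rw [integral_sum_norm_sq_eq_integral_trace_sq hpos h0 (fun x => v x - w x)
    (hv.sub (hw.of_le (by exact_mod_cast le_top))) (hvc.sub hwc) _
    (hM.sub_hessian hpos h0 hv hvc w hw hwc)]
  congr 1
  funext x
  rw [lapl_eq_sum_fderiv_gradient w hw, ← Finset.sum_sub_distrib]
  rfl

lemma memLp_hessian (w : Euc n → ℝ) (hw : ContDiff ℝ (⊤ : ℕ∞) w) (hwc : HasCompactSupport w)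
    (i : Fin n) (p : ℝ≥0∞) :
    MemLp (fun x => fderiv ℝ (gradient w) x (EuclideanSpace.single i 1)) p volume := by
  refine Continuous.memLp_of_hasCompactSupport
    (((contDiff_gradient w hw).continuous_fderiv one_ne_zero).clm_apply continuous_const)
    (((hasCompactSupport_gradient w hwc).fderiv ℝ).mono fun x hx h0 => hx (by simp [h0]))

end CalderonZygmund

section CalderonZygmundPerturbation

variable {h : ℕ → ℝ}

lemma hessian_approx_step (hn : 2 ≤ n) (hpos : ∀ k, 0 < h k)
    (h0 : Filter.Tendsto h Filter.atTop (𝓝 0)) {v : Euc n → ℝ} (hv : ContDiff ℝ 1 v)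
    (hvc : HasCompactSupport v) {M : Fin n → Euc n → Euc n}
    (hM : IsDQLimit univ h (gradient v) M) {q C A δ r : ℝ} (hq : 2 ≤ q) (hC : 0 ≤ C) (hA : 0 ≤ A)
    (hδ : 0 < δ) (hr : 0 ≤ r)
    (hCZ : ∀ w : Euc n → ℝ, ContDiff ℝ (⊤ : ℕ∞) w → HasCompactSupport w →
      (∫ x, ‖iteratedFDeriv ℝ 2 w x‖ ^ q) ^ (1 / q) ≤ C * (∫ x, |lapl w x| ^ q) ^ (1 / q))
    (g : Euc n → ℝ) (hg : MemLp g (ENNReal.ofReal q) volume) (K : Set (Euc n)) (hK : IsCompact K)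
    (hgK : ∀ x, x ∉ K → g x = 0)
    (hgA : eLpNorm g (ENNReal.ofReal q) volume ≤ ENNReal.ofReal A)
    (hgr : eLpNorm (fun x => (∑ i, M i x i) - g x) 2 volume ≤ ENNReal.ofReal r) :
    ∃ w : Euc n → ℝ, ContDiff ℝ (⊤ : ℕ∞) w ∧ HasCompactSupport w ∧
      eLpNorm (iteratedFDeriv ℝ 2 w) (ENNReal.ofReal q) volume ≤ ENNReal.ofReal (C * (A + δ)) ∧
      eLpNorm (fun x => (∑ i, M i x i) - lapl w x) 2 volume ≤ ENNReal.ofReal (r + δ) := by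
  obtain ⟨w, hw, hwc, h2, hqn⟩ := exists_test_lapl_approx hn g hq hδ hg K hK hgK
  have hq1 : 1 ≤ ENNReal.ofReal q := by rw [ENNReal.one_le_ofReal]; linarith
  have hcl := continuous_lapl w hw
  have hM2 : ∀ i, MemLp (M i) 2 volume := fun i =>
    hM.memLp_univ hpos h0 (continuous_gradient v hv) (hasCompactSupport_gradient v hvc) i
  have hMi : ∀ i, AEStronglyMeasurable (fun x => M i x i) volume := fun i =>
    (EuclideanSpace.proj i : Euc n →L[ℝ] ℝ).continuous.comp_aestronglyMeasurable (hM2 i).1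
  have hT : AEStronglyMeasurable (fun x => ∑ i, M i x i) volume :=
    Finset.aestronglyMeasurable_fun_sum _ fun i _ => hMi i
  refine ⟨w, hw, hwc, ?_, ?_⟩
  · refine (eLpNorm_iteratedFDeriv_le (by linarith) hC w hw hwc (hCZ w hw hwc)).trans ?_
    rw [ENNReal.ofReal_mul hC]
    gcongr
    have e : lapl w = g - fun x => g x - lapl w x := by funext x; simp
    rw [e, ENNReal.ofReal_add hA hδ.le]
    exact (eLpNorm_sub_le hg.1 (hg.1.sub hcl.aestronglyMeasurable) hq1).trans (add_le_add hgA hqn)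
  · have e : (fun x => (∑ i, M i x i) - lapl w x) =
        (fun x => (∑ i, M i x i) - g x) + fun x => g x - lapl w x := by funext x; simp
    rw [e, ENNReal.ofReal_add hr hδ.le]
    exact (eLpNorm_add_le (hT.sub hg.1) (hg.1.sub hcl.aestronglyMeasurable) (by norm_num)).trans
      (add_le_add hgr h2)

lemma hessian_contraction_step (hpos : ∀ k, 0 < h k)
    (h0 : Filter.Tendsto h Filter.atTop (𝓝 0)) {v : Euc n → ℝ} (hv : ContDiff ℝ 1 v)
    (hvc : HasCompactSupport v) {M : Fin n → Euc n → Euc n}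
    (hM : IsDQLimit univ h (gradient v) M) (ν : Euc n → Euc n) (hνm : StronglyMeasurable ν)
    (hν : ∀ x, ‖ν x‖ ≤ 1) {q θ A B Q s : ℝ} (hq : 2 ≤ q) (hθ : 0 ≤ θ) (hA : 0 ≤ A) (hB : 0 ≤ B)
    (hAB : θ * A + B ≤ Q) (F : Euc n → ℝ)
    (hF : MemLp F (ENNReal.ofReal q) volume)
    (hFB : eLpNorm F (ENNReal.ofReal q) volume ≤ ENNReal.ofReal B)
    (htr : ∀ᵐ x, ∑ i, M i x i = θ * ∑ i, ν x i * ⟪ν x, M i x⟫_ℝ + F x) (w : Euc n → ℝ)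
    (hw : ContDiff ℝ (⊤ : ℕ∞) w) (hwc : HasCompactSupport w)
    (hwA : eLpNorm (iteratedFDeriv ℝ 2 w) (ENNReal.ofReal q) volume ≤ ENNReal.ofReal A)
    (hws : eLpNorm (fun x => (∑ i, M i x i) - lapl w x) 2 volume ≤ ENNReal.ofReal s) :
    ∃ g : Euc n → ℝ, MemLp g (ENNReal.ofReal q) volume ∧
      (∀ x, x ∉ tsupport (gradient v) → g x = 0) ∧
      eLpNorm g (ENNReal.ofReal q) volume ≤ ENNReal.ofReal Q ∧
      eLpNorm (fun x => (∑ i, M i x i) - g x) 2 volume ≤ ENNReal.ofReal (θ * s) := by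
  set K := tsupport (gradient v) with hK
  have hKm : MeasurableSet K := (isClosed_tsupport _).measurableSet
  have hq1 : 1 ≤ ENNReal.ofReal q := by rw [ENNReal.one_le_ofReal]; linarith
  set D : Fin n → Euc n → Euc n := fun i x =>
    fderiv ℝ (gradient w) x (EuclideanSpace.single i 1) with hD
  have hM2 : ∀ i, MemLp (M i) 2 volume := fun i =>
    hM.memLp_univ hpos h0 (continuous_gradient v hv) (hasCompactSupport_gradient v hvc) i
  have hD2 : ∀ i, MemLp (D i) 2 volume := fun i => memLp_hessian w hw hwc i 2
  have hMi : ∀ i, MemLp (fun x => M i x i) 2 volume := fun i =>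
    (EuclideanSpace.proj i : Euc n →L[ℝ] ℝ).comp_memLp' (hM2 i)
  have hT : MemLp (fun x => ∑ i, M i x i) 2 volume := memLp_finsetSum _ fun i _ => hMi i
  have hl : MemLp (lapl w) 2 volume :=
    (continuous_lapl w hw).memLp_of_hasCompactSupport (hasCompactSupport_lapl w hwc)
  have hνc : ∀ i, StronglyMeasurable fun x => ν x i := fun i =>
    (EuclideanSpace.proj i : Euc n →L[ℝ] ℝ).continuous.comp_stronglyMeasurable hνm
  have hDm : ∀ i, StronglyMeasurable (D i) := fun i =>
    (((contDiff_gradient w hw).continuous_fderiv one_ne_zero).clm_apply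
      continuous_const).stronglyMeasurable
  set P : Euc n → ℝ := fun x => ∑ i, ν x i * ⟪ν x, D i x⟫_ℝ with hP
  have hPm : StronglyMeasurable P :=
    Finset.stronglyMeasurable_fun_sum _ fun i _ => (hνc i).mul (hνm.inner (hDm i))
  have hPle : ∀ x, ‖P x‖ ≤ ‖iteratedFDeriv ℝ 2 w x‖ := fun x =>
    abs_sum_mul_inner_fderiv_gradient_le w hw x (ν x) (hν x)
  have hPq : eLpNorm P (ENNReal.ofReal q) volume ≤ ENNReal.ofReal A :=
    (eLpNorm_mono hPle).trans hwA
  have hPL : MemLp P (ENNReal.ofReal q) volume :=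
    ⟨hPm.aestronglyMeasurable, hPq.trans_lt ENNReal.ofReal_lt_top⟩
  set g₀ : Euc n → ℝ := fun x => θ * P x + F x with hg₀
  have hg₀L : MemLp g₀ (ENNReal.ofReal q) volume := (hPL.const_mul θ).add hF
  have hg₀q : eLpNorm g₀ (ENNReal.ofReal q) volume ≤ ENNReal.ofReal Q := by
    refine le_trans ?_ (ENNReal.ofReal_le_ofReal hAB)
    rw [ENNReal.ofReal_add (by positivity) hB, ENNReal.ofReal_mul hθ]
    refine (eLpNorm_add_le (hPL.const_mul θ).1 hF.1 hq1).trans (add_le_add ?_ hFB)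
    have := eLpNorm_const_smul (μ := volume) θ P (ENNReal.ofReal q)
    rw [Real.enorm_of_nonneg hθ] at this
    calc _ = _ := this
      _ ≤ _ := by gcongr
  have key : eLpNorm (fun x => ∑ i, ν x i * ⟪ν x, M i x - D i x⟫_ℝ) 2 volume ≤
      ENNReal.ofReal s := by
    refine le_trans ?_ hws
    refine eLpNorm_two_le_of_sq_le _ _ (fun x => ∑ i, ‖M i x - D i x‖ ^ 2) ?_ ?_ (hT.sub hl)
      (integral_sum_norm_sub_hessian_sq hpos h0 hv hvc hM w hw hwc)
    · exact integrable_finsetSum _ fun i _ =>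
        (memLp_two_iff_integrable_sq_norm ((hM2 i).sub (hD2 i)).1).1 ((hM2 i).sub (hD2 i))
    · intro x
      rw [Real.norm_eq_abs, sq_abs]
      exact sq_sum_mul_inner_le (ν x) (hν x) _
  refine ⟨K.indicator g₀, hg₀L.indicator hKm, fun x hx => indicator_of_notMem hx _,
    (eLpNorm_indicator_le _).trans hg₀q, ?_⟩
  have hM0 : ∀ᵐ x, ∀ i, x ∉ K → M i x = 0 := by
    rw [ae_all_iff]
    intro i
    filter_upwards [hM.ae_eq_zero hpos h0 i] with x hx hxK
    exact hx (mem_univ x) hxK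
  have hbd : eLpNorm (fun x => (∑ i, M i x i) - K.indicator g₀ x) 2 volume ≤
      eLpNorm (fun x => θ * ∑ i, ν x i * ⟪ν x, M i x - D i x⟫_ℝ) 2 volume := by
    refine eLpNorm_mono_ae ?_
    filter_upwards [hM0, htr] with x hx0 hx
    by_cases hxK : x ∈ K
    · rw [indicator_of_mem hxK, hx]
      refine le_of_eq ?_
      congr 1
      simp only [hg₀, hP, inner_sub_right, mul_sub, Finset.sum_sub_distrib]
      ring
    · rw [indicator_of_notMem hxK]
      simp only [hx0 _ hxK, PiLp.zero_apply, Finset.sum_const_zero, sub_zero, norm_zero]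
      exact norm_nonneg _
  refine hbd.trans ?_
  have := eLpNorm_const_smul (μ := volume) θ
    (fun x => ∑ i, ν x i * ⟪ν x, M i x - D i x⟫_ℝ) 2
  rw [Real.enorm_of_nonneg hθ] at this
  rw [ENNReal.ofReal_mul hθ]
  calc _ = _ := this
    _ ≤ _ := by gcongr

end CalderonZygmundPerturbation

/-- Perturbed Calderón–Zygmund estimate: if the Laplacian of `v` differs from an `L^q` function by a
term which is small compared to the full Hessian, then the Hessian of `v` is in `L^q`. -/
theorem memLp_hessian_of_trace_eq (hn : 2 ≤ n) {h : ℕ → ℝ} (hpos : ∀ k, 0 < h k)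
    (h0 : Filter.Tendsto h Filter.atTop (𝓝 0)) {v : Euc n → ℝ} (hv : ContDiff ℝ 1 v)
    (hvc : HasCompactSupport v) {M : Fin n → Euc n → Euc n}
    (hM : IsDQLimit univ h (gradient v) M) (ν : Euc n → Euc n) (hνm : StronglyMeasurable ν)
    (hν : ∀ x, ‖ν x‖ ≤ 1) {q θ C : ℝ} (hq : 2 ≤ q) (hθ : 0 ≤ θ) (hθ1 : θ < 1) (hC : 0 ≤ C)
    (hθC : θ * C < 1)
    (hCZ : ∀ w : Euc n → ℝ, ContDiff ℝ (⊤ : ℕ∞) w → HasCompactSupport w →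
      (∫ x, ‖iteratedFDeriv ℝ 2 w x‖ ^ q) ^ (1 / q) ≤ C * (∫ x, |lapl w x| ^ q) ^ (1 / q))
    (F : Euc n → ℝ) (hF : MemLp F (ENNReal.ofReal q) volume)
    (htr : ∀ᵐ x, ∑ i, M i x i = θ * ∑ i, ν x i * ⟪ν x, M i x⟫_ℝ + F x) (i : Fin n) :
    MemLp (M i) (ENNReal.ofReal q) volume := by
  set B : ℝ := (eLpNorm F (ENNReal.ofReal q) volume).toReal with hB
  have hB0 : 0 ≤ B := ENNReal.toReal_nonneg
  have hFB : eLpNorm F (ENNReal.ofReal q) volume ≤ ENNReal.ofReal B := by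
    rw [hB, ENNReal.ofReal_toReal hF.2.ne]
  have hden : 0 < 1 - θ * C := by linarith
  have hden' : 0 < 1 - θ := by linarith
  set Q : ℝ := (θ * C + B) / (1 - θ * C) with hQ
  have hQ0 : 0 ≤ Q := by positivity
  have hQe : θ * (C * (Q + 1)) + B = Q := by rw [hQ]; field_simp; ring
  set A : ℝ := C * (Q + 1) with hA
  have hA0 : 0 ≤ A := by positivity
  have hM2 : ∀ i, MemLp (M i) 2 volume := fun i =>
    hM.memLp_univ hpos h0 (continuous_gradient v hv) (hasCompactSupport_gradient v hvc) i
  have hMi : ∀ i, MemLp (fun x => M i x i) 2 volume := fun i =>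
    (EuclideanSpace.proj i : Euc n →L[ℝ] ℝ).comp_memLp' (hM2 i)
  have hT : MemLp (fun x => ∑ i, M i x i) 2 volume := memLp_finsetSum _ fun i _ => hMi i
  set r₀ : ℝ := (eLpNorm (fun x => ∑ i, M i x i) 2 volume).toReal with hr₀
  have hr₀0 : 0 ≤ r₀ := ENNReal.toReal_nonneg
  set K := tsupport (gradient v) with hK
  have hKc : IsCompact K := hasCompactSupport_gradient v hvc
  have hw : ∀ δ r : ℝ, 0 < δ → δ ≤ 1 → 0 ≤ r → (∃ g : Euc n → ℝ,
      MemLp g (ENNReal.ofReal q) volume ∧ (∀ x, x ∉ K → g x = 0) ∧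
      eLpNorm g (ENNReal.ofReal q) volume ≤ ENNReal.ofReal Q ∧
      eLpNorm (fun x => (∑ i, M i x i) - g x) 2 volume ≤ ENNReal.ofReal r) →
      ∃ w : Euc n → ℝ, ContDiff ℝ (⊤ : ℕ∞) w ∧ HasCompactSupport w ∧
      eLpNorm (iteratedFDeriv ℝ 2 w) (ENNReal.ofReal q) volume ≤ ENNReal.ofReal A ∧
      eLpNorm (fun x => (∑ i, M i x i) - lapl w x) 2 volume ≤ ENNReal.ofReal (r + δ) := by
    rintro δ r hδ hδ1 hr ⟨g, hg, hgK, hgQ, hgr⟩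
    obtain ⟨w, hw, hwc, hwA, hwr⟩ := hessian_approx_step hn hpos h0 hv hvc hM hq hC hQ0 hδ hr hCZ
      g hg K hKc hgK hgQ hgr
    refine ⟨w, hw, hwc, hwA.trans (ENNReal.ofReal_le_ofReal ?_), hwr⟩
    rw [hA]
    gcongr
  have hiter : ∀ δ : ℝ, 0 < δ → δ ≤ 1 → ∀ k : ℕ, ∃ g : Euc n → ℝ,
      MemLp g (ENNReal.ofReal q) volume ∧ (∀ x, x ∉ K → g x = 0) ∧
      eLpNorm g (ENNReal.ofReal q) volume ≤ ENNReal.ofReal Q ∧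
      eLpNorm (fun x => (∑ i, M i x i) - g x) 2 volume ≤
        ENNReal.ofReal (θ ^ k * r₀ + δ * (θ / (1 - θ))) := by
    intro δ hδ hδ1 k
    induction k with
    | zero =>
      refine ⟨fun _ => 0, MemLp.zero', fun _ _ => rfl, by simp, ?_⟩
      simp only [sub_zero, pow_zero, one_mul]
      calc _ = ENNReal.ofReal r₀ := by rw [hr₀, ENNReal.ofReal_toReal hT.2.ne]
        _ ≤ _ := ENNReal.ofReal_le_ofReal (le_add_of_nonneg_right (by positivity))
    | succ k ih =>
      obtain ⟨w, hw, hwc, hwA, hwr⟩ := hw δ _ hδ hδ1 (by positivity) ih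
      obtain ⟨g, hg, hgK, hgQ, hgr⟩ := hessian_contraction_step hpos h0 hv hvc hM ν hνm hν hq hθ
        hA0 hB0 hQe.le F hF hFB htr w hw hwc hwA hwr
      refine ⟨g, hg, hgK, hgQ, hgr.trans_eq ?_⟩
      congr 1
      field_simp
      ring
  have hex : ∀ m : ℕ, ∃ w : Euc n → ℝ, ContDiff ℝ (⊤ : ℕ∞) w ∧ HasCompactSupport w ∧
      eLpNorm (iteratedFDeriv ℝ 2 w) (ENNReal.ofReal q) volume ≤ ENNReal.ofReal A ∧
      eLpNorm (fun x => (∑ i, M i x i) - lapl w x) 2 volume ≤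
        ENNReal.ofReal ((1 / ((m : ℝ) + 1)) * (1 + θ / (1 - θ) + 1)) := by
    intro m
    have hδ : 0 < 1 / ((m : ℝ) + 1) := by positivity
    have hδ1 : 1 / ((m : ℝ) + 1) ≤ 1 := by
      rw [div_le_one (by positivity)]
      linarith [Nat.cast_nonneg (α := ℝ) m]
    have hlim : Filter.Tendsto (fun k => θ ^ k * r₀) Filter.atTop (𝓝 (0 * r₀)) :=
      (tendsto_pow_atTop_nhds_zero_of_lt_one hθ hθ1).mul_const r₀
    rw [zero_mul] at hlim
    obtain ⟨k, hk⟩ := (hlim.eventually (gt_mem_nhds hδ)).exists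
    obtain ⟨w, hw1, hwc, hwA, hwr⟩ := hw _ _ hδ hδ1 (by positivity) (hiter _ hδ hδ1 k)
    refine ⟨w, hw1, hwc, hwA, hwr.trans (ENNReal.ofReal_le_ofReal ?_)⟩
    linarith
  choose w hw1 hwc hwA hwr using hex
  set D : ℕ → Euc n → Euc n := fun m x =>
    fderiv ℝ (gradient (w m)) x (EuclideanSpace.single i 1) with hD
  have hDL : ∀ m i p, MemLp (fun x => fderiv ℝ (gradient (w m)) x (EuclideanSpace.single i 1)) p
    volume := fun m i p => memLp_hessian (w m) (hw1 m) (hwc m) i p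
  have hlapl : ∀ m, MemLp (lapl (w m)) 2 volume := fun m =>
    (continuous_lapl (w m) (hw1 m)).memLp_of_hasCompactSupport (hasCompactSupport_lapl (w m) (hwc m))
  have hclose : ∀ m, eLpNorm (D m - M i) 2 volume ≤
      ENNReal.ofReal ((1 / ((m : ℝ) + 1)) * (1 + θ / (1 - θ) + 1)) := by
    intro m
    refine le_trans ?_ (hwr m)
    refine eLpNorm_two_le_of_sq_le _ _ (fun x => ∑ j, ‖M j x -
      fderiv ℝ (gradient (w m)) x (EuclideanSpace.single j 1)‖ ^ 2) ?_ ?_ (hT.sub (hlapl m))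
      (integral_sum_norm_sub_hessian_sq hpos h0 hv hvc hM (w m) (hw1 m) (hwc m))
    · exact integrable_finsetSum _ fun j _ =>
        (memLp_two_iff_integrable_sq_norm ((hM2 j).sub (hDL m j 2)).1).1 ((hM2 j).sub (hDL m j 2))
    · intro x
      rw [Pi.sub_apply, norm_sub_rev]
      exact Finset.single_le_sum (f := fun j => ‖M j x -
        fderiv ℝ (gradient (w m)) x (EuclideanSpace.single j 1)‖ ^ 2)
        (fun j _ => sq_nonneg _) (Finset.mem_univ i)
  have hlim : Filter.Tendsto (fun m => eLpNorm (D m - M i) 2 volume) Filter.atTop (𝓝 0) := by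
    refine tendsto_of_tendsto_of_tendsto_of_le_of_le tendsto_const_nhds ?_ (fun _ => zero_le)
      hclose
    have := (tendsto_one_div_add_atTop_nhds_zero_nat (𝕜 := ℝ)).mul_const (1 + θ / (1 - θ) + 1)
    rw [zero_mul] at this
    simpa using ENNReal.tendsto_ofReal this
  have hmeas := tendstoInMeasure_of_tendsto_eLpNorm (by norm_num) (fun m => (hDL m i 2).1)
    (hM2 i).1 hlim
  obtain ⟨ns, -, hns⟩ := hmeas.exists_seq_tendsto_ae
  refine ⟨(hM2 i).1, ?_⟩
  refine (Lp.eLpNorm_lim_le_liminf_eLpNorm (fun k => (hDL (ns k) i 2).1) (M i) hns).trans_lt ?_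
  refine lt_of_le_of_lt (b := ENNReal.ofReal A) ?_ ENNReal.ofReal_lt_top
  refine (Filter.liminf_le_liminf (Filter.Eventually.of_forall fun k =>
    (eLpNorm_mono fun x => norm_fderiv_gradient_single_le (w (ns k)) (hw1 _) x i).trans
      (hwA (ns k)))).trans_eq ?_
  exact Filter.liminf_const _

/-- The infimum defining the Calderón–Zygmund constant is attained, unless `CZ n q = 0`. -/
lemma CZ_pos_and_estimate (q p : ℝ) (hp1 : 2 - 1 / CZ n q < p) (hp2 : p ≤ 2) :
    0 ≤ CZ n q ∧ (2 - p) * CZ n q < 1 ∧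
      ∀ w : Euc n → ℝ, ContDiff ℝ (⊤ : ℕ∞) w → HasCompactSupport w →
        (∫ x, ‖iteratedFDeriv ℝ 2 w x‖ ^ q) ^ (1 / q) ≤
          CZ n q * (∫ x, |lapl w x| ^ q) ^ (1 / q) := by
  set S := {C : ℝ | 0 ≤ C ∧ ∀ w : Euc n → ℝ, ContDiff ℝ (⊤ : ℕ∞) w → HasCompactSupport w →
    (∫ x, ‖iteratedFDeriv ℝ 2 w x‖ ^ q) ^ (1 / q) ≤ C * (∫ x, |lapl w x| ^ q) ^ (1 / q)} with hS
  have hCZ : CZ n q = sInf S := rfl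
  have hne0 : CZ n q ≠ 0 := by
    intro h
    rw [h] at hp1
    norm_num at hp1
    linarith
  have hSne : S.Nonempty := by
    by_contra h
    rw [not_nonempty_iff_eq_empty] at h
    exact hne0 (by rw [hCZ, h, Real.sInf_empty])
  have h0 : 0 ≤ CZ n q := Real.sInf_nonneg fun C hC => hC.1
  have hpos : 0 < CZ n q := lt_of_le_of_ne h0 hne0.symm
  refine ⟨h0, ?_, fun w hw hwc => ?_⟩
  · have : 2 - p < 1 / CZ n q := by linarith
    rwa [lt_div_iff₀ hpos] at this
  · have hb : 0 ≤ (∫ x, |lapl w x| ^ q) ^ (1 / q) :=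
      Real.rpow_nonneg (integral_nonneg fun x => by positivity) _
    rcases hb.eq_or_lt with hb | hb
    · obtain ⟨C, hC⟩ := hSne
      have := hC.2 w hw hwc
      rw [← hb, mul_zero] at this ⊢
      exact this
    · rw [← div_le_iff₀ hb, hCZ]
      exact le_csInf hSne fun C hC => by
        rw [div_le_iff₀ hb]
        exact hC.2 w hw hwc

section LocalHessian

variable {h : ℕ → ℝ} {E : Type*} [NormedAddCommGroup E] [NormedSpace ℝ E]

lemma IsDQLimit.add [ProperSpace E] {Ω : Set (Euc n)} (hpos : ∀ k, 0 < h k)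
    (h0 : Filter.Tendsto h Filter.atTop (𝓝 0))
    {g g' : Euc n → E} {H H' : Fin n → Euc n → E} (hg : IsDQLimit Ω h g H)
    (hg' : IsDQLimit Ω h g' H') {R R' : ℝ} (hR : ∀ x, ‖g x‖ ≤ R) (hR' : ∀ x, ‖g' x‖ ≤ R') :
    IsDQLimit Ω h (fun x => g x + g' x) (fun i x => H i x + H' i x) := by
  have h2 := (hg.prodMk hg').comp h0 hpos (max R R')
    (fun x => by
      rw [Prod.norm_mk]
      exact max_le_max (hR x) (hR' x)) (fun z : E × E => z.1 + z.2)
    (contDiff_fst.add contDiff_snd)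
  convert h2 using 3 with i x
  rw [fderiv_fun_add differentiableAt_fst differentiableAt_snd, fderiv_fst, fderiv_snd]
  rfl

lemma IsDQLimit.smul [ProperSpace E] {Ω : Set (Euc n)} (hpos : ∀ k, 0 < h k)
    (h0 : Filter.Tendsto h Filter.atTop (𝓝 0))
    {a : Euc n → ℝ} {g : Euc n → E} {A : Fin n → Euc n → ℝ} {H : Fin n → Euc n → E}
    (ha : IsDQLimit Ω h a A) (hg : IsDQLimit Ω h g H) {R R' : ℝ} (hR : ∀ x, ‖a x‖ ≤ R)
    (hR' : ∀ x, ‖g x‖ ≤ R') :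
    IsDQLimit Ω h (fun x => a x • g x) (fun i x => a x • H i x + A i x • g x) := by
  have h2 := (ha.prodMk hg).comp h0 hpos (max R R')
    (fun x => by
      rw [Prod.norm_mk]
      exact max_le_max (hR x) (hR' x)) (fun z : ℝ × E => z.1 • z.2)
    (contDiff_fst.smul contDiff_snd)
  convert h2 using 3 with i x
  rw [fderiv_fun_smul differentiableAt_fst differentiableAt_snd, fderiv_fst, fderiv_snd]
  rfl

set_option maxHeartbeats 1000000 in
/-- Local `L^q` integrability of the Hessian of a `p`-harmonic type function for `p` near `2`. -/
theorem memLp_hessian_restrict (hn : 2 ≤ n) (p : ℝ) (hp1 : 1 < p) (hp2 : p ≤ 2)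
    (U : Set (Euc n)) (hU : IsOpen U)
    (hpos : ∀ k, 0 < h k) (h0 : Filter.Tendsto h Filter.atTop (𝓝 0))
    (u f : Euc n → ℝ) (hu : ContDiff ℝ 1 u) (huc : HasCompactSupport u) (hf : Continuous f)
    (H : Fin n → Euc n → Euc n)
    (hH : IsDQLimit U h (gradient u) H) (heq : WeakDiv U (fun x => stress p (gradient u x)) f)
    (hZ : p < 2 → ∀ i, ∀ᵐ x, x ∈ U → gradient u x = 0 → H i x = 0) {q C : ℝ} (hq : 2 ≤ q)
    (hC : 0 ≤ C) (hpC : (2 - p) * C < 1)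
    (hCZ : ∀ w : Euc n → ℝ, ContDiff ℝ (⊤ : ℕ∞) w → HasCompactSupport w →
      (∫ x, ‖iteratedFDeriv ℝ 2 w x‖ ^ q) ^ (1 / q) ≤ C * (∫ x, |lapl w x| ^ q) ^ (1 / q))
    (K : Set (Euc n)) (hK : IsCompact K) (hKU : K ⊆ U) (i : Fin n) :
    MemLp (H i) (ENNReal.ofReal q) (volume.restrict K) := by
  obtain ⟨η, U', hη, hηc, hηs, hη0, hη1, hU'o, hKU', hU'η, hηU'⟩ := exists_cutoff K U hK hU hKU
  have hη1' : ContDiff ℝ 1 η := hη.of_le (by exact_mod_cast le_top)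
  set G := gradient u with hGdef
  have hG : Continuous G := continuous_gradient u hu
  have hGc : HasCompactSupport G := hasCompactSupport_gradient u huc
  have hgη : ContDiff ℝ 1 (gradient η) := contDiff_gradient η hη
  have hgηc : HasCompactSupport (gradient η) := hasCompactSupport_gradient η hηc
  obtain ⟨R₁, hR₁⟩ := hGc.exists_bound_of_continuous hG
  obtain ⟨R₂, hR₂⟩ := hgηc.exists_bound_of_continuous hgη.continuous
  obtain ⟨R₃, hR₃⟩ := huc.exists_bound_of_continuous hu.continuous
  obtain ⟨R₄, hR₄⟩ := hηc.exists_bound_of_continuous hη1'.continuous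
  set v : Euc n → ℝ := fun x => η x * u x with hvdef
  have hv : ContDiff ℝ 1 v := hη1'.mul hu
  have hvc : HasCompactSupport v := hηc.mul_right
  have hgv : gradient v = fun x => η x • G x + u x • gradient η x := by
    funext x
    simp only [hvdef, hGdef, gradient]
    rw [fderiv_fun_mul (hη1'.differentiable one_ne_zero x) (hu.differentiable one_ne_zero x),
      map_add, map_smul, map_smul]
  have hnear : ∀ x, x ∉ tsupport η → η =ᶠ[𝓝 x] fun _ => 0 := fun x hx => by
    filter_upwards [(isClosed_tsupport η).isOpen_compl.mem_nhds hx] with y hy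
    exact image_eq_zero_of_notMem_tsupport hy
  set e : Fin n → Euc n := fun i => EuclideanSpace.single i 1 with he
  set Rm : Fin n → Euc n → Euc n := fun i x =>
    fderiv ℝ η x (e i) • G x + (u x • fderiv ℝ (gradient η) x (e i) +
      fderiv ℝ u x (e i) • gradient η x) with hRm
  set M₀ : Fin n → Euc n → Euc n := fun i x => η x • H i x + Rm i x with hM₀
  have hM₀lim : IsDQLimit U h (gradient v) M₀ := by
    have l1 := (isDQLimit_of_contDiff (Ω := U) hpos h0 η hη1' hηc).smul hpos h0 hH hR₄ hR₁
    have l2 := (isDQLimit_of_contDiff (Ω := U) hpos h0 u hu huc).smul hpos h0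
      (isDQLimit_of_contDiff (Ω := U) hpos h0 _ hgη hgηc) hR₃ hR₂
    have l3 := l1.add hpos h0 (R := R₄ * R₁) (R' := R₃ * R₂) l2 (fun x => by
      rw [norm_smul]
      exact mul_le_mul (hR₄ x) (hR₁ x) (norm_nonneg _) ((norm_nonneg _).trans (hR₄ x)))
      (fun x => by
        rw [norm_smul]
        exact mul_le_mul (hR₃ x) (hR₂ x) (norm_nonneg _) ((norm_nonneg _).trans (hR₃ x)))
    rw [hgv]
    convert l3 using 3 with i x
    simp only [hM₀, hRm, he, hGdef, add_assoc]
  have hgvs : tsupport (gradient v) ⊆ tsupport η := by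
    refine closure_minimal (fun x hx => ?_) (isClosed_tsupport η)
    by_contra h
    refine hx ?_
    have h1 : η x = 0 := image_eq_zero_of_notMem_tsupport h
    have h2 : gradient η x = 0 := by
      unfold gradient
      rw [(hnear x h).fderiv_eq]
      simp
    rw [hgv]
    simp [h1, h2]
  have hgvc := hasCompactSupport_gradient v hvc
  set M : Fin n → Euc n → Euc n := fun i => (tsupport (gradient v)).indicator (M₀ i) with hM
  have hMlim : IsDQLimit univ h (gradient v) M := hM₀lim.extend h0 hU hgvc (hgvs.trans hηs)
  have hMM : ∀ᵐ x, ∀ i, x ∈ U → M i x = M₀ i x := by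
    rw [ae_all_iff]
    intro i
    filter_upwards [hM₀lim.ae_eq_zero hpos h0 i] with x hx hxU
    by_cases hxs : x ∈ tsupport (gradient v)
    · exact indicator_of_mem hxs _
    · rw [hx hxU hxs]; exact indicator_of_notMem hxs _
  have hRc : ∀ i, Continuous (Rm i) := fun i => by
    have := hη1'.continuous_fderiv one_ne_zero
    have := hgη.continuous_fderiv one_ne_zero
    have := hu.continuous_fderiv one_ne_zero
    have := hgη.continuous
    have := hu.continuous
    simp only [hRm]
    fun_prop
  have hR0 : ∀ i x, x ∉ tsupport η → Rm i x = 0 := fun i x hx => by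
    have h1 : gradient η =ᶠ[𝓝 x] fun _ => 0 := by
      filter_upwards [(hnear x hx).eventuallyEq_nhds] with y hy
      unfold gradient
      rw [hy.fderiv_eq]
      simp
    simp only [hRm, (hnear x hx).fderiv_eq, h1.fderiv_eq, h1.eq_of_nhds]
    simp
  have hRs : ∀ i, HasCompactSupport (Rm i) := fun i =>
    HasCompactSupport.intro hηc.isCompact fun x hx => hR0 i x hx
  have hRL : ∀ i, MemLp (Rm i) (ENNReal.ofReal q) volume := fun i =>
    (hRc i).memLp_of_hasCompactSupport (hRs i)
  set ν : Euc n → Euc n := fun x => ‖G x‖⁻¹ • G x with hν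
  have hνm : StronglyMeasurable ν :=
    (hG.norm.measurable.inv.stronglyMeasurable).smul hG.stronglyMeasurable
  have hν1 : ∀ x, ‖ν x‖ ≤ 1 := fun x => by
    rw [hν]
    simp only [norm_smul, norm_inv, norm_norm]
    exact inv_mul_le_one
  have hνc : ∀ i, StronglyMeasurable fun x => ν x i := fun i =>
    (EuclideanSpace.proj i : Euc n →L[ℝ] ℝ).continuous.comp_stronglyMeasurable hνm
  set F : Euc n → ℝ := fun x => (∑ i, Rm i x i) - (2 - p) * (∑ i, ν x i * ⟪ν x, Rm i x⟫_ℝ) -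
    η x * (f x * ‖G x‖ ^ (2 - p)) with hF
  have hFL : MemLp F (ENNReal.ofReal q) volume := by
    have m1 : MemLp (fun x => ∑ i, Rm i x i) (ENNReal.ofReal q) volume :=
      memLp_finsetSum _ fun i _ => (EuclideanSpace.proj i : Euc n →L[ℝ] ℝ).comp_memLp' (hRL i)
    have m2 : MemLp (fun x => ∑ i, ν x i * ⟪ν x, Rm i x⟫_ℝ) (ENNReal.ofReal q) volume := by
      refine memLp_finsetSum _ fun i _ => ?_
      refine (hRL i).of_le
        ((hνc i).mul (hνm.inner (hRc i).stronglyMeasurable)).aestronglyMeasurable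
        (Filter.Eventually.of_forall fun x => ?_)
      rw [norm_mul]
      calc ‖ν x i‖ * ‖⟪ν x, Rm i x⟫_ℝ‖ ≤ 1 * (1 * ‖Rm i x‖) := by
            gcongr
            · exact (PiLp.norm_apply_le (ν x) i).trans (hν1 x)
            · exact (norm_inner_le_norm _ _).trans (by gcongr; exact hν1 x)
        _ = _ := by ring
    have m3 : MemLp (fun x => η x * (f x * ‖G x‖ ^ (2 - p))) (ENNReal.ofReal q) volume := by
      refine Continuous.memLp_of_hasCompactSupport ?_ hηc.mul_right
      exact hη1'.continuous.mul (hf.mul (hG.norm.rpow_const fun _ => Or.inr (by linarith)))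
    exact (m1.sub (m2.const_mul (2 - p))).sub m3
  have htr : ∀ᵐ x, ∑ i, M i x i = (2 - p) * ∑ i, ν x i * ⟪ν x, M i x⟫_ℝ + F x := by
    filter_upwards [ae_trace_eq p hp2 U hU h hpos h0 G f hf hG hGc H hH heq hZ, hMM] with x hx hxM
    by_cases hxU : x ∈ U
    · have h1 := hx hxU
      simp only [hxM _ hxU, hM₀, hF, PiLp.add_apply, PiLp.smul_apply, inner_add_right,
        inner_smul_right, Finset.sum_add_distrib, mul_add, smul_eq_mul]
      have h2 : ∑ i, ν x i * (η x * ⟪ν x, H i x⟫_ℝ) = η x * ∑ i, ν x i * ⟪ν x, H i x⟫_ℝ := by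
        rw [Finset.mul_sum]
        exact Finset.sum_congr rfl fun i _ => by ring
      rw [h2, ← Finset.mul_sum, h1]
      ring
    · have hxη : x ∉ tsupport η := fun h => hxU (hηs h)
      have h1 : ∀ i, M i x = 0 := fun i => indicator_of_notMem (fun h => hxη (hgvs h)) _
      have h2 : η x = 0 := image_eq_zero_of_notMem_tsupport hxη
      simp [h1, hF, h2, hR0 _ x hxη]
  have hfin := memLp_hessian_of_trace_eq hn hpos h0 hv hvc hMlim ν hνm hν1 hq (by linarith)
    (by linarith) hC hpC hCZ F hFL htr i
  refine (hfin.restrict K).ae_eq ?_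
  filter_upwards [ae_restrict_of_ae hMM, ae_restrict_mem hK.measurableSet] with x hx hxK
  have h1 : η =ᶠ[𝓝 x] fun _ => 1 := by
    filter_upwards [hU'o.mem_nhds (hKU' hxK)] with y hy using hηU' y hy
  have h2 : gradient η =ᶠ[𝓝 x] fun _ => 0 := by
    filter_upwards [h1.eventuallyEq_nhds] with y hy
    unfold gradient
    rw [hy.fderiv_eq]
    simp
  rw [hx i (hKU hxK)]
  simp only [hM₀, hRm, h1.fderiv_eq, h2.fderiv_eq, h1.eq_of_nhds, h2.eq_of_nhds]
  simp

end LocalHessian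

lemma sq_rpow_half {t : ℝ} (ht : 0 ≤ t) (s : ℝ) : (t ^ 2) ^ (s / 2) = t ^ s := by
  rw [← Real.rpow_natCast, ← Real.rpow_mul ht]
  congr 1
  push_cast
  ring

lemma eventually_two_mul_sq_lt {t : ℝ} (ht : 0 < t) :
    ∀ᶠ m : ℕ in Filter.atTop, 2 * (1 / ((m : ℝ) + 1)) ^ 2 < t := by
  have h := ((tendsto_one_div_add_atTop_nhds_zero_nat (𝕜 := ℝ)).pow 2).const_mul 2
  rw [zero_pow two_ne_zero, mul_zero] at h
  exact h.eventually (gt_mem_nhds ht)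

lemma tendsto_cutField (s : ℝ) (z : Euc n) :
    Filter.Tendsto (fun m : ℕ => cutField (1 / ((m : ℝ) + 1)) s z) Filter.atTop
      (𝓝 (‖z‖ ^ s • z)) := by
  rcases eq_or_ne z 0 with rfl | hz
  · simp [cutField]
  · have hz' : 0 < ‖z‖ ^ 2 := by positivity
    refine tendsto_const_nhds.congr' ?_
    filter_upwards [eventually_two_mul_sq_lt hz'] with m hm
    rw [cutField, cutPow_eq _ _ _ (by positivity) hm.le, sq_rpow_half (norm_nonneg _)]

lemma tendsto_fderiv_cutField (s : ℝ) (z w : Euc n) (h : z = 0 → w = 0) :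
    Filter.Tendsto (fun m : ℕ => fderiv ℝ (cutField (1 / ((m : ℝ) + 1)) s) z w) Filter.atTop
      (𝓝 (‖z‖ ^ s • w + (s * ‖z‖ ^ (s - 2) * ⟪z, w⟫_ℝ) • z)) := by
  rcases eq_or_ne z 0 with hz | hz
  · simp [h hz, hz]
  · have hz' : 0 < ‖z‖ ^ 2 := by positivity
    refine tendsto_const_nhds.congr' ?_
    filter_upwards [eventually_two_mul_sq_lt hz'] with m hm
    have hε : 0 < 1 / ((m : ℝ) + 1) := by positivity
    rw [fderiv_cutField _ _ hε, cutPow_eq _ _ _ hε hm.le, sq_rpow_half (norm_nonneg _)]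
    have h1 : cutPow (1 / ((m : ℝ) + 1)) s =ᶠ[𝓝 (‖z‖ ^ 2)] fun t => t ^ (s / 2) := by
      filter_upwards [lt_mem_nhds hm] with t ht
      exact cutPow_eq _ _ _ hε ht.le
    rw [h1.deriv_eq, (Real.hasDerivAt_rpow_const (Or.inl hz'.ne')).deriv,
      show s / 2 - 1 = (s - 2) / 2 by ring, sq_rpow_half (norm_nonneg _)]
    congr 2
    ring

lemma exists_bound_fderiv_cutField (s : ℝ) : ∃ C, 0 ≤ C ∧ ∀ (ε : ℝ) (z w : Euc n), 0 < ε →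
    ‖fderiv ℝ (cutField ε s) z w‖ ≤ C * (‖z‖ ^ s * ‖w‖) := by
  obtain ⟨C, hC, hb⟩ := exists_bound_deriv_cutPow s
  refine ⟨1 + C, by positivity, fun ε z w hε => ?_⟩
  have h1 := hb ε (‖z‖ ^ 2) hε (sq_nonneg _)
  have h2 := cutPow_le ε s (‖z‖ ^ 2) (sq_nonneg _)
  rw [sq_rpow_half (norm_nonneg _)] at h1 h2
  have h3 := cutPow_nonneg ε s (‖z‖ ^ 2) hε
  rw [fderiv_cutField ε s hε, add_mul, one_mul]
  refine (norm_add_le _ _).trans (add_le_add ?_ ?_)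
  · rw [norm_smul, Real.norm_of_nonneg h3]
    gcongr
  · rw [norm_smul, norm_mul]
    calc ‖2 * deriv (cutPow ε s) (‖z‖ ^ 2)‖ * ‖⟪z, w⟫_ℝ‖ * ‖z‖
        ≤ ‖2 * deriv (cutPow ε s) (‖z‖ ^ 2)‖ * (‖z‖ * ‖w‖) * ‖z‖ := by
          gcongr
          exact norm_inner_le_norm _ _
      _ = |2 * deriv (cutPow ε s) (‖z‖ ^ 2) * ‖z‖ ^ 2| * ‖w‖ := by
          rw [abs_mul, abs_of_nonneg (sq_nonneg ‖z‖), Real.norm_eq_abs]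
          ring
      _ ≤ C * ‖z‖ ^ s * ‖w‖ := by gcongr
      _ = _ := by ring

/-- The derivative of `z ↦ ‖z‖ ^ (p - 2) • z` at `z` in direction `w`. -/
def stressDeriv (p : ℝ) (z w : Euc n) : Euc n :=
  ‖z‖ ^ (p - 2) • w + ((p - 2) * ‖z‖ ^ (p - 2 - 2) * ⟪z, w⟫_ℝ) • z

lemma norm_stressDeriv_le (p : ℝ) (hp1 : 1 < p) (hp2 : p ≤ 2) (z w : Euc n) :
    ‖stressDeriv p z w‖ ≤ 2 * (‖z‖ ^ (p - 2) * ‖w‖) := by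
  rw [two_mul, stressDeriv]
  refine (norm_add_le _ _).trans (add_le_add ?_ ?_)
  · rw [norm_smul, Real.norm_of_nonneg (by positivity)]
  · rcases eq_or_ne z 0 with rfl | hz
    · rw [smul_zero, norm_zero]; positivity
    have hz' : 0 < ‖z‖ := norm_pos_iff.2 hz
    rw [norm_smul, norm_mul, norm_mul, Real.norm_of_nonneg (r := ‖z‖ ^ (p - 2 - 2)) (by positivity)]
    have h1 : ‖p - 2‖ ≤ 1 := by rw [Real.norm_eq_abs, abs_le]; constructor <;> linarith
    have h2 : ‖z‖ ^ (p - 2 - 2) * ‖z‖ ^ 2 = ‖z‖ ^ (p - 2) := by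
      rw [← Real.rpow_natCast, ← Real.rpow_add hz']
      congr 1
      push_cast
      ring
    calc ‖p - 2‖ * ‖z‖ ^ (p - 2 - 2) * ‖⟪z, w⟫_ℝ‖ * ‖z‖
        ≤ 1 * ‖z‖ ^ (p - 2 - 2) * (‖z‖ * ‖w‖) * ‖z‖ := by
          gcongr
          exact norm_inner_le_norm _ _
      _ = (‖z‖ ^ (p - 2 - 2) * ‖z‖ ^ 2) * ‖w‖ := by ring
      _ = _ := by rw [h2]

lemma measurable_stressDeriv (p : ℝ) {z w : Euc n → Euc n} (hz : StronglyMeasurable z)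
    (hw : StronglyMeasurable w) : StronglyMeasurable fun x => stressDeriv p (z x) (w x) := by
  unfold stressDeriv
  have h1 : StronglyMeasurable fun x => ‖z x‖ ^ (p - 2) :=
    (hz.norm.measurable.pow_const _).stronglyMeasurable
  have h2 : StronglyMeasurable fun x => (p - 2) * ‖z x‖ ^ (p - 2 - 2) * ⟪z x, w x⟫_ℝ :=
    ((hz.norm.measurable.pow_const _).stronglyMeasurable.const_mul _).mul (hz.inner hw)
  exact (h1.smul hw).add (h2.smul hz)

/-- The weak derivative of the stress field. -/
theorem integral_stress_mul_fderiv (p : ℝ) (hp1 : 1 < p) (hp2 : p ≤ 2) (U : Set (Euc n))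
    {h : ℕ → ℝ} (hpos : ∀ k, 0 < h k)
    (h0 : Filter.Tendsto h Filter.atTop (𝓝 0)) (G : Euc n → Euc n) (hG : Continuous G)
    (hGc : HasCompactSupport G) (H : Fin n → Euc n → Euc n) (hHm : ∀ i, StronglyMeasurable (H i))
    (hH : IsDQLimit U h G H) (hZ : p < 2 → ∀ i, ∀ᵐ x, x ∈ U → G x = 0 → H i x = 0)
    (i j : Fin n) (hI : ∀ K, IsCompact K → K ⊆ U →
      IntegrableOn (fun x => ‖G x‖ ^ (p - 2) * ‖H i x‖) K volume)
    (ψ : Euc n → ℝ) (hψ : ContDiff ℝ 1 ψ) (hψc : HasCompactSupport ψ) (hψs : tsupport ψ ⊆ U) :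
    ∫ x, (stress p (G x)) j * fderiv ℝ ψ x (EuclideanSpace.single i 1) =
      - ∫ x, (stressDeriv p (G x) (H i x)) j * ψ x := by
  obtain ⟨R, hR⟩ := hGc.exists_bound_of_continuous hG
  rcases hp2.eq_or_lt with rfl | hp
  · have := (hH.coord h0 hpos R hR j).integral_mul_fderiv hpos h0 (by fun_prop) ψ hψ hψc hψs i
    simpa [stress, stressDeriv] using this
  set e : Euc n := EuclideanSpace.single i 1 with he
  have hψ' : Continuous fun x => fderiv ℝ ψ x e :=
    (hψ.continuous_fderiv one_ne_zero).clm_apply continuous_const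
  have hψ'c : HasCompactSupport fun x => fderiv ℝ ψ x e :=
    (hψc.fderiv ℝ).mono fun x hx h0 => hx (by simp [h0])
  have hproj : ∀ z : Euc n, ‖z j‖ ≤ ‖z‖ := fun z => PiLp.norm_apply_le z j
  have hcont : ∀ m : ℕ, Continuous fun x => cutField (1 / ((m : ℝ) + 1)) (p - 2) (G x) := fun m =>
    (contDiff_cutField _ _ (by positivity)).continuous.comp hG
  have hbR : ∀ (m : ℕ) x, ‖cutField (1 / ((m : ℝ) + 1)) (p - 2) (G x)‖ ≤ ‖stress p (G x)‖ := by
    intro m x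
    rw [cutField, stress, norm_smul, norm_smul, Real.norm_of_nonneg
      (cutPow_nonneg _ _ _ (by positivity)), Real.norm_of_nonneg (by positivity)]
    gcongr
    exact (cutPow_le _ _ _ (sq_nonneg _)).trans_eq (sq_rpow_half (norm_nonneg _) _)
  have hsc : Continuous fun x => stress p (G x) := (continuous_stress p hp1).comp hG
  have hsR : ∀ x, ‖stress p (G x)‖ ≤ R ^ (p - 1) := fun x => by
    rw [norm_stress p hp1.ne']
    exact Real.rpow_le_rpow (norm_nonneg _) (hR x) (by linarith)
  have hm : ∀ m : ℕ, ∫ x, (cutField (1 / ((m : ℝ) + 1)) (p - 2) (G x)) j * fderiv ℝ ψ x e =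
      - ∫ x, (fderiv ℝ (cutField (1 / ((m : ℝ) + 1)) (p - 2)) (G x) (H i x)) j * ψ x := by
    intro m
    have l1 := hH.comp h0 hpos R hR _
      (contDiff_cutField (n := n) (1 / ((m : ℝ) + 1)) (p - 2) (by positivity))
    have hc := hcont m
    exact (l1.coord h0 hpos _ (fun x => (hbR m x).trans (hsR x)) j).integral_mul_fderiv hpos h0
      ((EuclideanSpace.proj (𝕜 := ℝ) j).continuous.comp hc) ψ hψ hψc hψs i
  obtain ⟨C, hC, hCb⟩ := exists_bound_fderiv_cutField (n := n) (p - 2)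
  have lim1 : Filter.Tendsto (fun m : ℕ =>
      ∫ x, (cutField (1 / ((m : ℝ) + 1)) (p - 2) (G x)) j * fderiv ℝ ψ x e) Filter.atTop
      (𝓝 (∫ x, (stress p (G x)) j * fderiv ℝ ψ x e)) := by
    refine tendsto_integral_of_dominated_convergence
      (fun x => ‖stress p (G x)‖ * ‖fderiv ℝ ψ x e‖) ?_ ?_ ?_ ?_
    · intro m
      have hc := hcont m
      exact (((EuclideanSpace.proj (𝕜 := ℝ) j).continuous.comp hc).mul hψ').aestronglyMeasurable
    · exact (hsc.norm.mul hψ'.norm).integrable_of_hasCompactSupport hψ'c.norm.mul_left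
    · intro m
      refine Filter.Eventually.of_forall fun x => ?_
      rw [norm_mul]
      gcongr
      exact (hproj _).trans (hbR m x)
    · refine Filter.Eventually.of_forall fun x => Filter.Tendsto.mul_const _ ?_
      exact ((EuclideanSpace.proj (𝕜 := ℝ) j).continuous.tendsto _).comp
        (tendsto_cutField (p - 2) (G x))
  have lim2 : Filter.Tendsto (fun m : ℕ =>
      ∫ x, (fderiv ℝ (cutField (1 / ((m : ℝ) + 1)) (p - 2)) (G x) (H i x)) j * ψ x) Filter.atTop
      (𝓝 (∫ x, (stressDeriv p (G x) (H i x)) j * ψ x)) := by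
    have hGm : StronglyMeasurable G := hG.stronglyMeasurable
    obtain ⟨B, hB⟩ := hψc.exists_bound_of_continuous hψ.continuous
    have hB0 : 0 ≤ B := (norm_nonneg _).trans (hB 0)
    refine tendsto_integral_of_dominated_convergence
      ((tsupport ψ).indicator fun x => C * (‖G x‖ ^ (p - 2) * ‖H i x‖) * B) ?_ ?_ ?_ ?_
    · intro m
      have h1 : StronglyMeasurable fun x =>
          fderiv ℝ (cutField (1 / ((m : ℝ) + 1)) (p - 2)) (G x) (H i x) :=
        isBoundedBilinearMap_apply.continuous.comp_stronglyMeasurable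
          (((((contDiff_cutField (n := n) (1 / ((m : ℝ) + 1)) (p - 2)
          (by positivity)).continuous_fderiv one_ne_zero).comp hG).stronglyMeasurable).prodMk
          (hHm i))
      exact (((EuclideanSpace.proj (𝕜 := ℝ) j).continuous.comp_stronglyMeasurable h1).mul
        hψ.continuous.stronglyMeasurable).aestronglyMeasurable
    · rw [integrable_indicator_iff (isClosed_tsupport ψ).measurableSet]
      exact ((hI _ hψc.isCompact hψs).const_mul C).mul_const B
    · intro m
      refine Filter.Eventually.of_forall fun x => ?_
      by_cases hx : x ∈ tsupport ψ
      · rw [indicator_of_mem hx, norm_mul]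
        have := hCb (1 / ((m : ℝ) + 1)) (G x) (H i x) (by positivity)
        gcongr
        · exact (hproj _).trans this
        · exact hB x
      · rw [indicator_of_notMem hx, image_eq_zero_of_notMem_tsupport hx]
        simp
    · filter_upwards [hZ hp i] with x hx
      by_cases hxs : x ∈ tsupport ψ
      · refine Filter.Tendsto.mul_const _ ?_
        exact ((EuclideanSpace.proj (𝕜 := ℝ) j).continuous.tendsto _).comp
          (tendsto_fderiv_cutField (p - 2) (G x) (H i x) (hx (hψs hxs)))
      · simp [image_eq_zero_of_notMem_tsupport hxs]
  exact tendsto_nhds_unique lim1 (lim2.neg.congr fun m => (hm m).symm)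

lemma rpow_mul_rpow_le (p α g t : ℝ) (hα : 3 ≤ α) (hg : 0 ≤ g) (ht : 0 ≤ t)
    (h0 : p < 2 → g = 0 → t = 0) (hp2 : p ≤ 2) :
    (g ^ (p - 2) * t) ^ α ≤
      g ^ (-((2 - p) * (2 * α - 1))) * (g ^ (p - 2) * t ^ 2) + t ^ (2 * (α - 1)) := by
  rcases ht.eq_or_lt with rfl | ht
  · rw [mul_zero, Real.zero_rpow (by linarith)]
    positivity
  have h1 : g ^ (-((2 - p) * (2 * α - 1))) * g ^ (p - 2) = (g ^ (α * (p - 2))) ^ 2 := by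
    rcases hp2.lt_or_eq with hp | rfl
    · have hg' : 0 < g := hg.lt_of_ne fun h => ht.ne' (h0 hp h.symm)
      rw [← Real.rpow_add hg', ← Real.rpow_natCast, ← Real.rpow_mul hg]
      congr 1
      push_cast
      ring
    · simp
  have h2 : t ^ (2 * (α - 1)) = (t ^ (α - 1)) ^ 2 := by
    rw [← Real.rpow_natCast, ← Real.rpow_mul ht.le, mul_comm]
    norm_num
  have h3 : (g ^ (p - 2) * t) ^ α = (g ^ (α * (p - 2)) * t) * t ^ (α - 1) := by
    rw [Real.mul_rpow (by positivity) ht.le, ← Real.rpow_mul hg, mul_comm (p - 2), mul_assoc]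
    congr 1
    rw [Real.rpow_sub_one ht.ne']
    field_simp
  rw [h2, h3, ← mul_assoc, h1]
  nlinarith [sq_nonneg (g ^ (α * (p - 2)) * t - t ^ (α - 1)),
    sq_nonneg (g ^ (α * (p - 2)) * t + t ^ (α - 1))]

lemma le_one_add_rpow {t α : ℝ} (ht : 0 ≤ t) (hα : 1 ≤ α) : t ≤ 1 + t ^ α := by
  rcases le_total t 1 with h | h
  · have := Real.rpow_nonneg ht α
    linarith
  · have := Real.self_le_rpow_of_one_le h hα
    linarith

theorem exists_weak_derivative_stress (hn : 2 ≤ n) (p α : ℝ) (hα : 3 ≤ α)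
    (hp1 : max (2 - 1 / (2 * α - 1)) (2 - 1 / CZ n (2 * (α - 1))) < p) (hp2 : p ≤ 2)
    (Ω : Set (Euc n)) (hΩ : IsOpen Ω) (u f : Euc n → ℝ) (hu : ContDiff ℝ 1 u)
    (huc : HasCompactSupport u) (hf : ContDiff ℝ 1 f) (hfc : HasCompactSupport f)
    (heq : WeakDiv Ω (fun x => stress p (gradient u x)) f) (K : Set (Euc n)) (hK : IsCompact K)
    (hKΩ : K ⊆ Ω) :
    ∃ U, IsOpen U ∧ K ⊆ U ∧ U ⊆ Ω ∧ ∃ D : Fin n → Euc n → Euc n,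
      (∀ i j (ψ : Euc n → ℝ), ContDiff ℝ 1 ψ → HasCompactSupport ψ → tsupport ψ ⊆ U →
        ∫ x, (stress p (gradient u x)) j * fderiv ℝ ψ x (EuclideanSpace.single i 1) =
          - ∫ x, D i x j * ψ x) ∧
      ∀ i j L, IsCompact L → L ⊆ U →
        IntegrableOn (fun x => D i x j) L volume ∧
        IntegrableOn (fun x => |D i x j| ^ α) L volume := by
  obtain ⟨hpα, hpC⟩ := max_lt_iff.1 hp1
  have h2α : 0 < 2 * α - 1 := by linarith
  have hγ1 : (2 - p) * (2 * α - 1) < 1 := by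
    have : 2 - p < 1 / (2 * α - 1) := by linarith
    rwa [lt_div_iff₀ h2α] at this
  have hγ0 : 0 ≤ (2 - p) * (2 * α - 1) := mul_nonneg (by linarith) h2α.le
  have hp : 1 < p := by nlinarith
  obtain ⟨hC0, hC1, hCZ⟩ := CZ_pos_and_estimate (n := n) (2 * (α - 1)) p hpC hp2
  obtain ⟨U, hU, hKU, hUΩ, h, hpos, h0, H, hHm, hH, hZ⟩ :=
    exists_isDQLimit_gradient p hp hp2 Ω hΩ u f hu huc hf hfc heq K hK hKΩ
  have heqU : WeakDiv U (fun x => stress p (gradient u x)) f :=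
    fun ψ h1 h2 h3 => heq ψ h1 h2 (h3.trans hUΩ)
  set G := gradient u with hGdef
  have hG : Continuous G := continuous_gradient u hu
  have hGc : HasCompactSupport G := hasCompactSupport_gradient u huc
  have hFm : ∀ i, StronglyMeasurable fun x => ‖G x‖ ^ (p - 2) * ‖H i x‖ := fun i =>
    (hG.stronglyMeasurable.norm.measurable.pow_const _).stronglyMeasurable.mul (hHm i).norm
  have hDm : ∀ i j, StronglyMeasurable fun x => (stressDeriv p (G x) (H i x)) j := fun i j =>
    (EuclideanSpace.proj (𝕜 := ℝ) j).continuous.comp_stronglyMeasurable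
      (measurable_stressDeriv p hG.stronglyMeasurable (hHm i))
  have hint : ∀ i L, IsCompact L → L ⊆ U →
      IntegrableOn (fun x => (‖G x‖ ^ (p - 2) * ‖H i x‖) ^ α) L volume := by
    intro i L hL hLU
    have h2 : IntegrableOn (fun x => ‖H i x‖ ^ (2 * (α - 1))) L volume := by
      have := (memLp_hessian_restrict hn p hp hp2 U hU hpos h0 u f hu huc hf.continuous H hH heqU hZ
        (q := 2 * (α - 1)) (by linarith) hC0 hC1 hCZ L hL hLU i).integrable_norm_rpow
        (by rw [Ne, ENNReal.ofReal_eq_zero, not_le]; linarith) ENNReal.ofReal_ne_top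
      rwa [ENNReal.toReal_ofReal (by linarith)] at this
    have hmeas : StronglyMeasurable fun x => (‖G x‖ ^ (p - 2) * ‖H i x‖) ^ α :=
      ((hFm i).measurable.pow_const _).stronglyMeasurable
    have h1 : IntegrableOn (fun x => ‖G x‖ ^ (-((2 - p) * (2 * α - 1))) *
        (‖G x‖ ^ (p - 2) * ‖H i x‖ ^ 2)) L volume ∧
        ∀ᵐ x, x ∈ U → p < 2 → ‖G x‖ = 0 → ‖H i x‖ = 0 := by
      rcases hp2.lt_or_eq with hp' | rfl
      · refine ⟨?_, ?_⟩
        · refine (weighted_estimate p _ hp hp2 hγ0 hγ1 U hU h hpos h0 u f hu huc hf hfc H hHm hH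
            heqU (hZ hp') L hL hLU).mono' ?_ (Filter.Eventually.of_forall fun x => ?_)
          · exact ((hG.stronglyMeasurable.norm.measurable.pow_const _).mul
              ((hG.stronglyMeasurable.norm.measurable.pow_const _).mul
              ((hHm i).norm.measurable.pow_const 2))).aestronglyMeasurable
          · rw [Real.norm_of_nonneg (by positivity)]
            gcongr
            exact Finset.single_le_sum (f := fun i => ‖H i x‖ ^ 2) (fun _ _ => by positivity)
              (Finset.mem_univ i)
        · filter_upwards [hZ hp' i] with x hx hxU _ hG0
          rw [hx hxU (norm_eq_zero.1 hG0), norm_zero]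
      · refine ⟨?_, Filter.Eventually.of_forall fun x _ h => absurd h (lt_irrefl _)⟩
        have := hH.memLp hG L hL hLU i
        simpa [IntegrableOn] using (memLp_two_iff_integrable_sq_norm this.1).1 this
    refine (h1.1.add h2).mono' hmeas.aestronglyMeasurable ?_
    filter_upwards [ae_restrict_of_ae h1.2, ae_restrict_mem hL.measurableSet] with x hx hxL
    rw [Real.norm_of_nonneg (by positivity)]
    exact rpow_mul_rpow_le p α _ _ hα (norm_nonneg _) (norm_nonneg _) (hx (hLU hxL)) hp2
  have hint1 : ∀ i L, IsCompact L → L ⊆ U →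
      IntegrableOn (fun x => ‖G x‖ ^ (p - 2) * ‖H i x‖) L volume := by
    intro i L hL hLU
    refine (((integrableOn_const (μ := volume) (C := (1 : ℝ)) hL.measure_lt_top.ne)).add
      (hint i L hL hLU)).mono' (hFm i).aestronglyMeasurable (Filter.Eventually.of_forall fun x => ?_)
    rw [Real.norm_of_nonneg (by positivity)]
    exact le_one_add_rpow (by positivity) (by linarith)
  have hDle : ∀ i j x, |(stressDeriv p (G x) (H i x)) j| ≤ 2 * (‖G x‖ ^ (p - 2) * ‖H i x‖) :=
    fun i j x => (PiLp.norm_apply_le (stressDeriv p (G x) (H i x)) j).trans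
      (norm_stressDeriv_le p hp hp2 _ _)
  refine ⟨U, hU, hKU, hUΩ, fun i x => stressDeriv p (G x) (H i x), fun i j ψ hψ hψc hψs => ?_,
    fun i j L hL hLU => ⟨?_, ?_⟩⟩
  · exact integral_stress_mul_fderiv p hp hp2 U hpos h0 G hG hGc H hHm hH hZ i j
      (fun L hL hLU => hint1 i L hL hLU) ψ hψ hψc hψs
  · exact ((hint1 i L hL hLU).const_mul 2).mono' (hDm i j).aestronglyMeasurable
      (Filter.Eventually.of_forall fun x => hDle i j x)
  · refine ((hint i L hL hLU).const_mul (2 ^ α)).mono'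
      ((hDm i j).norm.measurable.pow_const α).aestronglyMeasurable
      (Filter.Eventually.of_forall fun x => ?_)
    rw [Real.norm_of_nonneg (by positivity), ← Real.mul_rpow (by positivity) (by positivity)]
    exact Real.rpow_le_rpow (abs_nonneg _) (hDle i j x) (by linarith)

lemma C1Loc.continuousOn_gradient {Ω : Set (Euc n)} (hΩ : IsOpen Ω) {β : ℝ≥0} (hβ : 0 < β)
    {u : Euc n → ℝ} (hu : C1Loc Ω β u) : ContinuousOn (gradient u) Ω := by
  intro x hx
  obtain ⟨K, hK, hxK, hKΩ⟩ := exists_compact_subset hΩ hx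
  obtain ⟨C, hC⟩ := hu.2 K hKΩ hK
  exact ((hC.continuousOn hβ).continuousAt (mem_interior_iff_mem_nhds.1 hxK)).continuousWithinAt

lemma C1Loc.contDiffOn {Ω : Set (Euc n)} (hΩ : IsOpen Ω) {β : ℝ≥0} (hβ : 0 < β)
    {u : Euc n → ℝ} (hu : C1Loc Ω β u) : ContDiffOn ℝ 1 u Ω := by
  rw [show (1 : WithTop ℕ∞) = 0 + 1 by norm_num, contDiffOn_succ_iff_fderiv_of_isOpen hΩ]
  refine ⟨fun x hx => (hu.1 x hx).differentiableWithinAt, by simp, ?_⟩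
  rw [contDiffOn_zero]
  have h : fderiv ℝ u = fun x => InnerProductSpace.toDual ℝ (Euc n) (gradient u x) := by
    ext1 x
    simp [gradient]
  rw [h]
  exact (InnerProductSpace.toDual ℝ (Euc n)).continuous.comp_continuousOn
    (hu.continuousOn_gradient hΩ hβ)

lemma contDiff_mul_of_tsupport_subset {Ω : Set (Euc n)} (hΩ : IsOpen Ω) {η u : Euc n → ℝ}
    (hη : ContDiff ℝ 1 η) (hηs : tsupport η ⊆ Ω) (hu : ContDiffOn ℝ 1 u Ω) :
    ContDiff ℝ 1 fun x => η x * u x := by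
  rw [contDiff_iff_contDiffAt]
  intro x
  by_cases hx : x ∈ tsupport η
  · exact hη.contDiffAt.mul (hu.contDiffAt (hΩ.mem_nhds (hηs hx)))
  · refine (contDiffAt_const (c := (0 : ℝ))).congr_of_eventuallyEq ?_
    filter_upwards [(isClosed_tsupport η).isOpen_compl.mem_nhds hx] with y hy
    rw [image_eq_zero_of_notMem_tsupport hy, zero_mul]

theorem exists_weak_derivative_stress_of_isPWeakSol (hn : 2 ≤ n) (p α : ℝ) (hα : 3 ≤ α)
    (hp1 : max (2 - 1 / (2 * α - 1)) (2 - 1 / CZ n (2 * (α - 1))) < p) (hp2 : p ≤ 2)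
    (Ω : Set (Euc n)) (hΩ : IsOpen Ω) (u f : Euc n → ℝ) (hu : ContDiffOn ℝ 1 u Ω)
    (hf : ContDiffOn ℝ 1 f Ω) (hsol : IsPWeakSol p Ω u f) (K : Set (Euc n)) (hK : IsCompact K)
    (hKΩ : K ⊆ Ω) :
    ∃ U, IsOpen U ∧ K ⊆ U ∧ U ⊆ Ω ∧ ∃ D : Fin n → Euc n → Euc n,
      (∀ i j (ψ : Euc n → ℝ), ContDiff ℝ 1 ψ → HasCompactSupport ψ → tsupport ψ ⊆ U →
        ∫ x, (stress p (gradient u x)) j * fderiv ℝ ψ x (EuclideanSpace.single i 1) =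
          - ∫ x, D i x j * ψ x) ∧
      ∀ i j L, IsCompact L → L ⊆ U →
        IntegrableOn (fun x => D i x j) L volume ∧
        IntegrableOn (fun x => |D i x j| ^ α) L volume := by
  obtain ⟨η, V, hη, hηc, hηs, -, -, hV, hKV, hVη, hV1⟩ := exists_cutoff K Ω hK hΩ hKΩ
  have hη1 : ContDiff ℝ 1 η := hη.of_le (by exact_mod_cast le_top)
  have hu' := contDiff_mul_of_tsupport_subset hΩ hη1 hηs hu
  have hf' := contDiff_mul_of_tsupport_subset hΩ hη1 hηs hf
  have hgrad : ∀ x ∈ V, gradient (fun x => η x * u x) x = gradient u x := by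
    intro x hx
    have : (fun x => η x * u x) =ᶠ[𝓝 x] u := by
      filter_upwards [hV.mem_nhds hx] with y hy
      rw [hV1 y hy, one_mul]
    rw [gradient, gradient, this.fderiv_eq]
  have hp : 1 < p := by
    have h2α : 0 < 2 * α - 1 := by linarith
    have h := (max_lt_iff.1 hp1).1
    have : 1 / (2 * α - 1) ≤ 1 := by rw [div_le_one h2α]; linarith
    linarith
  have heq : WeakDiv V (fun x => stress p (gradient (fun x => η x * u x) x))
      (fun x => η x * f x) := by
    refine weakDiv_of_smooth V hV _ _ ((continuous_stress p hp).comp (continuous_gradient _ hu'))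
      hf'.continuous fun ψ hψ hψc hψs => ?_
    have h := hsol ψ ⟨hψ, hψc, hψs.trans (hVη.trans hηs)⟩
    have hψ0 : ∀ x, x ∉ V → ψ x = 0 := fun x hx =>
      image_eq_zero_of_notMem_tsupport fun h => hx (hψs h)
    have hdψ0 : ∀ x, x ∉ V → fderiv ℝ ψ x = 0 := fderiv_eq_zero_of_notMem ψ V hψs
    have hVΩ : V ⊆ Ω := hVη.trans hηs
    rw [setIntegral_eq_integral_of_forall_compl_eq_zero,
      setIntegral_eq_integral_of_forall_compl_eq_zero] at h
    · rw [← integral_congr_ae (Filter.Eventually.of_forall fun x => ?_), h]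
      · refine integral_congr_ae (Filter.Eventually.of_forall fun x => ?_)
        by_cases hx : x ∈ V
        · simp [hV1 x hx]
        · simp [hψ0 x hx]
      · by_cases hx : x ∈ V
        · simp only [hgrad x hx, stress, map_smul, smul_eq_mul]
          rw [real_inner_comm, inner_gradient_left]
        · simp [gradient, hdψ0 x hx]
    · intro x hx
      rw [hψ0 x fun h => hx (hVΩ h), mul_zero]
    · intro x hx
      simp [gradient, hdψ0 x fun h => hx (hVΩ h)]
  obtain ⟨U, hU, hKU, hUV, D, hD, hDi⟩ := exists_weak_derivative_stress hn p α hα hp1 hp2 V hV _ _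
    hu' (hηc.mono fun x hx h0 => hx (by simp [h0])) hf'
    (hηc.mono fun x hx h0 => hx (by simp [h0])) heq K hK hKV
  refine ⟨U, hU, hKU, hUV.trans (hVη.trans hηs), D, fun i j ψ hψ hψc hψs => ?_, hDi⟩
  rw [← hD i j ψ hψ hψc hψs]
  refine integral_congr_ae (Filter.Eventually.of_forall fun x => ?_)
  by_cases hx : x ∈ U
  · simp only [hgrad x (hUV hx)]
  · simp [fderiv_eq_zero_of_notMem ψ U hψs x hx]

lemma exists_compact_exhaustion (Ω : Set (Euc n)) (hΩ : IsOpen Ω) :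
    ∃ K : ℕ → Set (Euc n), (∀ m, IsCompact (K m)) ∧ (∀ m, K m ⊆ Ω) ∧
      ∀ L, IsCompact L → L ⊆ Ω → ∃ m, L ⊆ K m := by
  have := hΩ.locallyCompactSpace
  let E := CompactExhaustion.choice Ω
  refine ⟨fun m => Subtype.val '' E m, fun m => (E.isCompact m).image continuous_subtype_val,
    fun m => by rintro _ ⟨x, -, rfl⟩; exact x.2, fun L hL hLΩ => ?_⟩
  have : IsCompact ((Subtype.val : Ω → Euc n) ⁻¹' L) :=
    Topology.IsInducing.subtypeVal.isCompact_preimage' hL (by simpa using hLΩ)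
  obtain ⟨m, hm⟩ := E.exists_superset_of_isCompact this
  exact ⟨m, fun x hx => ⟨⟨x, hLΩ hx⟩, hm hx, rfl⟩⟩

/-- Local weak derivatives with local integrability patch together to a global one. -/
theorem memW1Loc_of_local {Ω : Set (Euc n)} (hΩ : IsOpen Ω) {q : ℝ} (hq : 0 ≤ q) {g : Euc n → ℝ}
    (hg : ContinuousOn g Ω)
    (hloc : ∀ K, IsCompact K → K ⊆ Ω → ∃ U, IsOpen U ∧ K ⊆ U ∧ U ⊆ Ω ∧
      ∃ D : Fin n → Euc n → ℝ,
        (∀ i (ψ : Euc n → ℝ), ContDiff ℝ 1 ψ → HasCompactSupport ψ → tsupport ψ ⊆ U →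
          ∫ x, g x * fderiv ℝ ψ x (EuclideanSpace.single i 1) = - ∫ x, D i x * ψ x) ∧
        ∀ i L, IsCompact L → L ⊆ U →
          IntegrableOn (D i) L volume ∧ IntegrableOn (fun x => |D i x| ^ q) L volume) :
    MemW1Loc Ω q g := by
  classical
  obtain ⟨K, hK, hKΩ, hex⟩ := exists_compact_exhaustion Ω hΩ
  choose U hU hKU hUΩ D hD hDi using fun m => hloc (K m) (hK m) (hKΩ m)
  have huniq : ∀ i, ∀ᵐ x, ∀ k m, x ∈ U k ∩ U m → D k i x = D m i x := by
    intro i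
    rw [ae_all_iff]; intro k
    rw [ae_all_iff]; intro m
    have ho := (hU k).inter (hU m)
    have hli : ∀ l, U k ∩ U m ⊆ U l → LocallyIntegrableOn (D l i) (U k ∩ U m) volume := by
      intro l hl
      rw [locallyIntegrableOn_iff ho.isLocallyClosed]
      exact fun L hL hLc => (hDi l i L hLc (hL.trans hl)).1
    have := ho.ae_eq_zero_of_integral_contDiff_smul_eq_zero
      ((hli k inter_subset_left).sub (hli m inter_subset_right)) fun ψ hψ hψc hψs => ?_
    · filter_upwards [this] with x hx hxU
      exact sub_eq_zero.1 (hx hxU)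
    · have hψ1 : ContDiff ℝ 1 ψ := hψ.of_le (by exact_mod_cast le_top)
      have hint : ∀ l, U k ∩ U m ⊆ U l → Integrable (fun x => D l i x * ψ x) volume := by
        intro l hl
        have h1 := (hDi l i _ hψc.isCompact (hψs.trans hl)).1.mul_continuousOn
          hψ.continuous.continuousOn hψc.isCompact
        refine (integrableOn_iff_integrable_of_support_subset ?_).1 h1
        exact fun x hx => subset_tsupport ψ fun h0 => hx (by simp [h0])
      have e1 := hD k i ψ hψ1 hψc (hψs.trans inter_subset_left)
      have e2 := hD m i ψ hψ1 hψc (hψs.trans inter_subset_right)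
      have e3 := integral_sub (hint k inter_subset_left) (hint m inter_subset_right)
      simp only [smul_eq_mul, Pi.sub_apply, mul_comm (ψ _), sub_mul]
      linarith
  let N : Euc n → ℕ := fun x => if h : ∃ m, x ∈ K m then Nat.find h else 0
  have hN : ∀ m x, x ∈ K m → x ∈ K (N x) := fun m x hx => by
    have h : ∃ m, x ∈ K m := ⟨m, hx⟩
    simp only [N, dif_pos h]
    exact Nat.find_spec h
  have hd : ∀ i m, ∀ᵐ x, x ∈ K m → D (N x) i x = D m i x := by
    intro i m
    filter_upwards [huniq i] with x hx hxK
    exact hx _ _ ⟨hKU _ (hN m x hxK), hKU _ hxK⟩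
  refine ⟨fun i x => D (N x) i x, fun i ψ hψ => ?_, fun L hLΩ hL => ?_⟩
  · obtain ⟨hψ, hψc, hψs⟩ := hψ
    obtain ⟨m, hm⟩ := hex _ hψc.isCompact hψs
    have h1 := hD m i ψ (hψ.of_le (by exact_mod_cast le_top)) hψc (hm.trans (hKU m))
    rw [setIntegral_eq_integral_of_forall_compl_eq_zero,
      setIntegral_eq_integral_of_forall_compl_eq_zero]
    · refine h1.trans (congrArg Neg.neg (integral_congr_ae ?_))
      filter_upwards [hd i m] with x hx
      by_cases hxs : x ∈ tsupport ψ
      · rw [hx (hm hxs)]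
      · simp [image_eq_zero_of_notMem_tsupport hxs]
    · intro x hx
      rw [image_eq_zero_of_notMem_tsupport fun h => hx (hψs h), mul_zero]
    · intro x hx
      simp [pd, fderiv_eq_zero_of_notMem ψ Ω hψs x hx]
  · refine ⟨(ContinuousOn.rpow_const (hg.mono hLΩ).abs fun _ _ => Or.inr hq).integrableOn_compact hL,
      fun i => ?_⟩
    obtain ⟨m, hm⟩ := hex L hL hLΩ
    refine (hDi m i L hL (hm.trans (hKU m))).2.congr ?_
    filter_upwards [ae_restrict_of_ae (hd i m), ae_restrict_mem hL.measurableSet] with x hx hxL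
    rw [hx (hm hxL)]

/-- Theorem `stressfield`: `W^{1,α̃}_loc` regularity of the stress field
`|∇u|^{p-2} ∇u` for `p` close to `2`. -/
theorem stress_field_first_order
    {n : ℕ} (hn : 2 ≤ n) (Ω : Set (Euc n)) (hΩo : IsOpen Ω) (hΩc : IsConnected Ω)
    (p tα : ℝ) (β β' : ℝ≥0) (hβ : 0 < β) (hβ1 : β < 1) (hβ' : 0 < β') (hβ'1 : β' < 1)
    (u f : Euc n → ℝ) (hu : C1Loc Ω β u) (hsol : IsPWeakSol p Ω u f)
    (htα : 3 ≤ tα)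
    (hp1 : max (2 - 1 / (2 * tα - 1)) (2 - 1 / CZ n (2 * (tα - 1))) < p)
    (hp2 : p ≤ 2)
    (hf1 : MemW2Loc Ω (2 * (tα - 1) / 3) f) (hf2 : C1Loc Ω β' f) :
    ∀ i : Fin n, MemW1Loc Ω tα (fun x => ‖gradient u x‖ ^ (p - 2) * gradient u x i) := by
  have hu1 := hu.contDiffOn hΩo hβ
  have hf2' := hf2.contDiffOn hΩo hβ'
  have hp : 1 < p := by
    have h2α : 0 < 2 * tα - 1 := by linarith
    have h := (max_lt_iff.1 hp1).1
    have : 1 / (2 * tα - 1) ≤ 1 := by rw [div_le_one h2α]; linarith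
    linarith
  intro j
  refine memW1Loc_of_local hΩo (by linarith) ?_ fun K hK hKΩ => ?_
  · exact (EuclideanSpace.proj (𝕜 := ℝ) j).continuous.comp_continuousOn
      ((continuous_stress p hp).comp_continuousOn (hu.continuousOn_gradient hΩo hβ))
  · obtain ⟨U, hU, hKU, hUΩ, D, hD, hDi⟩ := exists_weak_derivative_stress_of_isPWeakSol hn p tα htα
      hp1 hp2 Ω hΩo u f hu1 hf2' hsol K hK hKΩ
    exact ⟨U, hU, hKU, hUΩ, fun i x => D i x j, fun i ψ h1 h2 h3 => hD i j ψ h1 h2 h3,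
      fun i L hL hLU => hDi i j L hL hLU⟩

end
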